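/- Let N ≥ 3 be an integer and let p ∈ (N/(N-2), p_c), where p_c = 1 + 4/(N-4+2√(N-1)). Let V : ℝ^N\{0} → ℝ satisfy condition (V₀) with exponents τ₀ > τ_p^* and β < (N-2)p - N. Then there exist ν₀ > 0 and a family of functions (u_ν)_{ν ∈ (0,ν₀]} such that: (i) for each ν ∈ (0,ν₀], u_ν is a ν-fast decaying solution of -Δu = V u^p on ℝ^N\{0}; (ii) lim_{|x|→0} u_ν(x)|x|^{2/(p-1)} = c_p; (iii) if 0 < ν ≤ ν' ≤ ν₀ then u_ν(x) ≤ u_{ν'}(x) for every x ≠ 0; (iv) for every x ≠ 0, the map ν ↦ u_ν(x) is continuous on (0,ν₀]; (v) for every compact set K ⊂ ℝ^N\{0}, sup_{x∈K} u_ν(x) → 0 as ν → 0⁺. -/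

import Mathlib

open Real MeasureTheory Filter Metric Set

noncomputable section

/-- The Euclidean Laplacian, as the sum of second directional derivatives along the
coordinate axes. -/
def lap {N : ℕ} (u : EuclideanSpace ℝ (Fin N) → ℝ) (x : EuclideanSpace ℝ (Fin N)) : ℝ :=
  ∑ i : Fin N,
    fderiv ℝ (fun y => fderiv ℝ u y (EuclideanSpace.single i (1:ℝ))) x
      (EuclideanSpace.single i (1:ℝ))

/-- `f` is locally Hölder continuous on `s`. -/
def LocHolderOn {N : ℕ} (f : EuclideanSpace ℝ (Fin N) → ℝ)
    (s : Set (EuclideanSpace ℝ (Fin N))) : Prop :=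
  ∀ x ∈ s, ∃ (C α : NNReal) (r : ℝ), 0 < r ∧ 0 < α ∧ α ≤ 1 ∧
    HolderOnWith C α f (Metric.ball x r ∩ s)

/-- The constant `c_p = ((2/(p-1))(N-2-2/(p-1)))^{1/(p-1)}`. -/
def cp (N : ℕ) (p : ℝ) : ℝ := (2 / (p - 1) * ((N:ℝ) - 2 - 2 / (p - 1))) ^ (1 / (p - 1))

/-- The Joseph–Lundgren exponent `p_c = 1 + 4/(N-4+2√(N-1))`. -/
def pc (N : ℕ) : ℝ := 1 + 4 / ((N:ℝ) - 4 + 2 * Real.sqrt ((N:ℝ) - 1))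

/-- The exponent `τ_p^*`. -/
def tauStar (N : ℕ) (p : ℝ) : ℝ :=
  (2 / (p - 1) - ((N:ℝ) - 2) / 2) -
    Real.sqrt ((2 / (p - 1) - ((N:ℝ) - 2) / 2) ^ 2 - 2 * ((N:ℝ) - 2 - 2 / (p - 1)))

/-- The surface measure `σ_{N-1}` of the unit sphere in `ℝ^N`,
expressed as `N` times the volume of the unit ball. -/
def sphereArea (N : ℕ) : ℝ :=
  (N : ℝ) * (volume (Metric.ball (0 : EuclideanSpace ℝ (Fin N)) 1)).toReal

/-- The normalizing constant `c_N = 1/((N-2)σ_{N-1})` of the fundamental solution of `-Δ`. -/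
def cGreen (N : ℕ) : ℝ := 1 / (((N:ℝ) - 2) * sphereArea N)

/-- `u` is a `ν`-fast decaying solution of `-Δ u = V u^p` in `ℝ^N \ {0}`. -/
def FastDecaySol (N : ℕ) (p : ℝ) (V u : EuclideanSpace ℝ (Fin N) → ℝ) (ν : ℝ) : Prop :=
  ContDiffOn ℝ 2 u {0}ᶜ ∧ (∀ x : EuclideanSpace ℝ (Fin N), x ≠ 0 → 0 < u x) ∧
  (∀ x : EuclideanSpace ℝ (Fin N), x ≠ 0 → -lap u x = V x * u x ^ p) ∧
  Tendsto (fun x : EuclideanSpace ℝ (Fin N) => u x * ‖x‖ ^ ((N:ℝ) - 2))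
    (Filter.comap (fun x => ‖x‖) Filter.atTop) (nhds ν)

/-- `u(x)|x|^{2/(p-1)} → c_p` as `x → 0`. -/
def SingAtOrigin (N : ℕ) (p : ℝ) (u : EuclideanSpace ℝ (Fin N) → ℝ) : Prop :=
  Tendsto (fun x : EuclideanSpace ℝ (Fin N) => u x * ‖x‖ ^ (2 / (p - 1)))
    (nhdsWithin 0 {0}ᶜ) (nhds (cp N p))

/-- Condition `(V₀)` with parameters `c₀, τ₀, c_∞, β`. -/
def V0cond (N : ℕ) (V : EuclideanSpace ℝ (Fin N) → ℝ) (c₀ τ₀ cinf β : ℝ) : Prop :=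
  LocHolderOn V {0}ᶜ ∧ 0 < c₀ ∧ 0 < τ₀ ∧
  (∀ x : EuclideanSpace ℝ (Fin N), x ≠ 0 → ‖x‖ ≤ 1 → |V x - 1| ≤ c₀ * ‖x‖ ^ τ₀) ∧
  1 ≤ cinf ∧
  ∀ x : EuclideanSpace ℝ (Fin N), x ≠ 0 → 0 ≤ V x ∧ V x ≤ cinf * (1 + ‖x‖) ^ β



/-- Short name for the Euclidean space. -/
abbrev Sp (N : ℕ) := EuclideanSpace ℝ (Fin N)

lemma rpow_antitone_exp {x y z : ℝ} (hx : 0 < x) (hxy : x ≤ y) (hz : z ≤ 0) : y ^ z ≤ x ^ z :=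
  Real.rpow_le_rpow_of_nonpos hx hxy hz

lemma ae_ne_zero {N : ℕ} (hN : 3 ≤ N) : ∀ᵐ y : Sp N, y ≠ 0 := by
  have : Nonempty (Fin N) := ⟨⟨0, by omega⟩⟩
  have : volume ({0} : Set (Sp N)) = 0 := measure_singleton 0
  exact compl_mem_ae_iff.mpr this

lemma meas_norm_rpow {N : ℕ} (s : ℝ) : Measurable (fun y : Sp N => ‖y‖ ^ s) :=
  measurable_norm.pow_const s

lemma meas_ker {N : ℕ} (x : Sp N) (s : ℝ) : Measurable (fun y : Sp N => ‖x - y‖ ^ s) := by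
  have : Measurable (fun y : Sp N => ‖x - y‖) := by fun_prop
  exact this.pow_const s

lemma intOn_ball_rpow {N : ℕ} (hN : 3 ≤ N) {s r : ℝ} (hs : s < N) :
    IntegrableOn (fun y : Sp N => ‖y‖ ^ (-s)) (ball 0 r) := by
  refine integrableOn_ball_of_norm_le_rpow (C := 1) (α := s) ?_ ?_ ?_ ?_
  · simp; omega
  · simpa using hs
  · filter_upwards with y
    rw [one_mul, Real.norm_of_nonneg (by positivity)]
  · exact (meas_norm_rpow _).aestronglyMeasurable

lemma intOn_ball_ker {N : ℕ} (hN : 3 ≤ N) {s r : ℝ} (hs : s < N) (x : Sp N) :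
    IntegrableOn (fun y : Sp N => ‖x - y‖ ^ (-s)) (ball x r) := by
  have h := intOn_ball_rpow hN hs (r := r)
  have h2 := (Measure.measurePreserving_sub_left (volume : Measure (Sp N)) x)
  have h3 := h2.integrableOn_comp_preimage (MeasurableEquiv.subLeft x).measurableEmbedding
    (s := ball 0 r) (f := fun y : Sp N => ‖y‖ ^ (-s))
  have h4 : (fun y : Sp N => x - y) ⁻¹' (ball 0 r) = ball x r := by
    ext y; simp [dist_eq_norm, norm_sub_rev]
  rw [h4] at h3
  exact h3.mpr h

lemma int_one_add {N : ℕ} {s : ℝ} (hs : (N:ℝ) < s) :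
    Integrable (fun y : Sp N => (1 + ‖y‖) ^ (-s)) := by
  apply integrable_one_add_norm
  simpa using hs

/-- Fundamental integrability. -/
lemma ker_int {N : ℕ} (hN : 3 ≤ N) {b : ℝ} (hb0 : 0 < b) (hb : b < (N:ℝ) - 2) {x : Sp N}
    (hx : x ≠ 0) : Integrable (fun y : Sp N => ‖x - y‖ ^ (2 - (N:ℝ)) * ‖y‖ ^ (-b - 2)) := by
  have hN' : (3:ℝ) ≤ N := by exact_mod_cast hN
  have hx0 : 0 < ‖x‖ := norm_pos_iff.mpr hx
  set c : ℝ := 2 / ‖x‖ + 1 with hc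
  have hc1 : 0 < c := by positivity
  have i1 : Integrable ((ball (0 : Sp N) ‖x‖).indicator (fun y : Sp N => ‖y‖ ^ (-b - 2))) := by
    rw [integrable_indicator_iff measurableSet_ball]
    have := intOn_ball_rpow hN (s := b + 2) (r := ‖x‖) (by linarith)
    rwa [neg_add'] at this
  have i2 : Integrable ((ball x ‖x‖).indicator (fun y : Sp N => ‖x - y‖ ^ (2 - (N:ℝ)))) := by
    rw [integrable_indicator_iff measurableSet_ball]
    have := intOn_ball_ker hN (s := (N:ℝ) - 2) (r := ‖x‖) (by linarith) x
    simpa using this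
  have i3 := int_one_add (N := N) (s := (N:ℝ) + b) (by linarith)
  have I := ((i1.const_mul ((‖x‖/2) ^ (2 - (N:ℝ)))).add
    (i2.const_mul ((‖x‖/2) ^ (-b - 2)))).add
      (i3.const_mul (((3:ℝ)⁻¹) ^ (2 - (N:ℝ)) * c ^ ((N:ℝ) + b)))
  refine I.mono' ?_ ?_
  · exact ((meas_ker x _).mul (meas_norm_rpow _)).aestronglyMeasurable
  · filter_upwards with y
    rw [Real.norm_of_nonneg (by positivity)]
    simp only [Pi.add_apply]
    have p1 : 0 ≤ (ball (0 : Sp N) ‖x‖).indicator (fun y : Sp N => ‖y‖ ^ (-b - 2)) y :=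
      indicator_nonneg (fun _ _ => by positivity) _
    have p2 : 0 ≤ (ball x ‖x‖).indicator (fun y : Sp N => ‖x - y‖ ^ (2 - (N:ℝ))) y :=
      indicator_nonneg (fun _ _ => by positivity) _
    have p1' : 0 ≤ (‖x‖/2) ^ (2 - (N:ℝ)) *
      (ball (0 : Sp N) ‖x‖).indicator (fun y : Sp N => ‖y‖ ^ (-b - 2)) y := by positivity
    have p2' : 0 ≤ (‖x‖/2) ^ (-b - 2) *
      (ball x ‖x‖).indicator (fun y : Sp N => ‖x - y‖ ^ (2 - (N:ℝ))) y := by positivity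
    have p3' : 0 ≤ ((3:ℝ)⁻¹) ^ (2 - (N:ℝ)) * c ^ ((N:ℝ) + b) * (1 + ‖y‖) ^ (-((N:ℝ) + b)) := by
      positivity
    have tri : ‖x‖ ≤ ‖x - y‖ + ‖y‖ := by
      have := norm_add_le (x - y) y; simpa using this
    have tri2 : ‖y‖ ≤ ‖x - y‖ + ‖x‖ := by
      have := norm_add_le (y - x) x; rw [norm_sub_rev] at this; simpa using this
    by_cases h1 : ‖y‖ < ‖x‖ / 2
    · have hy : y ∈ ball (0 : Sp N) ‖x‖ := by simp; linarith
      rw [indicator_of_mem hy] at p1' ⊢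
      have : ‖x - y‖ ^ (2 - (N:ℝ)) ≤ (‖x‖/2) ^ (2 - (N:ℝ)) :=
        rpow_antitone_exp (by positivity) (by linarith) (by linarith)
      have := mul_le_mul_of_nonneg_right this (show 0 ≤ ‖y‖ ^ (-b - 2) by positivity)
      linarith
    · by_cases h2 : ‖x - y‖ < ‖x‖ / 2
      · have hy : y ∈ ball x ‖x‖ := by rw [mem_ball, dist_eq_norm, norm_sub_rev]; linarith
        rw [indicator_of_mem hy] at p2' ⊢
        have : ‖y‖ ^ (-b - 2) ≤ (‖x‖/2) ^ (-b - 2) :=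
          rpow_antitone_exp (by positivity) (by linarith) (by linarith)
        have := mul_le_mul_of_nonneg_right this (show 0 ≤ ‖x - y‖ ^ (2 - (N:ℝ)) by positivity)
        linarith
      · have hy0 : 0 < ‖y‖ := by linarith
        have e1 : ‖x - y‖ ^ (2 - (N:ℝ)) ≤ (3⁻¹ * ‖y‖) ^ (2 - (N:ℝ)) :=
          rpow_antitone_exp (by positivity) (by linarith) (by linarith)
        have e2 : ‖y‖ ^ (-((N:ℝ) + b)) ≤ (c⁻¹ * (1 + ‖y‖)) ^ (-((N:ℝ) + b)) := by
          apply rpow_antitone_exp (by positivity) _ (by linarith)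
          rw [inv_mul_le_iff₀ hc1, hc]
          have : 1 ≤ 2 / ‖x‖ * ‖y‖ := by
            rw [div_mul_eq_mul_div, le_div_iff₀ hx0]; linarith
          linarith
        rw [mul_rpow (by positivity) (by positivity)] at e1 e2
        have e3 : (c⁻¹) ^ (-((N:ℝ) + b)) = c ^ ((N:ℝ) + b) := by
          rw [inv_rpow hc1.le, rpow_neg hc1.le, inv_inv]
        rw [e3] at e2
        have e4 : ‖y‖ ^ (-((N:ℝ) + b)) = ‖y‖ ^ (2 - (N:ℝ)) * ‖y‖ ^ (-b - 2) := by
          rw [← rpow_add hy0]; congr 1; ring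
        have f1 := mul_le_mul_of_nonneg_right e1 (show 0 ≤ ‖y‖ ^ (-b - 2) by positivity)
        rw [mul_assoc, ← e4] at f1
        have f2 := mul_le_mul_of_nonneg_left e2 (show 0 ≤ ((3:ℝ)⁻¹) ^ (2 - (N:ℝ)) by positivity)
        linarith

/-- Admissible densities. -/
def Adm {N : ℕ} (f : Sp N → ℝ) : Prop :=
  AEStronglyMeasurable f volume ∧ ∃ C b₁ b₂ : ℝ, 0 ≤ C ∧ 0 < b₁ ∧ b₁ < (N:ℝ) - 2 ∧ 0 < b₂ ∧
    b₂ < (N:ℝ) - 2 ∧ ∀ y : Sp N, y ≠ 0 → |f y| ≤ C * (‖y‖ ^ (-b₁ - 2) + ‖y‖ ^ (-b₂ - 2))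

/-- The (unnormalized) Newtonian potential. -/
def G {N : ℕ} (f : Sp N → ℝ) (x : Sp N) : ℝ := ∫ y : Sp N, ‖x - y‖ ^ (2 - (N:ℝ)) * f y

lemma Adm.int {N : ℕ} (hN : 3 ≤ N) {f : Sp N → ℝ} (hf : Adm f) {x : Sp N} (hx : x ≠ 0) :
    Integrable (fun y : Sp N => ‖x - y‖ ^ (2 - (N:ℝ)) * f y) := by
  obtain ⟨hm, C, b₁, b₂, hC, h1, h2, h3, h4, h⟩ := hf
  refine (((ker_int hN h1 h2 hx).add (ker_int hN h3 h4 hx)).const_mul C).mono'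
    ((meas_ker x _).aestronglyMeasurable.mul hm) ?_
  filter_upwards [ae_ne_zero hN] with y hy
  rw [norm_mul, Real.norm_of_nonneg (by positivity)]
  have := mul_le_mul_of_nonneg_left (h y hy) (show 0 ≤ ‖x - y‖ ^ (2 - (N:ℝ)) by positivity)
  simp only [Pi.add_apply, Real.norm_eq_abs]
  linarith

lemma Adm.of_le {N : ℕ} {f g : Sp N → ℝ} (hg : Adm g) (hm : AEStronglyMeasurable f volume)
    {K : ℝ} (h : ∀ y : Sp N, y ≠ 0 → |f y| ≤ K * |g y|) : Adm f := by
  obtain ⟨_, C, b₁, b₂, hC, h1, h2, h3, h4, h'⟩ := hg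
  refine ⟨hm, |K| * C, b₁, b₂, by positivity, h1, h2, h3, h4, fun y hy => ?_⟩
  have a := h y hy
  have b := h' y hy
  have c : K * |g y| ≤ |K| * |g y| := mul_le_mul_of_nonneg_right (le_abs_self K) (abs_nonneg _)
  have d := mul_le_mul_of_nonneg_left b (abs_nonneg K)
  linarith

lemma Adm.const_mul {N : ℕ} {f : Sp N → ℝ} (hf : Adm f) (c : ℝ) : Adm (fun y => c * f y) :=
  hf.of_le (hf.1.const_mul c) (K := |c|) (fun y _ => by rw [abs_mul])

lemma Adm.of_le_two {N : ℕ} {f : Sp N → ℝ} (hm : AEStronglyMeasurable f volume)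
    {C b₁ b₂ : ℝ} (hC : 0 ≤ C) (h1 : 0 < b₁) (h2 : b₁ < (N:ℝ) - 2) (h3 : 0 < b₂)
    (h4 : b₂ < (N:ℝ) - 2)
    (h : ∀ y : Sp N, y ≠ 0 → |f y| ≤ C * (‖y‖ ^ (-b₁ - 2) + ‖y‖ ^ (-b₂ - 2))) : Adm f :=
  ⟨hm, C, b₁, b₂, hC, h1, h2, h3, h4, h⟩

lemma adm_pow {N : ℕ} {b : ℝ} (h1 : 0 < b) (h2 : b < (N:ℝ) - 2) :
    Adm (fun y : Sp N => ‖y‖ ^ (-b - 2)) := by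
  refine Adm.of_le_two (meas_norm_rpow _).aestronglyMeasurable (C := 1) zero_le_one h1 h2 h1 h2 ?_
  intro y _
  have : 0 ≤ ‖y‖ ^ (-b - 2) := by positivity
  rw [abs_of_nonneg this]; linarith

lemma rpow_le_add_of_between {r s t u : ℝ} (hr : 0 < r) (h1 : s ≤ t) (h2 : t ≤ u) :
    r ^ t ≤ r ^ s + r ^ u := by
  have p1 : 0 ≤ r ^ s := by positivity
  have p2 : 0 ≤ r ^ u := by positivity
  rcases le_total r 1 with h | h
  · have := Real.rpow_le_rpow_of_exponent_ge hr h h1; linarith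
  · have := Real.rpow_le_rpow_of_exponent_le h h2; linarith

lemma Adm.add {N : ℕ} {f g : Sp N → ℝ} (hf : Adm f) (hg : Adm g) :
    Adm (fun y => f y + g y) := by
  obtain ⟨hm, C, b₁, b₂, hC, h1, h2, h3, h4, h⟩ := hf
  obtain ⟨hm', C', b₁', b₂', hC', h1', h2', h3', h4', h'⟩ := hg
  set m := min (min b₁ b₂) (min b₁' b₂') with hm0
  set M := max (max b₁ b₂) (max b₁' b₂') with hM0
  have k1 : m ≤ b₁ := by simp [m]
  have k2 : m ≤ b₂ := by simp [m]
  have k3 : m ≤ b₁' := by simp [m]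
  have k4 : m ≤ b₂' := by simp [m]
  have l1 : b₁ ≤ M := by simp [M]
  have l2 : b₂ ≤ M := by simp [M]
  have l3 : b₁' ≤ M := by simp [M]
  have l4 : b₂' ≤ M := by simp [M]
  have m0 : 0 < m := by simp [m, *]
  have M0 : M < (N:ℝ) - 2 := by simp only [M, max_lt_iff]; exact ⟨⟨h2, h4⟩, h2', h4'⟩
  refine Adm.of_le_two (hm.add hm') (C := 2 * C + 2 * C') (b₁ := M) (b₂ := m) (by positivity)
    (by linarith) M0 m0 (by linarith) ?_
  intro y hy
  have hy0 : 0 < ‖y‖ := norm_pos_iff.mpr hy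
  have key : ∀ t, m ≤ t → t ≤ M → ‖y‖ ^ (-t - 2) ≤ ‖y‖ ^ (-M - 2) + ‖y‖ ^ (-m - 2) :=
    fun t ht ht' => rpow_le_add_of_between hy0 (by linarith) (by linarith)
  have a := h y hy
  have b := h' y hy
  have a' := mul_le_mul_of_nonneg_left (add_le_add (key b₁ k1 l1) (key b₂ k2 l2)) hC
  have b' := mul_le_mul_of_nonneg_left (add_le_add (key b₁' k3 l3) (key b₂' k4 l4)) hC'
  have := abs_add_le (f y) (g y)
  linarith

lemma Adm.sub {N : ℕ} {f g : Sp N → ℝ} (hf : Adm f) (hg : Adm g) :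
    Adm (fun y => f y - g y) := by
  have := hf.add (hg.const_mul (-1))
  simpa [sub_eq_add_neg] using this

lemma Adm.of_abs_le {N : ℕ} {f g : Sp N → ℝ} (hg : Adm g) (hm : AEStronglyMeasurable f volume)
    (h : ∀ y : Sp N, y ≠ 0 → |f y| ≤ g y) : Adm f :=
  hg.of_le hm (K := 1) (fun y hy => by rw [one_mul]; exact (h y hy).trans (le_abs_self _))

lemma G_mono {N : ℕ} (hN : 3 ≤ N) {f g : Sp N → ℝ} (hf : Adm f) (hg : Adm g)
    (h : ∀ y : Sp N, y ≠ 0 → f y ≤ g y) {x : Sp N} (hx : x ≠ 0) : G f x ≤ G g x := by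
  apply integral_mono_ae (hf.int hN hx) (hg.int hN hx)
  filter_upwards [ae_ne_zero hN] with y hy
  exact mul_le_mul_of_nonneg_left (h y hy) (by positivity)

lemma G_congr {N : ℕ} (hN : 3 ≤ N) {f g : Sp N → ℝ}
    (h : ∀ y : Sp N, y ≠ 0 → f y = g y) (x : Sp N) : G f x = G g x := by
  apply integral_congr_ae
  filter_upwards [ae_ne_zero hN] with y hy
  simp only [h y hy]

lemma G_add {N : ℕ} (hN : 3 ≤ N) {f g : Sp N → ℝ} (hf : Adm f) (hg : Adm g)
    {x : Sp N} (hx : x ≠ 0) : G (fun y => f y + g y) x = G f x + G g x := by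
  unfold G
  rw [← integral_add (hf.int hN hx) (hg.int hN hx)]
  simp only [mul_add]

lemma G_sub {N : ℕ} (hN : 3 ≤ N) {f g : Sp N → ℝ} (hf : Adm f) (hg : Adm g)
    {x : Sp N} (hx : x ≠ 0) : G (fun y => f y - g y) x = G f x - G g x := by
  unfold G
  rw [← integral_sub (hf.int hN hx) (hg.int hN hx)]
  simp only [mul_sub]

lemma G_const_mul {N : ℕ} (c : ℝ) (f : Sp N → ℝ) (x : Sp N) :
    G (fun y => c * f y) x = c * G f x := by
  unfold G
  rw [← integral_const_mul]
  congr 1; ext y; ring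

lemma G_nonneg {N : ℕ} (hN : 3 ≤ N) {f : Sp N → ℝ} (h : ∀ y : Sp N, y ≠ 0 → 0 ≤ f y)
    (x : Sp N) : 0 ≤ G f x := by
  apply integral_nonneg_of_ae
  filter_upwards [ae_ne_zero hN] with y hy
  have := h y hy
  simp only [Pi.zero_apply]; positivity

/-- dominated convergence for `G`. -/
lemma G_tendsto {N : ℕ} (hN : 3 ≤ N) {ι : Type*} {l : Filter ι} [l.IsCountablyGenerated]
    {F : ι → Sp N → ℝ} {f g : Sp N → ℝ} (hg : Adm g)
    (hm : ∀ᶠ n in l, AEStronglyMeasurable (F n) volume)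
    (hb : ∀ᶠ n in l, ∀ y : Sp N, y ≠ 0 → |F n y| ≤ g y)
    (hlim : ∀ y : Sp N, y ≠ 0 → Tendsto (fun n => F n y) l (nhds (f y))) {x : Sp N} (hx : x ≠ 0) :
    Tendsto (fun n => G (F n) x) l (nhds (G f x)) := by
  apply tendsto_integral_filter_of_dominated_convergence
    (fun y : Sp N => ‖x - y‖ ^ (2 - (N:ℝ)) * g y)
  · filter_upwards [hm] with n hn
    exact (meas_ker x _).aestronglyMeasurable.mul hn
  · filter_upwards [hb] with n hn
    filter_upwards [ae_ne_zero hN] with y hy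
    rw [norm_mul, Real.norm_of_nonneg (by positivity)]
    exact mul_le_mul_of_nonneg_left (hn y hy) (by positivity)
  · exact hg.int hN hx
  · filter_upwards [ae_ne_zero hN] with y hy
    exact (hlim y hy).const_mul _

/-- scaling of `G`. -/
lemma G_scale {N : ℕ} {f : Sp N → ℝ} {l : ℝ} (hl : 0 < l) (x : Sp N) :
    G (fun y => f (l • y)) x = l ^ (-2 : ℝ) * G f (l • x) := by
  unfold G
  have h := Measure.integral_comp_smul (volume : Measure (Sp N))
    (fun y : Sp N => ‖l • x - y‖ ^ (2 - (N:ℝ)) * f y) l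
  have e : ∀ y : Sp N, ‖l • x - l • y‖ ^ (2 - (N:ℝ)) * f (l • y)
      = l ^ (2 - (N:ℝ)) * (‖x - y‖ ^ (2 - (N:ℝ)) * f (l • y)) := by
    intro y
    rw [← smul_sub, norm_smul, Real.norm_of_nonneg hl.le, mul_rpow hl.le (norm_nonneg _)]; ring
  simp only [e] at h
  rw [integral_const_mul] at h
  have hl2 : l ^ (2 - (N:ℝ)) ≠ 0 := by positivity
  have : |(l ^ Module.finrank ℝ (Sp N))⁻¹| = l ^ (2 - (N:ℝ)) * l ^ (-2 : ℝ) := by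
    rw [← rpow_add hl, abs_of_pos (by positivity)]
    simp only [finrank_euclideanSpace, Fintype.card_fin]
    rw [← rpow_natCast, ← rpow_neg hl.le]; congr 1; ring
  rw [this, smul_eq_mul, mul_assoc] at h
  exact mul_left_cancel₀ hl2 h

lemma G_pos {N : ℕ} (hN : 3 ≤ N) {f : Sp N → ℝ} (hf : Adm f) (h : ∀ y : Sp N, y ≠ 0 → 0 ≤ f y)
    {r : ℝ} (hr : 0 < r) (hp : ∀ y : Sp N, y ≠ 0 → ‖y‖ < r → 0 < f y)
    {x : Sp N} (hx : x ≠ 0) : 0 < G f x := by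
  unfold G
  rw [integral_pos_iff_support_of_nonneg_ae _ (hf.int hN hx)]
  · have hx0 : 0 < ‖x‖ := norm_pos_iff.mpr hx
    have hsub : ball (0 : Sp N) (min r ‖x‖) \ {0} ⊆
        Function.support (fun y : Sp N => ‖x - y‖ ^ (2 - (N:ℝ)) * f y) := by
      intro y hy
      obtain ⟨hy1, hy2⟩ := hy
      rw [mem_ball_zero_iff, lt_min_iff] at hy1
      have hy2' : y ≠ 0 := hy2
      have hxy : x - y ≠ 0 := by
        intro h0
        rw [sub_eq_zero] at h0
        rw [h0] at hy1; exact lt_irrefl _ hy1.2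
      have := hp y hy2' hy1.1
      have h3 : 0 < ‖x - y‖ := norm_pos_iff.mpr hxy
      simp only [Function.mem_support]
      positivity
    refine lt_of_lt_of_le ?_ (measure_mono hsub)
    have : Nonempty (Fin N) := ⟨⟨0, by omega⟩⟩
    rw [measure_sdiff_null (measure_singleton 0)]
    exact measure_ball_pos _ _ (by positivity)
  · filter_upwards [ae_ne_zero hN] with y hy
    have := h y hy
    simp only [Pi.zero_apply]; positivity


section cvdefs
variable {N : ℕ} {F : Type*} [NormedAddCommGroup F] [NormedSpace ℝ F]

/-- convolution of a kernel with a scalar density. -/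
def cv (K : Sp N → F) (f : Sp N → ℝ) (x : Sp N) : F := ∫ y : Sp N, f y • K (x - y)

/-- rescaled kernel. -/
def sc (t s : ℝ) (K : Sp N → F) (z : Sp N) : F := s ^ t • K (s • z)

lemma cv_eq_conv (K : Sp N → F) (f : Sp N → ℝ) (x : Sp N) :
    cv K f x = convolution f K (ContinuousLinearMap.lsmul ℝ ℝ) volume x := rfl

lemma cv_hasFDerivAt [CompleteSpace F] {K : Sp N → F} {f : Sp N → ℝ} (hK : ContDiff ℝ 1 K)
    (hc : HasCompactSupport K) (hf : LocallyIntegrable f volume) (x : Sp N) :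
    HasFDerivAt (cv K f) (cv (fderiv ℝ K) f x) x := by
  have := hc.hasFDerivAt_convolution_right (ContinuousLinearMap.lsmul ℝ ℝ) hf hK x
  have e : cv (fderiv ℝ K) f x = convolution f (fderiv ℝ K)
      ((ContinuousLinearMap.lsmul ℝ ℝ).precompR (Sp N)) volume x := by
    unfold cv convolution
    congr 1
  rw [e]
  exact this

lemma cv_integrable {K : Sp N → F} {f : Sp N → ℝ} (hK : Continuous K)
    (hc : HasCompactSupport K) (hf : LocallyIntegrable f volume) (x : Sp N) :
    Integrable (fun y : Sp N => f y • K (x - y)) := by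
  have := hc.convolutionExists_right (ContinuousLinearMap.lsmul ℝ ℝ) hf hK x
  exact this

lemma cv_continuous {K : Sp N → F} {f : Sp N → ℝ} (hK : Continuous K)
    (hc : HasCompactSupport K) (hf : LocallyIntegrable f volume) : Continuous (cv K f) := by
  have := hc.continuous_convolution_right (ContinuousLinearMap.lsmul ℝ ℝ) hf hK
  exact this

lemma cv_bound {K : Sp N → F} {f : Sp N → ℝ} {x : Sp N} {C B R : ℝ} (hC : 0 ≤ C) (hB : 0 ≤ B)
    (hR : 0 < R)
    (hK : ∀ z, ‖K z‖ ≤ C) (hsupp : ∀ z, R ≤ ‖z‖ → K z = 0)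
    (hf : ∀ y, K (x - y) ≠ 0 → |f y| ≤ B) :
    ‖cv K f x‖ ≤ C * B * (R ^ (N:ℝ) * (volume (ball (0 : Sp N) 1)).toReal) := by
  have h1 : ‖cv K f x‖ ≤ ∫ y : Sp N, (ball x R).indicator (fun _ => B * C) y := by
    apply norm_integral_le_of_norm_le
    · rw [integrable_indicator_iff measurableSet_ball]
      exact integrableOn_const (by exact measure_ball_lt_top.ne)
    · filter_upwards with y
      by_cases h0 : K (x - y) = 0
      · simp only [h0, smul_zero, norm_zero]
        exact indicator_nonneg (fun _ _ => by positivity) _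
      · have hy : y ∈ ball x R := by
          rw [mem_ball, dist_eq_norm, norm_sub_rev]
          by_contra hcon
          exact h0 (hsupp _ (not_lt.mp hcon))
        rw [indicator_of_mem hy, norm_smul]
        exact mul_le_mul (hf y h0) (hK _) (norm_nonneg _) hB
  rw [integral_indicator measurableSet_ball, setIntegral_const] at h1
  have h2 : (volume : Measure (Sp N)).real (ball x R)
      = R ^ (N:ℝ) * (volume (ball (0 : Sp N) 1)).toReal := by
    rw [Measure.real, Measure.addHaar_ball_of_pos _ _ hR, ENNReal.toReal_mul,
      ENNReal.toReal_ofReal (by positivity)]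
    simp
  rw [h2, smul_eq_mul] at h1
  linarith

end cvdefs

lemma Adm.locallyIntegrable {N : ℕ} (hN : 3 ≤ N) {f : Sp N → ℝ} (hf : Adm f) :
    LocallyIntegrable f volume := by
  obtain ⟨hm, C, b₁, b₂, hC, h1, h2, h3, h4, h⟩ := hf
  have hN' : (3:ℝ) ≤ N := by exact_mod_cast hN
  have hd : 1 ≤ Module.finrank ℝ (Sp N) := by simp; omega
  have key : ∀ b, 0 < b → b < (N:ℝ) - 2 →
      LocallyIntegrable (fun y : Sp N => ‖y‖ ^ (-b - 2)) volume := by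
    intro b hb hb'
    refine locallyIntegrable_of_norm_le_rpow (C := 1) (α := b + 2) hd ?_ ?_ ?_
    · simp; linarith
    · filter_upwards with y
      rw [Real.norm_of_nonneg (by positivity), one_mul, neg_add']
    · exact (meas_norm_rpow _).aestronglyMeasurable
  have := ((key b₁ h1 h2).add (key b₂ h3 h4)).smul C
  refine this.mono hm ?_
  filter_upwards [ae_ne_zero hN] with y hy
  have := h y hy
  simp only [Pi.smul_apply, Pi.add_apply, smul_eq_mul]
  rw [Real.norm_eq_abs]
  exact this.trans (le_abs_self _)

/-- local boundedness away from the origin. -/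
lemma Adm.bdd {N : ℕ} {f : Sp N → ℝ} (hf : Adm f) {ρ : ℝ} (hρ : 0 < ρ) :
    ∃ B, 0 ≤ B ∧ ∀ y : Sp N, ρ ≤ ‖y‖ → |f y| ≤ B := by
  obtain ⟨hm, C, b₁, b₂, hC, h1, h2, h3, h4, h⟩ := hf
  refine ⟨C * (ρ ^ (-b₁ - 2) + ρ ^ (-b₂ - 2)), by positivity, fun y hy => ?_⟩
  have hy0 : y ≠ 0 := norm_pos_iff.mp (hρ.trans_le hy)
  refine (h y hy0).trans ?_
  exact mul_le_mul_of_nonneg_left (add_le_add (rpow_antitone_exp hρ hy (by linarith))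
    (rpow_antitone_exp hρ hy (by linarith))) hC

/-- decay at infinity. -/
lemma Adm.decay {N : ℕ} {f : Sp N → ℝ} (hf : Adm f) :
    ∃ B η : ℝ, 0 ≤ B ∧ 0 < η ∧ ∀ y : Sp N, 1 ≤ ‖y‖ → |f y| ≤ B * ‖y‖ ^ (-2 - η) := by
  obtain ⟨hm, C, b₁, b₂, hC, h1, h2, h3, h4, h⟩ := hf
  refine ⟨C * 2, min b₁ b₂, by positivity, lt_min h1 h3, fun y hy => ?_⟩
  have hy0 : y ≠ 0 := norm_pos_iff.mp (zero_lt_one.trans_le hy)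
  refine (h y hy0).trans ?_
  have k1 : ‖y‖ ^ (-b₁ - 2) ≤ ‖y‖ ^ (-2 - min b₁ b₂) :=
    Real.rpow_le_rpow_of_exponent_le hy (by linarith [min_le_left b₁ b₂])
  have k2 : ‖y‖ ^ (-b₂ - 2) ≤ ‖y‖ ^ (-2 - min b₁ b₂) :=
    Real.rpow_le_rpow_of_exponent_le hy (by linarith [min_le_right b₁ b₂])
  have := mul_le_mul_of_nonneg_left (add_le_add k1 k2) hC
  linarith

section est
variable {N : ℕ} {F : Type*} [NormedAddCommGroup F] [NormedSpace ℝ F]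

/-- Kernels vanishing near zero and homogeneous of degree `-t` near infinity. -/
def Hom (t : ℝ) (Ψ : Sp N → F) : Prop :=
  (∀ z, ‖z‖ < 1 → Ψ z = 0) ∧ ∀ s : ℝ, 1 ≤ s → ∀ z, 2 < ‖z‖ → s ^ t • Ψ (s • z) = Ψ z

/-- the dyadic truncations. -/
def kn (t : ℝ) (Ψ : Sp N → F) (n : ℕ) (z : Sp N) : F :=
  sc t ((2:ℝ) ^ (n:ℝ)) Ψ z - sc t ((2:ℝ) ^ (-(n:ℝ))) Ψ z

/-- the basic annular block. -/
def blk (t : ℝ) (Ψ : Sp N → F) (z : Sp N) : F := sc t 2 Ψ z - Ψ z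

lemma sc_sc {t s r : ℝ} (hs : 0 < s) (hr : 0 < r) (Ψ : Sp N → F) (z : Sp N) :
    sc t s (sc t r Ψ) z = sc t (r * s) Ψ z := by
  simp only [sc, smul_smul]
  rw [mul_rpow hr.le hs.le, mul_comm (s ^ t)]

lemma sc_one (t : ℝ) (Ψ : Sp N → F) (z : Sp N) : sc t 1 Ψ z = Ψ z := by simp [sc]

lemma kn_succ_sub (t : ℝ) (Ψ : Sp N → F) (n : ℕ) (z : Sp N) :
    kn t Ψ (n+1) z - kn t Ψ n z
      = sc t ((2:ℝ) ^ (n:ℝ)) (blk t Ψ) z + sc t ((2:ℝ) ^ (-(n:ℝ) - 1)) (blk t Ψ) z := by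
  have h : ∀ s : ℝ, 0 < s → sc t s (blk t Ψ) z = sc t (2 * s) Ψ z - sc t s Ψ z := by
    intro s hs
    rw [← sc_sc hs two_pos]
    simp only [sc, blk, smul_sub]
  rw [h _ (by positivity), h _ (by positivity)]
  simp only [kn]
  have e1 : (2:ℝ) * 2 ^ (n:ℝ) = 2 ^ ((n + 1 : ℕ) : ℝ) := by
    push_cast; rw [rpow_add two_pos, rpow_one]; ring
  have e2 : (2:ℝ) * 2 ^ (-(n:ℝ) - 1) = 2 ^ (-(n:ℝ)) := by
    rw [rpow_sub two_pos, rpow_one]; ring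
  have e3 : (-(n:ℝ) - 1) = -((n + 1 : ℕ) : ℝ) := by push_cast; ring
  rw [e1, e2, e3]
  abel

lemma blk_zero_near {t : ℝ} {Ψ : Sp N → F} (h : Hom t Ψ) {z : Sp N} (hz : ‖z‖ < 1/2) :
    blk t Ψ z = 0 := by
  simp only [blk, sc]
  rw [h.1 z (by linarith), h.1 ((2:ℝ) • z) (by rw [norm_smul]; norm_num; linarith)]
  simp

lemma blk_zero_far {t : ℝ} {Ψ : Sp N → F} (h : Hom t Ψ) {z : Sp N} (hz : 2 < ‖z‖) :
    blk t Ψ z = 0 := by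
  simp only [blk, sc]
  rw [h.2 2 (by norm_num) z hz, sub_self]

lemma hcs_of_zero {K : Sp N → F} {R : ℝ} (h : ∀ z, R < ‖z‖ → K z = 0) : HasCompactSupport K := by
  apply HasCompactSupport.intro (isCompact_closedBall (0 : Sp N) R)
  intro z hz
  apply h
  simpa using hz

lemma kn_zero_far {t : ℝ} {Ψ : Sp N → F} (h : Hom t Ψ) {n : ℕ} {z : Sp N}
    (hz : 2 * 2 ^ (n:ℝ) < ‖z‖) : kn t Ψ n z = 0 := by
  set s : ℝ := (2:ℝ) ^ (n:ℝ) with hs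
  have hs1 : 1 ≤ s := Real.one_le_rpow (by norm_num) (by positivity)
  have hs0 : 0 < s := by linarith
  have e : (2:ℝ) ^ (-(n:ℝ)) = s⁻¹ := by rw [rpow_neg (by norm_num)]
  simp only [kn, ← hs, e]
  have h2 : 2 < ‖s⁻¹ • z‖ := by
    rw [norm_smul, norm_inv, Real.norm_of_nonneg hs0.le]
    rw [lt_inv_mul_iff₀ hs0]; linarith
  have h3 := h.2 (s * s) (by nlinarith) (s⁻¹ • z) h2
  simp only [sc]
  rw [← h3, smul_smul, smul_smul, ← mul_rpow (by positivity) (by positivity)]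
  have e1 : s⁻¹ * (s * s) = s := by field_simp
  have e2 : s * s * s⁻¹ = s := by field_simp
  rw [e1, e2, sub_self]

lemma kn_continuous {t : ℝ} {Ψ : Sp N → F} (h : Continuous Ψ) (n : ℕ) :
    Continuous (kn t Ψ n) := by
  unfold kn sc; fun_prop

lemma sc_blk_continuous {t : ℝ} {Ψ : Sp N → F} (h : Continuous Ψ) (s : ℝ) :
    Continuous (sc t s (blk t Ψ)) := by
  unfold blk sc; fun_prop

lemma sc_blk_zero_far {t : ℝ} {Ψ : Sp N → F} (h : Hom t Ψ) {s : ℝ} (hs : 0 < s) {z : Sp N}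
    (hz : 2 / s < ‖z‖) : sc t s (blk t Ψ) z = 0 := by
  simp only [sc]
  rw [blk_zero_far h, smul_zero]
  rw [norm_smul, Real.norm_of_nonneg hs.le]
  rw [div_lt_iff₀ hs] at hz; linarith

lemma sc_blk_zero_near {t : ℝ} {Ψ : Sp N → F} (h : Hom t Ψ) {s : ℝ} (hs : 0 < s) {z : Sp N}
    (hz : ‖z‖ < 1 / (2 * s)) : sc t s (blk t Ψ) z = 0 := by
  simp only [sc]
  rw [blk_zero_near h, smul_zero]
  rw [norm_smul, Real.norm_of_nonneg hs.le]
  rw [lt_div_iff₀ (by positivity)] at hz; linarith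

lemma blk_bound {t : ℝ} {Ψ : Sp N → F} (hc : Continuous Ψ) (h : Hom t Ψ) :
    ∃ C, 0 ≤ C ∧ ∀ z, ‖blk t Ψ z‖ ≤ C := by
  have hcs : HasCompactSupport (blk t Ψ) := hcs_of_zero (R := 2) (fun z hz => blk_zero_far h hz)
  have hcont : Continuous (blk t Ψ) := by unfold blk sc; fun_prop
  obtain ⟨C, hC⟩ := hcont.bounded_above_of_compact_support hcs
  exact ⟨C, (norm_nonneg _).trans (hC 0), hC⟩

lemma cv_kn_diff {t : ℝ} {Ψ : Sp N → F} (hc : Continuous Ψ) (h : Hom t Ψ) {f : Sp N → ℝ}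
    (hf : LocallyIntegrable f volume) (n : ℕ) (x : Sp N) :
    cv (kn t Ψ (n+1)) f x - cv (kn t Ψ n) f x
      = cv (sc t ((2:ℝ) ^ (n:ℝ)) (blk t Ψ)) f x
        + cv (sc t ((2:ℝ) ^ (-(n:ℝ) - 1)) (blk t Ψ)) f x := by
  have i1 : ∀ m : ℕ, Integrable (fun y : Sp N => f y • kn t Ψ m (x - y)) := fun m =>
    cv_integrable (kn_continuous hc m) (hcs_of_zero (fun z hz => kn_zero_far h hz)) hf x
  have i2 : ∀ s : ℝ, 0 < s → Integrable (fun y : Sp N => f y • sc t s (blk t Ψ) (x - y)) :=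
    fun s hs => cv_integrable (sc_blk_continuous hc s)
      (hcs_of_zero (fun z hz => sc_blk_zero_far h hs hz)) hf x
  unfold cv
  rw [← integral_sub (i1 _) (i1 _), ← integral_add (i2 _ (by positivity)) (i2 _ (by positivity))]
  congr 1; ext y
  rw [← smul_sub, ← smul_add, kn_succ_sub]

/-- bound for one block, with `f` bounded by `B` on the relevant annulus. -/
lemma blk_cv_bound {t : ℝ} {Ψ : Sp N → F} (h : Hom t Ψ) {C : ℝ}
    (hC : 0 ≤ C) (hb : ∀ z, ‖blk t Ψ z‖ ≤ C) {f : Sp N → ℝ} {s B : ℝ} (hs : 0 < s) (hB : 0 ≤ B)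
    {x : Sp N} (hf : ∀ y, 1 / (2 * s) ≤ ‖x - y‖ → ‖x - y‖ ≤ 2 / s → |f y| ≤ B) :
    ‖cv (sc t s (blk t Ψ)) f x‖ ≤
      (C * (3 ^ (N:ℝ) * (volume (ball (0 : Sp N) 1)).toReal)) * (s ^ (t - N) * B) := by
  have h1 := cv_bound (K := sc t s (blk t Ψ)) (f := f) (x := x) (C := s ^ t * C) (B := B)
    (R := 3 / s) (by positivity) hB (by positivity) ?_ ?_ ?_
  · refine h1.trans (le_of_eq ?_)
    rw [div_rpow (by norm_num) hs.le, rpow_sub hs]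
    have : s ^ (N:ℝ) ≠ 0 := by positivity
    field_simp
  · intro z
    simp only [sc, norm_smul]
    rw [Real.norm_of_nonneg (by positivity)]
    exact mul_le_mul_of_nonneg_left (hb _) (by positivity)
  · intro z hz
    apply sc_blk_zero_far h hs
    refine lt_of_lt_of_le ?_ hz
    gcongr; norm_num
  · intro y hy
    apply hf
    · by_contra hcon
      exact hy (sc_blk_zero_near h hs (not_le.mp hcon))
    · by_contra hcon
      exact hy (sc_blk_zero_far h hs (not_le.mp hcon))

lemma two_rpow_tendsto : Tendsto (fun n : ℕ => (2:ℝ) ^ (n:ℝ)) atTop atTop := by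
  have := tendsto_pow_atTop_atTop_of_one_lt (r := (2:ℝ)) (by norm_num)
  simpa [Real.rpow_natCast] using this

/-- far blocks -/
lemma far_est {t : ℝ} (ht : (N:ℝ) - 2 ≤ t) {Ψ : Sp N → F} (hc : Continuous Ψ)
    (h : Hom t Ψ) {f : Sp N → ℝ} (hf : Adm f) (M : ℝ) :
    ∃ C r n₀, 0 ≤ C ∧ 0 < r ∧ r < 1 ∧ ∀ x : Sp N, ‖x‖ ≤ M → ∀ n : ℕ, n₀ ≤ n →
      ‖cv (sc t ((2:ℝ) ^ (-(n:ℝ) - 1)) (blk t Ψ)) f x‖ ≤ C * r ^ n := by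
  obtain ⟨C, hC, hb⟩ := blk_bound hc h
  obtain ⟨B, η, hB, hη, hdec⟩ := hf.decay
  obtain ⟨n₀, hn₀⟩ := (two_rpow_tendsto.eventually_ge_atTop (2 * |M| + 2)).exists_forall_of_atTop
  refine ⟨(C * (3 ^ (N:ℝ) * (volume (ball (0 : Sp N) 1)).toReal)) * (B * 4 ^ (2 + η)),
    2 ^ (-η), n₀, by positivity, by positivity,
    Real.rpow_lt_one_of_one_lt_of_neg (by norm_num) (by linarith), fun x hx n hn => ?_⟩
  set s : ℝ := (2:ℝ) ^ (-(n:ℝ) - 1) with hs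
  have hs0 : 0 < s := by positivity
  have hs1 : 1 / (2 * s) = 2 ^ (n:ℝ) := by
    rw [hs, rpow_sub two_pos, rpow_neg (by norm_num), rpow_one]; field_simp
  have hsn : s ≤ 1 := Real.rpow_le_one_of_one_le_of_nonpos (by norm_num)
    (by have : (0:ℝ) ≤ n := by positivity
        linarith)
  have hbig := hn₀ n hn
  have e1 := blk_cv_bound h hC hb (f := f) (s := s) (B := B * (1 / (4 * s)) ^ (-2 - η)) hs0
    (by positivity) (x := x) ?_
  · refine e1.trans ?_
    rw [mul_assoc (C * (3 ^ (N:ℝ) * (volume (ball (0 : Sp N) 1)).toReal)) (B * 4 ^ (2 + η))]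
    refine mul_le_mul_of_nonneg_left ?_ (by positivity)
    have e2 : (1 / (4 * s)) ^ (-2 - η) = 4 ^ (2 + η) * s ^ (2 + η) := by
      rw [one_div, inv_rpow (by positivity), ← rpow_neg (by positivity),
        mul_rpow (by norm_num) hs0.le, show -(-2 - η) = 2 + η by ring]
    rw [e2]
    have e3 : s ^ (t - N) * (B * (4 ^ (2 + η) * s ^ (2 + η)))
        = B * 4 ^ (2 + η) * s ^ (t - N + (2 + η)) := by
      rw [rpow_add hs0 (t - N) (2 + η)]; ring
    rw [e3]
    refine mul_le_mul_of_nonneg_left ?_ (by positivity)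
    have e4 : s ^ (t - N + (2 + η)) ≤ s ^ η :=
      Real.rpow_le_rpow_of_exponent_ge hs0 hsn (by linarith)
    refine e4.trans ?_
    rw [hs, ← rpow_natCast, ← rpow_mul (by norm_num), ← rpow_mul (by norm_num)]
    apply Real.rpow_le_rpow_of_exponent_le (by norm_num)
    nlinarith
  · intro y hy1 _
    rw [hs1] at hy1
    have hxM : ‖x‖ ≤ |M| := hx.trans (le_abs_self M)
    have tri : ‖x - y‖ ≤ ‖x‖ + ‖y‖ := norm_sub_le x y
    have hy2 : 1 / (4 * s) ≤ ‖y‖ := by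
      have : 1 / (4 * s) = 2 ^ (n:ℝ) / 2 := by rw [← hs1]; field_simp; norm_num
      rw [this]; linarith
    have hy3 : 1 ≤ ‖y‖ := by linarith [abs_nonneg M]
    refine (hdec y hy3).trans ?_
    refine mul_le_mul_of_nonneg_left ?_ hB
    exact rpow_antitone_exp (by positivity) hy2 (by linarith)

/-- near blocks for bounded densities (order less than two). -/
lemma near_est {t : ℝ} (ht : t < N) {Ψ : Sp N → F} (hc : Continuous Ψ)
    (h : Hom t Ψ) {f : Sp N → ℝ} (hf : Adm f) {ρ : ℝ} (hρ : 0 < ρ) :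
    ∃ C r n₀, 0 ≤ C ∧ 0 < r ∧ r < 1 ∧ ∀ x : Sp N, 2 * ρ ≤ ‖x‖ → ∀ n : ℕ, n₀ ≤ n →
      ‖cv (sc t ((2:ℝ) ^ (n:ℝ)) (blk t Ψ)) f x‖ ≤ C * r ^ n := by
  obtain ⟨C, hC, hb⟩ := blk_bound hc h
  obtain ⟨B, hB, hbd⟩ := hf.bdd hρ
  obtain ⟨n₀, hn₀⟩ := (two_rpow_tendsto.eventually_ge_atTop (2 / ρ)).exists_forall_of_atTop
  refine ⟨(C * (3 ^ (N:ℝ) * (volume (ball (0 : Sp N) 1)).toReal)) * B,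
    2 ^ (t - N), n₀, by positivity, by positivity,
    Real.rpow_lt_one_of_one_lt_of_neg (by norm_num) (by linarith), fun x hx n hn => ?_⟩
  set s : ℝ := (2:ℝ) ^ (n:ℝ) with hs
  have hs0 : 0 < s := by positivity
  have e1 := blk_cv_bound h hC hb (f := f) (s := s) (B := B) hs0 hB (x := x) ?_
  · refine e1.trans (le_of_eq ?_)
    rw [hs, ← rpow_mul (by norm_num), ← rpow_natCast, ← rpow_mul (by norm_num),
      mul_comm (n:ℝ)]
    ring
  · intro y _ hy
    apply hbd
    have h2 : 2 / s ≤ ρ := by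
      rw [div_le_iff₀ hs0]
      have := hn₀ n hn
      rw [div_le_iff₀ hρ] at this; linarith
    have tri : ‖x‖ ≤ ‖x - y‖ + ‖y‖ := by
      have := norm_add_le (x - y) y; simpa using this
    linarith

/-- near blocks, second order, for Hölder densities. -/
lemma near_est2 {Ψ : Sp N → F} (hc : Continuous Ψ)
    (h : Hom (N:ℝ) Ψ) (h0 : ∀ s, 0 < s → ∀ x, cv (sc (N:ℝ) s (blk (N:ℝ) Ψ)) (fun _ => 1) x = 0)
    {f : Sp N → ℝ} (hf : LocallyIntegrable f volume) {x₀ : Sp N} {ρ H α : ℝ} (hρ : 0 < ρ)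
    (hH : 0 ≤ H) (hα : 0 < α)
    (hol : ∀ x ∈ ball x₀ (2 * ρ), ∀ y ∈ ball x₀ (2 * ρ), |f y - f x| ≤ H * ‖x - y‖ ^ α) :
    ∃ C r n₀, 0 ≤ C ∧ 0 < r ∧ r < 1 ∧ ∀ x ∈ ball x₀ ρ, ∀ n : ℕ, n₀ ≤ n →
      ‖cv (sc (N:ℝ) ((2:ℝ) ^ (n:ℝ)) (blk (N:ℝ) Ψ)) f x‖ ≤ C * r ^ n := by
  obtain ⟨C, hC, hb⟩ := blk_bound hc h
  obtain ⟨n₀, hn₀⟩ := (two_rpow_tendsto.eventually_ge_atTop (2 / ρ)).exists_forall_of_atTop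
  refine ⟨(C * (3 ^ (N:ℝ) * (volume (ball (0 : Sp N) 1)).toReal)) * (H * 2 ^ α),
    2 ^ (-α), n₀, by positivity, by positivity,
    Real.rpow_lt_one_of_one_lt_of_neg (by norm_num) (by linarith), fun x hx n hn => ?_⟩
  set s : ℝ := (2:ℝ) ^ (n:ℝ) with hs
  have hs0 : 0 < s := by positivity
  have hsub : cv (sc (N:ℝ) s (blk (N:ℝ) Ψ)) f x
      = cv (sc (N:ℝ) s (blk (N:ℝ) Ψ)) (fun y => f y - f x) x := by
    have hcs : HasCompactSupport (sc (N:ℝ) s (blk (N:ℝ) Ψ)) :=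
      hcs_of_zero (fun z hz => sc_blk_zero_far h hs0 hz)
    have i1 := cv_integrable (sc_blk_continuous hc s) hcs hf x
    have i2 := cv_integrable (sc_blk_continuous hc s) hcs
      (locallyIntegrable_const (f x) : LocallyIntegrable (fun _ : Sp N => f x) volume) x
    have e1 : cv (sc (N:ℝ) s (blk (N:ℝ) Ψ)) (fun y => f y - f x) x
        = cv (sc (N:ℝ) s (blk (N:ℝ) Ψ)) f x - cv (sc (N:ℝ) s (blk (N:ℝ) Ψ)) (fun _ => f x) x := by
      unfold cv
      rw [← integral_sub i1 i2]
      simp only [sub_smul]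
    have e2 : cv (sc (N:ℝ) s (blk (N:ℝ) Ψ)) (fun _ => f x) x = 0 := by
      have := h0 s hs0 x
      unfold cv at this ⊢
      simp only [one_smul] at this
      rw [integral_smul, this, smul_zero]
    rw [e1, e2, sub_zero]
  rw [hsub]
  have e1 := blk_cv_bound h hC hb (f := fun y => f y - f x) (s := s) (B := H * (2 / s) ^ α) hs0
    (by positivity) (x := x) ?_
  · refine e1.trans (le_of_eq ?_)
    have e3 : (2 / s) ^ α = 2 ^ α * (2 ^ (-α)) ^ n := by
      rw [div_rpow (by norm_num) hs0.le, hs, ← rpow_mul (by norm_num), ← rpow_natCast,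
        ← rpow_mul (by norm_num), div_eq_mul_inv, ← rpow_neg (by norm_num)]
      congr 2; ring
    rw [e3, sub_self, rpow_zero]; ring
  · intro y _ hy
    have h2 : 2 / s ≤ ρ := by
      rw [div_le_iff₀ hs0]
      have := hn₀ n hn
      rw [div_le_iff₀ hρ] at this; linarith
    have hx' : dist x x₀ < ρ := hx
    have hy' : y ∈ ball x₀ (2 * ρ) := by
      rw [mem_ball]
      have : dist y x₀ ≤ dist y x + dist x x₀ := dist_triangle _ _ _
      rw [dist_eq_norm y x, norm_sub_rev] at this
      linarith
    have hx2 : x ∈ ball x₀ (2 * ρ) := by rw [mem_ball]; linarith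
    refine (hol x hx2 y hy').trans ?_
    gcongr

/-- uniform limit from a geometric bound. -/
lemma unif_of_geom [CompleteSpace F] {w : ℕ → Sp N → F} {U : Set (Sp N)} {C r : ℝ} {n₀ : ℕ}
    (hr : 0 < r) (hr1 : r < 1)
    (h : ∀ x ∈ U, ∀ n, n₀ ≤ n → ‖w (n+1) x - w n x‖ ≤ C * r ^ n) :
    ∃ L : Sp N → F, TendstoUniformlyOn w L atTop U := by
  have key : ∀ x ∈ U, ∃ l : F, ∀ n, dist (w (n + n₀) x) l ≤ C * r ^ n₀ * r ^ n / (1 - r) := by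
    intro x hx
    have hd : ∀ n, dist (w (n + n₀) x) (w (n + 1 + n₀) x) ≤ C * r ^ n₀ * r ^ n := by
      intro n
      rw [dist_comm, dist_eq_norm]
      have := h x hx (n + n₀) (by omega)
      rw [show n + 1 + n₀ = n + n₀ + 1 by ring]
      refine this.trans (le_of_eq ?_)
      rw [pow_add]; ring
    have hcau : CauchySeq (fun n => w (n + n₀) x) :=
      cauchySeq_of_le_geometric r (C * r ^ n₀) hr1 hd
    obtain ⟨l, hl⟩ := cauchySeq_tendsto_of_complete hcau
    exact ⟨l, fun n => dist_le_of_le_geometric_of_tendsto r _ hr1 hd hl n⟩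
  classical
  choose! L hL using key
  refine ⟨L, ?_⟩
  rw [Metric.tendstoUniformlyOn_iff]
  intro ε hε
  have ht : Tendsto (fun n : ℕ => C * r ^ n₀ * r ^ n / (1 - r)) atTop (nhds 0) := by
    have := (tendsto_pow_atTop_nhds_zero_of_lt_one hr.le hr1)
    have := (this.const_mul (C * r ^ n₀)).div_const (1 - r)
    simpa using this
  obtain ⟨n₁, hn₁⟩ := (ht.eventually (gt_mem_nhds hε)).exists_forall_of_atTop
  filter_upwards [eventually_ge_atTop (n₁ + n₀)] with n hn x hx
  obtain ⟨k, rfl⟩ := Nat.exists_eq_add_of_le' (show n₀ ≤ n by omega)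
  rw [dist_comm]
  exact (hL x hx k).trans_lt (hn₁ k (by omega))

end est


section kernel
variable {N : ℕ} {F : Type*} [NormedAddCommGroup F] [NormedSpace ℝ F]

lemma hom_fderiv {t : ℝ} {Ψ : Sp N → F} (h : Hom t Ψ) (hd : Differentiable ℝ Ψ) :
    Hom (t + 1) (fderiv ℝ Ψ) := by
  refine ⟨fun z hz => ?_, fun s hs z hz => ?_⟩
  · have : Ψ =ᶠ[nhds z] fun _ => 0 := by
      filter_upwards [(isOpen_lt continuous_norm continuous_const).mem_nhds hz] with w hw
      exact h.1 w hw
    rw [this.fderiv_eq]; simp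
  · have hs0 : 0 < s := by linarith
    have : Ψ =ᶠ[nhds z] fun w => s ^ t • Ψ (s • w) := by
      filter_upwards [(isOpen_lt continuous_const continuous_norm).mem_nhds hz] with w hw
      exact (h.2 s hs w hw).symm
    rw [this.fderiv_eq, fderiv_fun_const_smul (by fun_prop), fderiv_comp_smul, smul_smul,
      rpow_add hs0, rpow_one]

lemma fderiv_sc {t s : ℝ} (hs : 0 < s) {Ψ : Sp N → F} (hd : Differentiable ℝ Ψ) :
    fderiv ℝ (sc t s Ψ) = sc (t + 1) s (fderiv ℝ Ψ) := by
  ext1 z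
  unfold sc
  rw [fderiv_fun_const_smul (by fun_prop), fderiv_comp_smul, smul_smul, rpow_add hs, rpow_one]

lemma diff_sc {t s : ℝ} {Ψ : Sp N → F} (hd : Differentiable ℝ Ψ) :
    Differentiable ℝ (sc t s Ψ) := by
  unfold sc; fun_prop

lemma cd_sc {t s : ℝ} {Ψ : Sp N → F} (hd : ContDiff ℝ 1 Ψ) :
    ContDiff ℝ 1 (sc t s Ψ) := by
  unfold sc; fun_prop

lemma cd_kn {t : ℝ} {Ψ : Sp N → F} (hd : ContDiff ℝ 1 Ψ) (n : ℕ) :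
    ContDiff ℝ 1 (kn t Ψ n) := by
  have : kn t Ψ n = fun z => sc t ((2:ℝ) ^ (n:ℝ)) Ψ z - sc t ((2:ℝ) ^ (-(n:ℝ))) Ψ z := rfl
  rw [this]
  exact (cd_sc hd).sub (cd_sc hd)

lemma cd_blk {t : ℝ} {Ψ : Sp N → F} (hd : ContDiff ℝ 1 Ψ) :
    ContDiff ℝ 1 (blk t Ψ) := by
  have : blk t Ψ = fun z => sc t 2 Ψ z - Ψ z := rfl
  rw [this]
  exact (cd_sc hd).sub hd

lemma fderiv_kn {t : ℝ} {Ψ : Sp N → F} (hd : Differentiable ℝ Ψ) (n : ℕ) :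
    fderiv ℝ (kn t Ψ n) = kn (t + 1) (fderiv ℝ Ψ) n := by
  ext1 z
  have : kn t Ψ n = (sc t ((2:ℝ) ^ (n:ℝ)) Ψ) - (sc t ((2:ℝ) ^ (-(n:ℝ))) Ψ) := rfl
  rw [this, fderiv_sub (diff_sc hd z) (diff_sc hd z), fderiv_sc (by positivity) hd,
    fderiv_sc (by positivity) hd]
  rfl

lemma fderiv_blk {t : ℝ} {Ψ : Sp N → F} (hd : Differentiable ℝ Ψ) :
    fderiv ℝ (blk t Ψ) = blk (t + 1) (fderiv ℝ Ψ) := by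
  ext1 z
  have : blk t Ψ = (sc t 2 Ψ) - Ψ := rfl
  rw [this, fderiv_sub (diff_sc hd z) (hd z), fderiv_sc (by positivity) hd]
  rfl

lemma kn_hcs {t : ℝ} {Ψ : Sp N → F} (h : Hom t Ψ) (n : ℕ) : HasCompactSupport (kn t Ψ n) :=
  hcs_of_zero (fun z hz => kn_zero_far h hz)

lemma cv_kn_hasFDerivAt [CompleteSpace F] {t : ℝ} {Ψ : Sp N → F} (hd : ContDiff ℝ 1 Ψ)
    (h : Hom t Ψ) {f : Sp N → ℝ} (hf : LocallyIntegrable f volume) (n : ℕ) (x : Sp N) :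
    HasFDerivAt (cv (kn t Ψ n) f) (cv (kn (t + 1) (fderiv ℝ Ψ) n) f x) x := by
  rw [← fderiv_kn (hd.differentiable (by norm_num))]
  exact cv_hasFDerivAt (cd_kn hd n) (kn_hcs h n) hf x

/-- the derivative block integrates to zero -/
lemma blk_fderiv_zero [CompleteSpace F] {t : ℝ} {Ψ : Sp N → F} (hd : ContDiff ℝ 1 Ψ)
    (h : Hom t Ψ) (s : ℝ) (hs : 0 < s) (x : Sp N) :
    cv (sc (t + 1) s (blk (t + 1) (fderiv ℝ Ψ))) (fun _ => 1) x = 0 := by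
  have hd' := hd.differentiable (by norm_num)
  rw [← fderiv_blk hd', ← fderiv_sc hs ((cd_blk hd).differentiable (by norm_num))]
  have h1 := cv_hasFDerivAt (cd_sc (t := t) (s := s) (cd_blk (t := t) hd))
    (hcs_of_zero (fun z hz => sc_blk_zero_far h hs hz))
    (locallyIntegrable_const (1:ℝ) : LocallyIntegrable (fun _ : Sp N => (1:ℝ)) volume) x
  have h2 : cv (sc t s (blk t Ψ)) (fun _ : Sp N => (1:ℝ))
      = fun _ => ∫ y, sc t s (blk t Ψ) y := by
    ext1 x
    unfold cv
    simp only [one_smul]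
    exact integral_sub_left_eq_self (sc t s (blk t Ψ)) volume x
  rw [h2] at h1
  exact h1.unique (hasFDerivAt_const _ _)

lemma limit_deriv [CompleteSpace F] {t : ℝ} {Ψ : Sp N → F} (hd : ContDiff ℝ 1 Ψ)
    (h : Hom t Ψ) {f : Sp N → ℝ} (hf : LocallyIntegrable f volume) {U : Set (Sp N)}
    (hU : IsOpen U) {C r : ℝ} {n₀ : ℕ} (hr : 0 < r) (hr1 : r < 1)
    (hgeo : ∀ x ∈ U, ∀ n, n₀ ≤ n →
      ‖cv (kn (t + 1) (fderiv ℝ Ψ) (n+1)) f x - cv (kn (t + 1) (fderiv ℝ Ψ) n) f x‖ ≤ C * r ^ n)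
    {g : Sp N → F} (hlim : ∀ x ∈ U, Tendsto (fun n => cv (kn t Ψ n) f x) atTop (nhds (g x))) :
    ∃ L : Sp N → (Sp N →L[ℝ] F), ContinuousOn L U ∧ ∀ x ∈ U, HasFDerivAt g (L x) x ∧
      Tendsto (fun n => cv (kn (t + 1) (fderiv ℝ Ψ) n) f x) atTop (nhds (L x)) := by
  obtain ⟨L, hL⟩ := unif_of_geom (w := fun n => cv (kn (t + 1) (fderiv ℝ Ψ) n) f) hr hr1 hgeo
  have h' := hom_fderiv h (hd.differentiable (by norm_num))
  refine ⟨L, ?_, fun x hx => ⟨?_, hL.tendsto_at hx⟩⟩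
  · refine hL.continuousOn (Eventually.frequently (Eventually.of_forall fun n => ?_))
    exact (cv_continuous (kn_continuous (hd.continuous_fderiv (by norm_num)) n)
      (kn_hcs h' n) hf).continuousOn
  · refine hasFDerivAt_of_tendstoUniformlyOn hU hL ?_ hlim hx
    intro n x hx
    exact cv_kn_hasFDerivAt hd h hf n x

lemma geo_combine {t : ℝ} {Ψ : Sp N → F} (hc : Continuous Ψ) (h : Hom t Ψ)
    {f : Sp N → ℝ} (hf : LocallyIntegrable f volume) {U : Set (Sp N)}
    {C₁ r₁ C₂ r₂ : ℝ} {n₁ n₂ : ℕ} (hC₁ : 0 ≤ C₁) (hC₂ : 0 ≤ C₂) (h1 : 0 < r₁) (h1' : r₁ < 1)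
    (h2 : 0 < r₂) (h2' : r₂ < 1)
    (e1 : ∀ x ∈ U, ∀ n : ℕ, n₁ ≤ n → ‖cv (sc t ((2:ℝ) ^ (n:ℝ)) (blk t Ψ)) f x‖ ≤ C₁ * r₁ ^ n)
    (e2 : ∀ x ∈ U, ∀ n : ℕ, n₂ ≤ n →
      ‖cv (sc t ((2:ℝ) ^ (-(n:ℝ) - 1)) (blk t Ψ)) f x‖ ≤ C₂ * r₂ ^ n) :
    ∃ (C r : ℝ) (n₀ : ℕ), 0 < r ∧ r < 1 ∧ ∀ x ∈ U, ∀ n, n₀ ≤ n →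
      ‖cv (kn t Ψ (n+1)) f x - cv (kn t Ψ n) f x‖ ≤ C * r ^ n := by
  refine ⟨C₁ + C₂, max r₁ r₂, max n₁ n₂, lt_max_of_lt_left h1, max_lt h1' h2',
    fun x hx n hn => ?_⟩
  rw [cv_kn_diff hc h hf]
  refine (norm_add_le _ _).trans ?_
  have a1 := e1 x hx n (le_trans (le_max_left _ _) hn)
  have a2 := e2 x hx n (le_trans (le_max_right _ _) hn)
  have b1 : r₁ ^ n ≤ (max r₁ r₂) ^ n := pow_le_pow_left₀ h1.le (le_max_left _ _) n
  have b2 : r₂ ^ n ≤ (max r₁ r₂) ^ n := pow_le_pow_left₀ h2.le (le_max_right _ _) n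
  nlinarith [mul_le_mul_of_nonneg_left b1 hC₁, mul_le_mul_of_nonneg_left b2 hC₂]

end kernel

/-- the cut-off. -/
def bmp (N : ℕ) : ContDiffBump (0 : Sp N) := ⟨1, 2, one_pos, one_lt_two⟩

/-- truncated fundamental solution. -/
def Pk (N : ℕ) (z : Sp N) : ℝ := ‖z‖ ^ (2 - (N:ℝ)) * (1 - bmp N z)

lemma bmp_one {N : ℕ} {z : Sp N} (hz : ‖z‖ ≤ 1) : bmp N z = 1 := by
  apply (bmp N).one_of_mem_closedBall
  simpa [bmp] using hz

lemma bmp_zero {N : ℕ} {z : Sp N} (hz : 2 ≤ ‖z‖) : bmp N z = 0 := by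
  apply (bmp N).zero_of_le_dist
  simpa [bmp] using hz

lemma Pk_near {N : ℕ} {z : Sp N} (hz : ‖z‖ ≤ 1) : Pk N z = 0 := by simp [Pk, bmp_one hz]

lemma Pk_far {N : ℕ} {z : Sp N} (hz : 2 ≤ ‖z‖) : Pk N z = ‖z‖ ^ (2 - (N:ℝ)) := by
  simp [Pk, bmp_zero hz]

lemma Pk_contDiff (N : ℕ) {n : ℕ} : ContDiff ℝ n (Pk N) := by
  rw [contDiff_iff_contDiffAt]
  intro z
  by_cases hz : z = 0
  · have : Pk N =ᶠ[nhds z] fun _ => 0 := by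
      have : ‖z‖ < 1 := by simp [hz]
      filter_upwards [(isOpen_lt continuous_norm continuous_const).mem_nhds this] with w hw
      exact Pk_near (le_of_lt hw)
    exact contDiffAt_const.congr_of_eventuallyEq this
  · unfold Pk
    have h1 : ContDiffAt ℝ n (fun z : Sp N => ‖z‖ ^ (2 - (N:ℝ))) z :=
      (contDiffAt_norm ℝ hz).rpow_const_of_ne (norm_ne_zero_iff.mpr hz)
    exact h1.mul (contDiffAt_const.sub (bmp N).contDiffAt)

lemma Pk_hom (N : ℕ) : Hom ((N:ℝ) - 2) (Pk N) := by
  refine ⟨fun z hz => Pk_near hz.le, fun s hs z hz => ?_⟩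
  have hs0 : 0 < s := by linarith
  have hz0 : 0 < ‖z‖ := by linarith
  have hn : ‖s • z‖ = s * ‖z‖ := by rw [norm_smul, Real.norm_of_nonneg hs0.le]
  rw [Pk_far hz.le, Pk_far (by rw [hn]; nlinarith), hn, mul_rpow hs0.le hz0.le, smul_eq_mul,
    ← mul_assoc, ← rpow_add hs0]
  simp

lemma kn_Pk {N : ℕ} (n : ℕ) {z : Sp N} (hz : z ≠ 0) : kn ((N:ℝ) - 2) (Pk N) n z
    = ‖z‖ ^ (2 - (N:ℝ)) * (bmp N ((2:ℝ) ^ (-(n:ℝ)) • z) - bmp N ((2:ℝ) ^ (n:ℝ) • z)) := by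
  have hz0 : 0 < ‖z‖ := norm_pos_iff.mpr hz
  have key : ∀ s : ℝ, 0 < s → sc ((N:ℝ) - 2) s (Pk N) z
      = ‖z‖ ^ (2 - (N:ℝ)) * (1 - bmp N (s • z)) := by
    intro s hs
    simp only [sc, Pk, smul_eq_mul]
    rw [norm_smul, Real.norm_of_nonneg hs.le, mul_rpow hs.le hz0.le, ← mul_assoc, ← mul_assoc,
      ← rpow_add hs]
    simp
  rw [kn, key _ (by positivity), key _ (by positivity)]
  ring

lemma cv_kn_tendsto {N : ℕ} (hN : 3 ≤ N) {f : Sp N → ℝ} (hf : Adm f) {x : Sp N} (hx : x ≠ 0) :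
    Tendsto (fun n => cv (kn ((N:ℝ) - 2) (Pk N) n) f x) atTop (nhds (G f x)) := by
  unfold cv G
  have hne : ∀ᵐ y : Sp N, y ≠ x := by
    have : Nonempty (Fin N) := ⟨⟨0, by omega⟩⟩
    exact compl_mem_ae_iff.mpr (measure_singleton x)
  apply tendsto_integral_of_dominated_convergence
    (fun y : Sp N => ‖‖x - y‖ ^ (2 - (N:ℝ)) * f y‖)
  · intro n
    exact (cv_integrable (kn_continuous (Pk_contDiff N (n := 1)).continuous n)
      (kn_hcs (Pk_hom N) n) (hf.locallyIntegrable hN) x).1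
  · exact (hf.int hN hx).norm
  · intro n
    filter_upwards [hne] with y hy
    rw [kn_Pk n (sub_ne_zero.mpr (Ne.symm hy)), smul_eq_mul, norm_mul, norm_mul, norm_mul]
    have b : ‖bmp N ((2:ℝ) ^ (-(n:ℝ)) • (x - y)) - bmp N ((2:ℝ) ^ (n:ℝ) • (x - y))‖ ≤ 1 := by
      rw [Real.norm_eq_abs, abs_le]
      constructor <;> linarith [(bmp N).nonneg (x := (2:ℝ) ^ (-(n:ℝ)) • (x - y)),
        (bmp N).le_one (x := (2:ℝ) ^ (-(n:ℝ)) • (x - y)),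
        (bmp N).nonneg (x := (2:ℝ) ^ (n:ℝ) • (x - y)),
        (bmp N).le_one (x := (2:ℝ) ^ (n:ℝ) • (x - y))]
    have c : 0 ≤ ‖f y‖ * ‖‖x - y‖ ^ (2 - (N:ℝ))‖ := by positivity
    nlinarith
  · filter_upwards [hne] with y hy
    have hz : x - y ≠ 0 := sub_ne_zero.mpr (Ne.symm hy)
    have hz0 : 0 < ‖x - y‖ := norm_pos_iff.mpr hz
    apply tendsto_const_nhds.congr'
    filter_upwards [two_rpow_tendsto.eventually_ge_atTop ‖x - y‖,
      two_rpow_tendsto.eventually_ge_atTop (2 / ‖x - y‖)] with n h1 h2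
    rw [kn_Pk n hz, bmp_one, bmp_zero, smul_eq_mul]
    · ring
    · rw [norm_smul, Real.norm_of_nonneg (by positivity)]
      rwa [div_le_iff₀ hz0] at h2
    · rw [norm_smul, Real.norm_of_nonneg (by positivity), rpow_neg (by norm_num)]
      rw [inv_mul_le_iff₀ (by positivity)]; linarith

/-- first order regularity -/
lemma R1 {N : ℕ} (hN : 3 ≤ N) {f : Sp N → ℝ} (hf : Adm f) {x₀ : Sp N} (hx₀ : x₀ ≠ 0) :
    ∃ ρ > 0, (0 : Sp N) ∉ ball x₀ ρ ∧ ContinuousOn (fderiv ℝ (G f)) (ball x₀ ρ) ∧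
      ∀ x ∈ ball x₀ ρ, DifferentiableAt ℝ (G f) x ∧
      Tendsto (fun n => cv (kn ((N:ℝ) - 1) (fderiv ℝ (Pk N)) n) f x) atTop
        (nhds (fderiv ℝ (G f) x)) := by
  have hx0 : 0 < ‖x₀‖ := norm_pos_iff.mpr hx₀
  have hfl := hf.locallyIntegrable hN
  have hP : ContDiff ℝ 1 (Pk N) := by exact_mod_cast Pk_contDiff N (n := 1)
  have hc := hP.continuous_fderiv (by norm_num)
  have hH := hom_fderiv (Pk_hom N) (hP.differentiable (by norm_num))
  have et : (N:ℝ) - 2 + 1 = N - 1 := by ring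
  obtain ⟨C₁, r₁, n₁, a1, a2, a3, a4⟩ := near_est (by linarith) hc hH hf (ρ := ‖x₀‖ / 4)
    (by positivity)
  obtain ⟨C₂, r₂, n₂, b1, b2, b3, b4⟩ := far_est (by linarith) hc hH hf (2 * ‖x₀‖)
  have hb : ∀ x ∈ ball x₀ (‖x₀‖ / 2), 2 * (‖x₀‖ / 4) ≤ ‖x‖ ∧ ‖x‖ ≤ 2 * ‖x₀‖ := by
    intro x hx
    rw [mem_ball, dist_eq_norm] at hx
    have t1 : ‖x‖ ≤ ‖x - x₀‖ + ‖x₀‖ := by simpa using norm_add_le (x - x₀) x₀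
    have t2 : ‖x₀‖ ≤ ‖x - x₀‖ + ‖x‖ := by
      have := norm_add_le (x₀ - x) x
      rw [norm_sub_rev x₀ x] at this; simpa using this
    constructor <;> linarith
  obtain ⟨C, r, n₀, c2, c3, c4⟩ := geo_combine hc hH hfl (U := ball x₀ (‖x₀‖ / 2)) a1 b1 a2 a3 b2 b3
    (fun x hx n hn => a4 x (hb x hx).1 n hn) (fun x hx n hn => b4 x (hb x hx).2 n hn)
  have hx' : ∀ x ∈ ball x₀ (‖x₀‖ / 2), x ≠ 0 := by
    intro x hx
    have := (hb x hx).1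
    exact norm_pos_iff.mp (by linarith)
  obtain ⟨L, hL, hL'⟩ := limit_deriv hP (Pk_hom N) hfl isOpen_ball c2 c3 c4 (g := G f)
    (fun x hx => cv_kn_tendsto hN hf (hx' x hx))
  have hfd : ∀ x ∈ ball x₀ (‖x₀‖ / 2), fderiv ℝ (G f) x = L x := fun x hx => (hL' x hx).1.fderiv
  refine ⟨‖x₀‖ / 2, by positivity, fun h => hx' 0 h rfl, hL.congr hfd, fun x hx =>
    ⟨(hL' x hx).1.differentiableAt, ?_⟩⟩
  rw [hfd x hx, ← et]
  exact (hL' x hx).2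

lemma G_diff {N : ℕ} (hN : 3 ≤ N) {f : Sp N → ℝ} (hf : Adm f) {x : Sp N} (hx : x ≠ 0) :
    DifferentiableAt ℝ (G f) x := by
  obtain ⟨ρ, hρ, -, -, h⟩ := R1 hN hf hx
  exact (h x (mem_ball_self hρ)).1

lemma G_contAt {N : ℕ} (hN : 3 ≤ N) {f : Sp N → ℝ} (hf : Adm f) {x : Sp N} (hx : x ≠ 0) :
    ContinuousAt (G f) x := (G_diff hN hf hx).continuousAt

lemma G_lip {N : ℕ} (hN : 3 ≤ N) {f : Sp N → ℝ} (hf : Adm f) {x₀ : Sp N} (hx₀ : x₀ ≠ 0) :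
    ∃ ρ > 0, ∃ C, 0 ≤ C ∧ ∀ x ∈ ball x₀ ρ, ∀ y ∈ ball x₀ ρ, |G f x - G f y| ≤ C * ‖x - y‖ := by
  obtain ⟨ρ, hρ, -, hc, h⟩ := R1 hN hf hx₀
  have hca : ContinuousAt (fderiv ℝ (G f)) x₀ := hc.continuousAt (ball_mem_nhds x₀ hρ)
  have hev : ∀ᶠ x in nhds x₀, ‖fderiv ℝ (G f) x‖ < ‖fderiv ℝ (G f) x₀‖ + 1 :=
    hca.norm.eventually (gt_mem_nhds (by linarith))
  obtain ⟨ρ', hρ', hb⟩ := Metric.eventually_nhds_iff_ball.mp hev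
  refine ⟨min ρ ρ', lt_min hρ hρ', ‖fderiv ℝ (G f) x₀‖ + 1, by positivity, fun x hx y hy => ?_⟩
  have := (convex_ball x₀ (min ρ ρ')).norm_image_sub_le_of_norm_fderiv_le (𝕜 := ℝ) (f := G f)
    (C := ‖fderiv ℝ (G f) x₀‖ + 1)
    (fun z hz => (h z (ball_subset_ball (min_le_left _ _) hz)).1)
    (fun z hz => (hb z (ball_subset_ball (min_le_right _ _) hz)).le) hy hx
  simpa using this


lemma lap_congr {N : ℕ} {u v : Sp N → ℝ} {x : Sp N} (h : u =ᶠ[nhds x] v) : lap u x = lap v x := by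
  unfold lap
  refine Finset.sum_congr rfl fun i _ => ?_
  have : (fun y => fderiv ℝ u y (EuclideanSpace.single i (1:ℝ)))
      =ᶠ[nhds x] (fun y => fderiv ℝ v y (EuclideanSpace.single i (1:ℝ))) := by
    filter_upwards [h.fderiv (𝕜 := ℝ)] with y hy
    rw [hy]
  rw [this.fderiv_eq]

/-- trace of a bilinear form. -/
def trc (N : ℕ) : (Sp N →L[ℝ] Sp N →L[ℝ] ℝ) →L[ℝ] ℝ :=
  ∑ i : Fin N, (ContinuousLinearMap.apply ℝ ℝ (EuclideanSpace.single i (1:ℝ) : Sp N)).comp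
    (ContinuousLinearMap.apply ℝ (Sp N →L[ℝ] ℝ) (EuclideanSpace.single i (1:ℝ) : Sp N))

lemma trc_apply {N : ℕ} (B : Sp N →L[ℝ] Sp N →L[ℝ] ℝ) : trc N B =
    ∑ i : Fin N, B (EuclideanSpace.single i (1:ℝ)) (EuclideanSpace.single i (1:ℝ)) := by
  simp [trc]

lemma lap_eq_trc {N : ℕ} {u : Sp N → ℝ} {x : Sp N} {L : Sp N →L[ℝ] Sp N →L[ℝ] ℝ}
    (h : HasFDerivAt (fderiv ℝ u) L x) : lap u x = trc N L := by
  rw [trc_apply]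
  unfold lap
  refine Finset.sum_congr rfl fun i _ => ?_
  have := (h.clm_apply (hasFDerivAt_const (EuclideanSpace.single i (1:ℝ) : Sp N) x)).fderiv
  rw [this]; simp

lemma hasFDerivAt_norm_rpow' {N : ℕ} (q : ℝ) {x : Sp N} (hx : x ≠ 0) :
    HasFDerivAt (fun y : Sp N => ‖y‖ ^ q) ((q * ‖x‖ ^ (q - 2)) • innerSL ℝ x) x := by
  have hx0 : 0 < ‖x‖ := norm_pos_iff.mpr hx
  have h1 := (hasStrictFDerivAt_norm_sq x).hasFDerivAt
  have h2 := h1.rpow_const (p := q / 2) (Or.inl (by positivity))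
  have e : (fun y : Sp N => (‖y‖ ^ 2) ^ (q / 2)) = fun y => ‖y‖ ^ q := by
    ext y
    rw [← rpow_natCast, ← rpow_mul (norm_nonneg _)]
    congr 1; push_cast; ring
  rw [e] at h2
  have e2 : (q / 2 * (‖x‖ ^ 2) ^ (q / 2 - 1)) • 2 • (innerSL ℝ) x
      = (q * ‖x‖ ^ (q - 2)) • innerSL ℝ x := by
    rw [← rpow_natCast, ← rpow_mul (norm_nonneg _), two_smul, smul_add, ← add_smul,
      show ((2:ℕ):ℝ) * (q / 2 - 1) = q - 2 by push_cast; ring]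
    congr 1
    ring
  rw [e2] at h2
  exact h2

lemma lap_norm_rpow {N : ℕ} (q : ℝ) {x : Sp N} (hx : x ≠ 0) :
    lap (fun y : Sp N => ‖y‖ ^ q) x = q * (q + N - 2) * ‖x‖ ^ (q - 2) := by
  have hx0 : 0 < ‖x‖ := norm_pos_iff.mpr hx
  have hne : ∀ᶠ y in nhds x, y ≠ 0 := isOpen_ne.mem_nhds hx
  have key : ∀ i : Fin N, fderiv ℝ (fun y => fderiv ℝ (fun y : Sp N => ‖y‖ ^ q) y
      (EuclideanSpace.single i (1:ℝ))) x (EuclideanSpace.single i (1:ℝ))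
      = q * ((q - 2) * ‖x‖ ^ (q - 4) * (x i) ^ 2 + ‖x‖ ^ (q - 2)) := by
    intro i
    have e1 : (fun y => fderiv ℝ (fun y : Sp N => ‖y‖ ^ q) y (EuclideanSpace.single i (1:ℝ)))
        =ᶠ[nhds x] fun y => (q * ‖y‖ ^ (q - 2)) * innerSL ℝ (EuclideanSpace.single i (1:ℝ)) y := by
      filter_upwards [hne] with y hy
      rw [(hasFDerivAt_norm_rpow' q hy).fderiv]
      simp [real_inner_comm]
    rw [e1.fderiv_eq]
    have h1 := ((hasFDerivAt_norm_rpow' (q - 2) hx).const_mul q).mul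
      (innerSL ℝ (EuclideanSpace.single i (1:ℝ) : Sp N)).hasFDerivAt
    have h2 := h1.fderiv
    have e2 : (fun y => (q * ‖y‖ ^ (q - 2)) * innerSL ℝ (EuclideanSpace.single i (1:ℝ)) y)
      = ((fun y : Sp N => q * ‖y‖ ^ (q - 2)) * (innerSL ℝ (EuclideanSpace.single i (1:ℝ) : Sp N))) := rfl
    rw [e2, h2]
    simp [EuclideanSpace.inner_single_left, EuclideanSpace.inner_single_right]
    rw [show q - 2 - 2 = q - 4 by ring]
    ring
  unfold lap
  rw [Finset.sum_congr rfl (fun i _ => key i), ← Finset.mul_sum, Finset.sum_add_distrib,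
    ← Finset.mul_sum]
  have hs : ∑ i, (x i) ^ 2 = ‖x‖ ^ (2:ℝ) := by
    rw [Real.rpow_two, EuclideanSpace.norm_sq_eq]
    simp
  rw [hs, mul_assoc (q - 2), ← rpow_add hx0]
  simp only [Finset.sum_const, Finset.card_univ, Fintype.card_fin, nsmul_eq_mul]
  rw [show q - 4 + 2 = q - 2 by ring]
  ring

/-- Laplacian of the truncated kernel. -/
def Qk (N : ℕ) (z : Sp N) : ℝ := trc N (fderiv ℝ (fderiv ℝ (Pk N)) z)

lemma Pk_fderiv_cd (N : ℕ) : ContDiff ℝ 1 (fderiv ℝ (Pk N)) := by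
  have h : ContDiff ℝ ((1:ℕ∞) + 1) (Pk N) := by
    have := Pk_contDiff N (n := 2)
    convert this using 1
    norm_num
  exact h.fderiv_right (le_refl _)

lemma Qk_continuous (N : ℕ) : Continuous (Qk N) := by
  have := (Pk_fderiv_cd N).continuous_fderiv (by norm_num)
  exact (trc N).continuous.comp this

lemma Qk_lap {N : ℕ} (z : Sp N) : Qk N z = lap (Pk N) z :=
  (lap_eq_trc ((Pk_fderiv_cd N).differentiable (by norm_num) z).hasFDerivAt).symm

lemma Qk_near {N : ℕ} {z : Sp N} (hz : ‖z‖ < 1) : Qk N z = 0 := by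
  have hP : ContDiff ℝ 1 (Pk N) := by exact_mod_cast Pk_contDiff N (n := 1)
  have := (hom_fderiv (hom_fderiv (Pk_hom N) (hP.differentiable (by norm_num)))
    ((Pk_fderiv_cd N).differentiable (by norm_num))).1 z hz
  simp [Qk, this]

lemma Qk_far {N : ℕ} {z : Sp N} (hz : 2 < ‖z‖) : Qk N z = 0 := by
  have : Pk N =ᶠ[nhds z] fun y => ‖y‖ ^ (2 - (N:ℝ)) := by
    filter_upwards [(isOpen_lt continuous_const continuous_norm).mem_nhds hz] with w hw
    exact Pk_far (le_of_lt hw)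
  rw [Qk_lap, lap_congr this, lap_norm_rpow _ (norm_pos_iff.mp (by linarith))]
  simp

/-- the Green constant. -/
def gam (N : ℕ) : ℝ := -∫ z, Qk N z

lemma cv_Q_scale {N : ℕ} {s : ℝ} (hs : 0 < s) (x : Sp N) :
    ∫ y, sc (N:ℝ) s (Qk N) (x - y) = - gam N := by
  rw [integral_sub_left_eq_self (sc (N:ℝ) s (Qk N)) volume x]
  unfold sc
  rw [integral_smul, Measure.integral_comp_smul_of_nonneg _ _ _ (hR := hs.le)]
  simp only [finrank_euclideanSpace, Fintype.card_fin, smul_eq_mul, gam, neg_neg]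
  rw [rpow_natCast, ← mul_assoc, mul_inv_cancel₀ (by positivity), one_mul]

lemma Qk_bound (N : ℕ) : ∃ C, 0 ≤ C ∧ ∀ z, ‖Qk N z‖ ≤ C := by
  have hcs : HasCompactSupport (Qk N) := hcs_of_zero (R := 2) (fun z hz => Qk_far hz)
  obtain ⟨C, hC⟩ := (Qk_continuous N).bounded_above_of_compact_support hcs
  exact ⟨C, (norm_nonneg _).trans (hC 0), hC⟩

lemma scQ_cont (N : ℕ) (s : ℝ) : Continuous (sc (N:ℝ) s (Qk N)) := by
  have := Qk_continuous N
  unfold sc; fun_prop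

lemma scQ_far {N : ℕ} {s : ℝ} (hs : 0 < s) {z : Sp N} (hz : 2 / s < ‖z‖) :
    sc (N:ℝ) s (Qk N) z = 0 := by
  unfold sc
  rw [Qk_far, smul_zero]
  rw [norm_smul, Real.norm_of_nonneg hs.le]
  rw [div_lt_iff₀ hs] at hz; linarith

lemma scQ_near {N : ℕ} {s : ℝ} (hs : 0 < s) {z : Sp N} (hz : ‖z‖ < 1 / s) :
    sc (N:ℝ) s (Qk N) z = 0 := by
  unfold sc
  rw [Qk_near, smul_zero]
  rw [norm_smul, Real.norm_of_nonneg hs.le]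
  rw [lt_div_iff₀ hs] at hz; linarith

lemma scQ_cv_bound {N : ℕ} {C : ℝ} (hC : 0 ≤ C) (hb : ∀ z, ‖Qk N z‖ ≤ C) {f : Sp N → ℝ}
    {s B : ℝ} (hs : 0 < s) (hB : 0 ≤ B)
    {x : Sp N} (hf : ∀ y, 1 / s ≤ ‖x - y‖ → ‖x - y‖ ≤ 2 / s → |f y| ≤ B) :
    ‖cv (sc (N:ℝ) s (Qk N)) f x‖ ≤
      (C * (3 ^ (N:ℝ) * (volume (ball (0 : Sp N) 1)).toReal)) * B := by
  have h1 := cv_bound (K := sc (N:ℝ) s (Qk N)) (f := f) (x := x) (C := s ^ (N:ℝ) * C) (B := B)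
    (R := 3 / s) (by positivity) hB (by positivity) ?_ ?_ ?_
  · refine h1.trans (le_of_eq ?_)
    rw [div_rpow (by norm_num) hs.le]
    have : s ^ (N:ℝ) ≠ 0 := by positivity
    field_simp
  · intro z
    simp only [sc, norm_smul]
    rw [Real.norm_of_nonneg (by positivity)]
    exact mul_le_mul_of_nonneg_left (hb _) (by positivity)
  · intro z hz
    apply scQ_far hs
    refine lt_of_lt_of_le ?_ hz
    gcongr; norm_num
  · intro y hy
    apply hf
    · by_contra hcon
      exact hy (scQ_near hs (not_le.mp hcon))
    · by_contra hcon
      exact hy (scQ_far hs (not_le.mp hcon))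

lemma cvQ_near {N : ℕ} (hN : 3 ≤ N) {f : Sp N → ℝ} (hf : Adm f) {x : Sp N}
    (hc : ContinuousAt f x) :
    Tendsto (fun n : ℕ => cv (sc (N:ℝ) ((2:ℝ) ^ (n:ℝ)) (Qk N)) f x) atTop
      (nhds (- gam N * f x)) := by
  obtain ⟨C, hC, hb⟩ := Qk_bound N
  set A := C * (3 ^ (N:ℝ) * (volume (ball (0 : Sp N) 1)).toReal) with hA
  have hA0 : 0 ≤ A := by positivity
  rw [Metric.tendsto_atTop]
  intro ε hε
  obtain ⟨δ, hδ, hδ'⟩ := Metric.continuousAt_iff.mp hc (ε / (A + 1)) (by positivity)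
  obtain ⟨n₀, hn₀⟩ := (two_rpow_tendsto.eventually_gt_atTop (2 / δ)).exists_forall_of_atTop
  refine ⟨n₀, fun n hn => ?_⟩
  set s : ℝ := (2:ℝ) ^ (n:ℝ) with hs
  have hs0 : 0 < s := by positivity
  have hcs : HasCompactSupport (sc (N:ℝ) s (Qk N)) := hcs_of_zero (fun z hz => scQ_far hs0 hz)
  have i1 := cv_integrable (scQ_cont N s) hcs (hf.locallyIntegrable hN) x
  have i2 := cv_integrable (scQ_cont N s) hcs
      (locallyIntegrable_const (f x) : LocallyIntegrable (fun _ : Sp N => f x) volume) x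
  have e1 : cv (sc (N:ℝ) s (Qk N)) f x - (- gam N * f x)
      = cv (sc (N:ℝ) s (Qk N)) (fun y => f y - f x) x := by
    unfold cv
    simp only [sub_smul]
    rw [integral_sub i1 i2, integral_smul, cv_Q_scale hs0, smul_eq_mul]
    ring
  rw [dist_eq_norm, e1]
  have h2 := scQ_cv_bound hC hb (f := fun y => f y - f x) (B := ε / (A + 1)) hs0 (by positivity)
    (x := x) ?_
  · refine h2.trans_lt ?_
    rw [← hA, mul_div_assoc', div_lt_iff₀ (by positivity)]
    nlinarith
  · intro y _ hy
    have h3 : 2 / s < δ := by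
      have := hn₀ n hn
      rw [div_lt_iff₀ hδ] at this
      rw [div_lt_iff₀ hs0]; linarith
    have := hδ' (x := y) (by rw [dist_eq_norm, norm_sub_rev]; linarith)
    rw [dist_eq_norm, Real.norm_eq_abs] at this
    exact this.le

lemma cvQ_far {N : ℕ} {f : Sp N → ℝ} (hf : Adm f) (x : Sp N) :
    Tendsto (fun n : ℕ => cv (sc (N:ℝ) ((2:ℝ) ^ (-(n:ℝ))) (Qk N)) f x) atTop (nhds 0) := by
  obtain ⟨C, hC, hb⟩ := Qk_bound N
  obtain ⟨B, η, hB, hη, hdec⟩ := hf.decay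
  set A := C * (3 ^ (N:ℝ) * (volume (ball (0 : Sp N) 1)).toReal) with hA
  have hA0 : 0 ≤ A := by positivity
  have hlim : Tendsto (fun n : ℕ => A * (B * ((2:ℝ) ^ (n:ℝ) - ‖x‖) ^ (-2 - η))) atTop (nhds 0) := by
    have h1 : Tendsto (fun n : ℕ => (2:ℝ) ^ (n:ℝ) - ‖x‖) atTop atTop :=
      tendsto_atTop_add_const_right _ _ two_rpow_tendsto
    have h2 := (tendsto_rpow_neg_atTop (y := 2 + η) (by linarith)).comp h1
    have h3 := (h2.const_mul B).const_mul A
    simp only [mul_zero] at h3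
    refine h3.congr fun n => ?_
    simp only [Function.comp]
    rw [show -(2 + η) = -2 - η by ring]
  refine squeeze_zero_norm' ?_ hlim
  filter_upwards [two_rpow_tendsto.eventually_ge_atTop (‖x‖ + 1)] with n hn
  apply scQ_cv_bound hC hb (by positivity)
  · have : 0 ≤ (2:ℝ) ^ (n:ℝ) - ‖x‖ := by linarith
    positivity
  · intro y hy _
    rw [rpow_neg (by norm_num), one_div, inv_inv] at hy
    have tri : ‖x - y‖ ≤ ‖x‖ + ‖y‖ := norm_sub_le x y
    refine (hdec y (by linarith)).trans (mul_le_mul_of_nonneg_left ?_ hB)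
    exact rpow_antitone_exp (by linarith) (by linarith) (by linarith)

lemma trc_cv {N : ℕ} (hN : 3 ≤ N) {f : Sp N → ℝ} (hf : Adm f) (n : ℕ) (x : Sp N) :
    trc N (cv (kn (N:ℝ) (fderiv ℝ (fderiv ℝ (Pk N))) n) f x)
      = cv (sc (N:ℝ) ((2:ℝ) ^ (n:ℝ)) (Qk N)) f x - cv (sc (N:ℝ) ((2:ℝ) ^ (-(n:ℝ))) (Qk N)) f x := by
  have hP : ContDiff ℝ 1 (Pk N) := by exact_mod_cast Pk_contDiff N (n := 1)
  have hH := (hom_fderiv (hom_fderiv (Pk_hom N) (hP.differentiable (by norm_num)))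
    ((Pk_fderiv_cd N).differentiable (by norm_num)))
  rw [show (N:ℝ) - 2 + 1 + 1 = N by ring] at hH
  have hfl := hf.locallyIntegrable hN
  have i1 := cv_integrable (kn_continuous (t := (N:ℝ))
    ((Pk_fderiv_cd N).continuous_fderiv (by norm_num)) n) (kn_hcs hH n) hfl x
  have hq : ∀ s : ℝ, 0 < s → Integrable (fun y : Sp N => f y • sc (N:ℝ) s (Qk N) (x - y)) :=
    fun s hs => cv_integrable (scQ_cont N s) (hcs_of_zero (fun z hz => scQ_far hs hz)) hfl x
  unfold cv
  rw [← integral_sub (hq _ (by positivity)) (hq _ (by positivity)),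
    ← ContinuousLinearMap.integral_comp_comm _ i1]
  congr 1
  ext y
  simp only [kn, sc, Qk, map_smul, map_sub, smul_eq_mul]
  ring

/-- second order regularity -/
lemma R2 {N : ℕ} (hN : 3 ≤ N) {f : Sp N → ℝ} (hf : Adm f) {x₀ : Sp N} (hx₀ : x₀ ≠ 0)
    {ρ₀ H α : ℝ} (hρ₀ : 0 < ρ₀) (hH : 0 ≤ H) (hα : 0 < α)
    (hol : ∀ x ∈ ball x₀ ρ₀, ∀ y ∈ ball x₀ ρ₀, |f y - f x| ≤ H * ‖x - y‖ ^ α) :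
    ContDiffAt ℝ 2 (G f) x₀ ∧ - lap (G f) x₀ = gam N * f x₀ := by
  obtain ⟨ρ₁, hρ₁, hz, hcont, hR1⟩ := R1 hN hf hx₀
  have hfl := hf.locallyIntegrable hN
  have hP1 : ContDiff ℝ 1 (Pk N) := by exact_mod_cast Pk_contDiff N (n := 1)
  have hP := Pk_fderiv_cd N
  have hc := hP.continuous_fderiv (by norm_num)
  have hH1 := hom_fderiv (Pk_hom N) (hP1.differentiable (by norm_num))
  rw [show (N:ℝ) - 2 + 1 = N - 1 by ring] at hH1
  have hH2 := hom_fderiv hH1 (hP.differentiable (by norm_num))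
  have h0 := blk_fderiv_zero hP hH1
  have e : (N:ℝ) - 1 + 1 = N := by ring
  rw [e] at hH2 h0
  set ρ := min (ρ₀ / 2) ρ₁ with hρd
  have hρ : 0 < ρ := lt_min (by positivity) hρ₁
  have hsub : ball x₀ (2 * ρ) ⊆ ball x₀ ρ₀ := ball_subset_ball (by
    have := min_le_left (ρ₀ / 2) ρ₁; linarith)
  have hsub1 : ball x₀ ρ ⊆ ball x₀ ρ₁ := ball_subset_ball (min_le_right _ _)
  obtain ⟨C₁, r₁, n₁, a1, a2, a3, a4⟩ := near_est2 hc hH2 h0 hfl hρ hH hα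
    (fun x hx y hy => hol x (hsub hx) y (hsub hy))
  obtain ⟨C₂, r₂, n₂, b1, b2, b3, b4⟩ := far_est (by linarith) hc hH2 hf (‖x₀‖ + ρ)
  obtain ⟨C, r, n₀, c2, c3, c4⟩ := geo_combine hc hH2 hfl (U := ball x₀ ρ) a1 b1 a2 a3 b2 b3
    a4 (fun x hx n hn => b4 x (by
      rw [mem_ball, dist_eq_norm] at hx
      have t1 : ‖x‖ ≤ ‖x - x₀‖ + ‖x₀‖ := by simpa using norm_add_le (x - x₀) x₀
      linarith) n hn)
  rw [← e] at c4
  obtain ⟨L, hL, hL'⟩ := limit_deriv hP hH1 hfl isOpen_ball c2 c3 c4 (g := fderiv ℝ (G f))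
    (fun x hx => (hR1 x (hsub1 hx)).2)
  have hmem : x₀ ∈ ball x₀ ρ := mem_ball_self hρ
  constructor
  · have hco : ContDiffOn ℝ 2 (G f) (ball x₀ ρ) := by
      rw [show (2 : WithTop ℕ∞) = 1 + 1 by norm_num,
        contDiffOn_succ_iff_fderiv_of_isOpen isOpen_ball]
      refine ⟨fun x hx => (hR1 x (hsub1 hx)).1.differentiableWithinAt, by simp, ?_⟩
      rw [show (1 : WithTop ℕ∞) = 0 + 1 by norm_num,
        contDiffOn_succ_iff_fderiv_of_isOpen isOpen_ball]
      refine ⟨fun x hx => (hL' x hx).1.differentiableAt.differentiableWithinAt, by simp, ?_⟩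
      rw [contDiffOn_zero]
      exact hL.congr fun x hx => (hL' x hx).1.fderiv
    exact hco.contDiffAt (ball_mem_nhds x₀ hρ)
  · rw [lap_eq_trc (hL' x₀ hmem).1]
    have t1 := ((trc N).continuous.tendsto _).comp (hL' x₀ hmem).2
    rw [e] at t1
    have hcf : ContinuousAt f x₀ := by
      rw [Metric.continuousAt_iff]
      intro ε hε
      have hl : Tendsto (fun t : ℝ => H * t ^ α) (nhds 0) (nhds 0) := by
        have : ContinuousAt (fun t : ℝ => H * t ^ α) 0 :=
          (continuousAt_id.rpow_const (Or.inr hα.le)).const_mul H |>.congr (by rfl)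
        have h := this.tendsto
        simpa [Real.zero_rpow hα.ne'] using h
      obtain ⟨δ, hδ, hδ'⟩ := Metric.eventually_nhds_iff.mp (hl.eventually (gt_mem_nhds hε))
      refine ⟨min δ ρ₀, lt_min hδ hρ₀, fun {y} hy => ?_⟩
      have h1 := hol x₀ (mem_ball_self hρ₀) y (lt_of_lt_of_le hy (min_le_right _ _))
      rw [Real.dist_eq]
      refine h1.trans_lt (hδ' ?_)
      have h2 := lt_of_lt_of_le hy (min_le_left _ _)
      rw [dist_eq_norm, norm_sub_rev] at h2
      simpa using h2
    have t2 := (cvQ_near hN hf hcf).sub (cvQ_far hf x₀)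
    have t3 := t2.congr (fun n => (trc_cv hN hf n x₀).symm)
    have := tendsto_nhds_unique t1 t3
    rw [this]; ring


lemma lap_const_mul {N : ℕ} (c : ℝ) (u : Sp N → ℝ) (x : Sp N) :
    lap (fun y => c * u y) x = c * lap u x := by
  unfold lap
  rw [Finset.mul_sum]
  refine Finset.sum_congr rfl fun i _ => ?_
  have e1 : (fun y => fderiv ℝ (fun y => c * u y) y (EuclideanSpace.single i (1:ℝ)))
      = c • (fun y => fderiv ℝ u y (EuclideanSpace.single i (1:ℝ))) := by
    ext y
    have : (fun y => c * u y) = c • u := by ext; simp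
    rw [this, fderiv_const_smul_field]
    simp
  rw [e1, fderiv_const_smul_field]
  simp

lemma G_isom {N : ℕ} (e : Sp N ≃ₗᵢ[ℝ] Sp N) (f : Sp N → ℝ) (x : Sp N) :
    G f (e x) = G (fun y => f (e y)) x := by
  unfold G
  have := e.measurePreserving.integral_comp e.toHomeomorph.measurableEmbedding
    (fun y => ‖e x - y‖ ^ (2 - (N:ℝ)) * f y)
  rw [← this]
  congr 1
  ext y
  rw [← map_sub, e.norm_map]

lemma G_radial {N : ℕ} {f : Sp N → ℝ} (hf : ∀ y z : Sp N, ‖y‖ = ‖z‖ → f y = f z) {x x' : Sp N}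
    (h : ‖x‖ = ‖x'‖) : G f x = G f x' := by
  have e := Submodule.reflection_sub h
  rw [← e, G_isom]
  congr 1
  ext y
  exact hf _ _ ((LinearIsometryEquiv.norm_map _ _).symm)

lemma exists_unit {N : ℕ} (hN : 3 ≤ N) : ∃ e : Sp N, ‖e‖ = 1 :=
  ⟨EuclideanSpace.single ⟨0, by omega⟩ 1, by simp⟩

lemma G_pow_aux {N : ℕ} (hN : 3 ≤ N) {b : ℝ} {e x : Sp N} (he : ‖e‖ = 1) (hx : x ≠ 0) :
    G (fun y => ‖y‖ ^ (-b - 2)) x = G (fun y => ‖y‖ ^ (-b - 2)) e * ‖x‖ ^ (-b) := by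
  have hx0 : 0 < ‖x‖ := norm_pos_iff.mpr hx
  have h1 := G_scale (f := fun y : Sp N => ‖y‖ ^ (-b - 2)) hx0 e
  have h2 : G (fun y : Sp N => ‖‖x‖ • y‖ ^ (-b - 2)) e
      = ‖x‖ ^ (-b - 2) * G (fun y => ‖y‖ ^ (-b - 2)) e := by
    rw [← G_const_mul]
    congr 1; ext y
    rw [norm_smul, Real.norm_of_nonneg hx0.le, mul_rpow hx0.le (norm_nonneg _)]
  rw [h2] at h1
  have h3 : G (fun y : Sp N => ‖y‖ ^ (-b - 2)) (‖x‖ • e) = G (fun y => ‖y‖ ^ (-b - 2)) x := by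
    apply G_radial
    · intro y z h; rw [h]
    · rw [norm_smul, he]; simp
  rw [h3, sub_eq_add_neg, rpow_add hx0] at h1
  have h4 : 0 < ‖x‖ ^ (-2:ℝ) := by positivity
  have h5 : ‖x‖ ^ (-2:ℝ) * (G (fun y => ‖y‖ ^ (-b - 2)) x)
      = ‖x‖ ^ (-2:ℝ) * (G (fun y => ‖y‖ ^ (-b - 2)) e * ‖x‖ ^ (-b)) := by
    simp only [sub_eq_add_neg] at h1 ⊢
    rw [← h1]; ring
  exact mul_left_cancel₀ h4.ne' h5

lemma hol_of_C1 {N : ℕ} {f : Sp N → ℝ} {x₀ : Sp N} (h : ContDiffAt ℝ 1 f x₀) :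
    ∃ ρ H : ℝ, 0 < ρ ∧ 0 ≤ H ∧
      ∀ x ∈ ball x₀ ρ, ∀ y ∈ ball x₀ ρ, |f y - f x| ≤ H * ‖x - y‖ ^ (1:ℝ) := by
  obtain ⟨K, t, ht, hK⟩ := h.exists_lipschitzOnWith
  obtain ⟨ρ, hρ, hsub⟩ := Metric.mem_nhds_iff.mp ht
  refine ⟨ρ, K, hρ, K.2, fun x hx y hy => ?_⟩
  have := hK.dist_le_mul x (hsub hx) y (hsub hy)
  rw [Real.dist_eq, dist_eq_norm] at this
  rw [rpow_one, abs_sub_comm]; exact this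

lemma G_pow_const {N : ℕ} (hN : 3 ≤ N) {b : ℝ} (h1 : 0 < b) (h2 : b < (N:ℝ) - 2) {e : Sp N}
    (he : ‖e‖ = 1) : G (fun y => ‖y‖ ^ (-b - 2)) e * (b * (N - 2 - b)) = gam N := by
  have he0 : e ≠ 0 := by intro h; simp [h] at he
  have hc : ContDiffAt ℝ 1 (fun y : Sp N => ‖y‖ ^ (-b - 2)) e :=
    (contDiffAt_norm ℝ he0).rpow_const_of_ne (norm_ne_zero_iff.mpr he0)
  obtain ⟨ρ, H, hρ, hH, hol⟩ := hol_of_C1 hc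
  have h := (R2 hN (adm_pow h1 h2) he0 hρ hH one_pos hol).2
  have hev : G (fun y : Sp N => ‖y‖ ^ (-b - 2)) =ᶠ[nhds e]
      fun x => G (fun y => ‖y‖ ^ (-b - 2)) e * ‖x‖ ^ (-b) := by
    filter_upwards [isOpen_ne.mem_nhds he0] with x hx
    exact G_pow_aux hN he hx
  rw [lap_congr hev, lap_const_mul, lap_norm_rpow _ he0, he] at h
  simp only [one_rpow, mul_one] at h
  rw [← h]; ring

lemma gam_pos {N : ℕ} (hN : 3 ≤ N) : 0 < gam N := by
  obtain ⟨e, he⟩ := exists_unit hN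
  have hN' : (3:ℝ) ≤ N := by exact_mod_cast hN
  have he0 : e ≠ 0 := by intro h; simp [h] at he
  have h1 : 0 < ((N:ℝ) - 2) / 2 := by linarith
  have h2 : ((N:ℝ) - 2) / 2 < (N:ℝ) - 2 := by linarith
  rw [← G_pow_const hN h1 h2 he]
  have : 0 < G (fun y : Sp N => ‖y‖ ^ (-(((N:ℝ) - 2) / 2) - 2)) e := by
    refine G_pos hN (adm_pow h1 h2) (fun y hy => by positivity) one_pos (fun y hy _ => ?_) he0
    have : 0 < ‖y‖ := norm_pos_iff.mpr hy
    positivity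
  have h3 : 0 < (N:ℝ) - 2 - ((N:ℝ) - 2) / 2 := by linarith
  positivity

/-- normalised Green operator. -/
def Gr {N : ℕ} (f : Sp N → ℝ) (x : Sp N) : ℝ := (gam N)⁻¹ * G f x

section Grlemmas
variable {N : ℕ}

lemma Gr_pow (hN : 3 ≤ N) {b : ℝ} (h1 : 0 < b) (h2 : b < (N:ℝ) - 2) {x : Sp N} (hx : x ≠ 0) :
    Gr (fun y => ‖y‖ ^ (-b - 2)) x = ‖x‖ ^ (-b) / (b * (N - 2 - b)) := by
  obtain ⟨e, he⟩ := exists_unit hN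
  have hg := gam_pos hN
  have h3 : 0 < b * ((N:ℝ) - 2 - b) := mul_pos h1 (by linarith)
  have := G_pow_const hN h1 h2 he
  unfold Gr
  rw [G_pow_aux hN he hx, ← this]
  have h4 : G (fun y : Sp N => ‖y‖ ^ (-b - 2)) e ≠ 0 := by
    intro h; rw [h, zero_mul] at this; linarith
  have h5 : (N:ℝ) - 2 - b ≠ 0 := by linarith
  field_simp

lemma Gr_mono (hN : 3 ≤ N) {f g : Sp N → ℝ} (hf : Adm f) (hg : Adm g)
    (h : ∀ y : Sp N, y ≠ 0 → f y ≤ g y) {x : Sp N} (hx : x ≠ 0) : Gr f x ≤ Gr g x :=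
  mul_le_mul_of_nonneg_left (G_mono hN hf hg h hx) (inv_nonneg.mpr (gam_pos hN).le)

lemma Gr_congr (hN : 3 ≤ N) {f g : Sp N → ℝ}
    (h : ∀ y : Sp N, y ≠ 0 → f y = g y) (x : Sp N) : Gr f x = Gr g x := by
  unfold Gr; rw [G_congr hN h]

lemma Gr_add (hN : 3 ≤ N) {f g : Sp N → ℝ} (hf : Adm f) (hg : Adm g)
    {x : Sp N} (hx : x ≠ 0) : Gr (fun y => f y + g y) x = Gr f x + Gr g x := by
  unfold Gr; rw [G_add hN hf hg hx]; ring

lemma Gr_sub (hN : 3 ≤ N) {f g : Sp N → ℝ} (hf : Adm f) (hg : Adm g)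
    {x : Sp N} (hx : x ≠ 0) : Gr (fun y => f y - g y) x = Gr f x - Gr g x := by
  unfold Gr; rw [G_sub hN hf hg hx]; ring

lemma Gr_const_mul (c : ℝ) (f : Sp N → ℝ) (x : Sp N) :
    Gr (fun y => c * f y) x = c * Gr f x := by
  unfold Gr; rw [G_const_mul]; ring

lemma Gr_nonneg (hN : 3 ≤ N) {f : Sp N → ℝ} (h : ∀ y : Sp N, y ≠ 0 → 0 ≤ f y) (x : Sp N) :
    0 ≤ Gr f x := mul_nonneg (inv_nonneg.mpr (gam_pos hN).le) (G_nonneg hN h x)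

lemma Gr_tendsto (hN : 3 ≤ N) {ι : Type*} {l : Filter ι} [l.IsCountablyGenerated]
    {F : ι → Sp N → ℝ} {f g : Sp N → ℝ} (hg : Adm g)
    (hm : ∀ᶠ n in l, AEStronglyMeasurable (F n) volume)
    (hb : ∀ᶠ n in l, ∀ y : Sp N, y ≠ 0 → |F n y| ≤ g y)
    (hlim : ∀ y : Sp N, y ≠ 0 → Tendsto (fun n => F n y) l (nhds (f y))) {x : Sp N} (hx : x ≠ 0) :
    Tendsto (fun n => Gr (F n) x) l (nhds (Gr f x)) :=
  (G_tendsto hN hg hm hb hlim hx).const_mul _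

lemma Gr_scale {f : Sp N → ℝ} {l : ℝ} (hl : 0 < l) (x : Sp N) :
    Gr (fun y => f (l • y)) x = l ^ (-2 : ℝ) * Gr f (l • x) := by
  unfold Gr; rw [G_scale hl]; ring

lemma Gr_pos (hN : 3 ≤ N) {f : Sp N → ℝ} (hf : Adm f) (h : ∀ y : Sp N, y ≠ 0 → 0 ≤ f y)
    {r : ℝ} (hr : 0 < r) (hp : ∀ y : Sp N, y ≠ 0 → ‖y‖ < r → 0 < f y)
    {x : Sp N} (hx : x ≠ 0) : 0 < Gr f x :=
  mul_pos (inv_pos.mpr (gam_pos hN)) (G_pos hN hf h hr hp hx)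

lemma Gr_contAt (hN : 3 ≤ N) {f : Sp N → ℝ} (hf : Adm f) {x : Sp N} (hx : x ≠ 0) :
    ContinuousAt (Gr f) x := (G_contAt hN hf hx).const_mul _ |>.congr (by rfl)

lemma Gr_lip (hN : 3 ≤ N) {f : Sp N → ℝ} (hf : Adm f) {x₀ : Sp N} (hx₀ : x₀ ≠ 0) :
    ∃ ρ > 0, ∃ C, 0 ≤ C ∧ ∀ x ∈ ball x₀ ρ, ∀ y ∈ ball x₀ ρ, |Gr f x - Gr f y| ≤ C * ‖x - y‖ := by
  obtain ⟨ρ, hρ, C, hC, h⟩ := G_lip hN hf hx₀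
  have hg := gam_pos hN
  refine ⟨ρ, hρ, (gam N)⁻¹ * C, by positivity, fun x hx y hy => ?_⟩
  unfold Gr
  rw [← mul_sub, abs_mul, abs_of_pos (by positivity), mul_assoc]
  exact mul_le_mul_of_nonneg_left (h x hx y hy) (by positivity)

lemma Gr_R2 (hN : 3 ≤ N) {f : Sp N → ℝ} (hf : Adm f) {x₀ : Sp N} (hx₀ : x₀ ≠ 0)
    {ρ₀ H α : ℝ} (hρ₀ : 0 < ρ₀) (hH : 0 ≤ H) (hα : 0 < α)
    (hol : ∀ x ∈ ball x₀ ρ₀, ∀ y ∈ ball x₀ ρ₀, |f y - f x| ≤ H * ‖x - y‖ ^ α) :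
    ContDiffAt ℝ 2 (Gr f) x₀ ∧ - lap (Gr f) x₀ = f x₀ := by
  obtain ⟨h1, h2⟩ := R2 hN hf hx₀ hρ₀ hH hα hol
  refine ⟨contDiffAt_const.mul h1, ?_⟩
  have hg := gam_pos hN
  have e : Gr f = fun y => (gam N)⁻¹ * G f y := rfl
  rw [e, lap_const_mul, neg_mul_eq_mul_neg, h2]
  field_simp

end Grlemmas

/-- the weight. -/
def mf {N : ℕ} (b η : ℝ) (y : Sp N) : ℝ := min (‖y‖ ^ (-b - 2)) (‖y‖ ^ (-(N:ℝ) - η))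

section mfl
variable {N : ℕ} {b η : ℝ}

lemma mf_nonneg (y : Sp N) : 0 ≤ mf b η y := le_min (by positivity) (by positivity)

lemma mf_pos {y : Sp N} (hy : y ≠ 0) : 0 < mf b η y := by
  have : 0 < ‖y‖ := norm_pos_iff.mpr hy
  exact lt_min (by positivity) (by positivity)

lemma mf_in (h2 : b < (N:ℝ) - 2) (hη : 0 < η) {y : Sp N} (hy : y ≠ 0) (h : ‖y‖ ≤ 1) :
    mf b η y = ‖y‖ ^ (-b - 2) :=
  min_eq_left (Real.rpow_le_rpow_of_exponent_ge (norm_pos_iff.mpr hy) h (by linarith))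

lemma mf_out (h2 : b < (N:ℝ) - 2) (hη : 0 < η) {y : Sp N} (h : 1 ≤ ‖y‖) :
    mf b η y = ‖y‖ ^ (-(N:ℝ) - η) :=
  min_eq_right (Real.rpow_le_rpow_of_exponent_le h (by linarith))

lemma mf_meas : Measurable (mf b η : Sp N → ℝ) :=
  (meas_norm_rpow _).min (meas_norm_rpow _)

lemma mf_adm (h1 : 0 < b) (h2 : b < (N:ℝ) - 2) : Adm (mf b η : Sp N → ℝ) := by
  refine (adm_pow h1 h2).of_abs_le mf_meas.aestronglyMeasurable fun y _ => ?_
  rw [abs_of_nonneg (mf_nonneg y)]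
  exact min_le_left _ _

lemma mf_int (hN : 3 ≤ N) (h2 : b < (N:ℝ) - 2) (hη : 0 < η) :
    Integrable (mf b η : Sp N → ℝ) := by
  have i1 : IntegrableOn (mf b η : Sp N → ℝ) (ball 0 1) := by
    refine (intOn_ball_rpow hN (s := b + 2) (r := 1) (by linarith)).mono'
      mf_meas.aestronglyMeasurable ?_
    filter_upwards with y
    rw [Real.norm_of_nonneg (mf_nonneg y), neg_add']
    exact min_le_left _ _
  have i2 : IntegrableOn (mf b η : Sp N → ℝ) (ball 0 1)ᶜ := by
    have := ((int_one_add (N := N) (s := N + η) (by linarith)).const_mul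
      (2 ^ ((N:ℝ) + η))).integrableOn (s := (ball 0 1)ᶜ)
    refine this.mono' mf_meas.aestronglyMeasurable ?_
    rw [ae_restrict_iff' measurableSet_ball.compl]
    filter_upwards with y hy
    have hy1 : 1 ≤ ‖y‖ := by simpa using hy
    rw [Real.norm_of_nonneg (mf_nonneg y)]
    refine (min_le_right _ _).trans ?_
    have e : (2:ℝ) ^ ((N:ℝ) + η) * (1 + ‖y‖) ^ (-((N:ℝ) + η)) = ((1 + ‖y‖) / 2) ^ (-((N:ℝ) + η)) := by
      rw [div_rpow (by positivity) (by norm_num), rpow_neg (by norm_num : (0:ℝ) ≤ 2)]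
      field_simp
    rw [e, neg_add']
    have : 0 ≤ (N:ℝ) := by positivity
    exact rpow_antitone_exp (by positivity) (by linarith) (by linarith)
  rw [← integrableOn_univ, ← union_compl_self (ball (0 : Sp N) 1)]
  exact i1.union i2

lemma asym_aux (hN : 3 ≤ N) (h1 : 0 < b) (h2 : b < (N:ℝ) - 2) (hη : 0 < η) {f : Sp N → ℝ} {K : ℝ}
    (hK : 0 ≤ K)
    (hm : AEStronglyMeasurable f volume) (hf : ∀ y : Sp N, y ≠ 0 → |f y| ≤ K * mf b η y) :
    Tendsto (fun x : Sp N => G f x * ‖x‖ ^ ((N:ℝ) - 2)) (Filter.comap (fun x => ‖x‖) Filter.atTop)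
      (nhds (∫ y, f y)) := by
  have hN' : (3:ℝ) ≤ N := by exact_mod_cast hN
  have hfa : Adm f := ((mf_adm (η := η) h1 h2).const_mul K).of_abs_le hm hf
  have hfi : Integrable f := by
    refine ((mf_int hN h2 hη).const_mul K).mono' hm ?_
    filter_upwards [ae_ne_zero hN] with y hy
    exact hf y hy
  set l := Filter.comap (fun x : Sp N => ‖x‖) Filter.atTop with hl
  have htl : Tendsto (fun x : Sp N => ‖x‖) l atTop := tendsto_comap
  have hcg : l.IsCountablyGenerated := Filter.comap.isCountablyGenerated _ _
  set φ : Sp N → Sp N → ℝ := fun x y => (closedBall (0 : Sp N) (‖x‖ / 2)).indicator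
    (fun y => ‖x - y‖ ^ (2 - (N:ℝ)) * ‖x‖ ^ ((N:ℝ) - 2) * f y) y with hφ
  have hφm : ∀ x, AEStronglyMeasurable (φ x) volume := by
    intro x
    exact ((((meas_ker x _).mul_const _).aestronglyMeasurable).mul hm).indicator
      measurableSet_closedBall
  -- ratio
  have hratio : ∀ x y : Sp N, 0 < ‖x‖ → ‖y‖ ≤ ‖x‖ / 2 → ‖x - y‖ ^ (2 - (N:ℝ)) * ‖x‖ ^ ((N:ℝ) - 2)
      = (‖x - y‖ / ‖x‖) ^ (2 - (N:ℝ)) := by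
    intro x y hx hy
    rw [div_rpow (norm_nonneg _) hx.le, div_eq_mul_inv, ← rpow_neg hx.le]
    congr 2; ring
  have hpos : ∀ᶠ x in l, 0 < ‖x‖ := htl.eventually (eventually_gt_atTop 0)
  have hbig : ∀ᶠ x in l, 2 ≤ ‖x‖ := htl.eventually (eventually_ge_atTop 2)
  have hdom : Tendsto (fun x => ∫ y, φ x y) l (nhds (∫ y, f y)) := by
    apply tendsto_integral_filter_of_dominated_convergence
      (fun y => (1/2 : ℝ) ^ (2 - (N:ℝ)) * |f y|)
    · exact Eventually.of_forall hφm
    · filter_upwards [hpos] with x hx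
      filter_upwards with y
      by_cases hy : y ∈ closedBall (0 : Sp N) (‖x‖ / 2)
      · have hy' : ‖y‖ ≤ ‖x‖ / 2 := by simpa using hy
        simp only [hφ]
        rw [indicator_of_mem hy, hratio x y hx hy', norm_mul, Real.norm_of_nonneg (by positivity),
          Real.norm_eq_abs]
        refine mul_le_mul_of_nonneg_right ?_ (abs_nonneg _)
        apply rpow_antitone_exp (by norm_num) _ (by linarith)
        have : ‖x‖ ≤ ‖x - y‖ + ‖y‖ := by simpa using norm_add_le (x - y) y
        rw [le_div_iff₀ hx]; linarith
      · simp only [hφ]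
        rw [indicator_of_notMem hy, norm_zero]; positivity
    · exact hfi.norm.const_mul _
    · filter_upwards with y
      have hev : ∀ᶠ x in l, φ x y = (‖x - y‖ / ‖x‖) ^ (2 - (N:ℝ)) * f y := by
        filter_upwards [htl.eventually (eventually_ge_atTop (2 * ‖y‖)), hpos] with x hx hx0
        simp only [hφ]
        have hy' : ‖y‖ ≤ ‖x‖ / 2 := by linarith
        rw [indicator_of_mem (by simpa using hy'), hratio x y hx0 hy']
      have hlim : Tendsto (fun x : Sp N => ‖x - y‖ / ‖x‖) l (nhds 1) := by
        have hq : Tendsto (fun x : Sp N => ‖y‖ / ‖x‖) l (nhds 0) := tendsto_const_nhds.div_atTop htl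
        have hlo : Tendsto (fun x : Sp N => 1 - ‖y‖ / ‖x‖) l (nhds 1) := by
          simpa using hq.const_sub 1
        have hhi : Tendsto (fun x : Sp N => 1 + ‖y‖ / ‖x‖) l (nhds 1) := by
          simpa using hq.const_add 1
        refine tendsto_of_tendsto_of_tendsto_of_le_of_le' hlo hhi ?_ ?_
        · filter_upwards [hpos] with x hx
          have : ‖x‖ ≤ ‖x - y‖ + ‖y‖ := by simpa using norm_add_le (x - y) y
          rw [le_div_iff₀ hx, sub_mul, div_mul_cancel₀ _ hx.ne']; linarith
        · filter_upwards [hpos] with x hx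
          have := norm_sub_le x y
          rw [div_le_iff₀ hx, add_mul, div_mul_cancel₀ _ hx.ne']; linarith
      have h3 : Tendsto (fun x : Sp N => (‖x - y‖ / ‖x‖) ^ (2 - (N:ℝ)) * f y) l (nhds (f y)) := by
        have := (hlim.rpow_const (p := 2 - (N:ℝ)) (Or.inl one_ne_zero)).mul_const (f y)
        simpa using this
      exact h3.congr' (by filter_upwards [hev] with x hx; exact hx.symm)
  -- tail
  have hB := (adm_pow h1 h2)
  obtain ⟨e, he⟩ := exists_unit hN
  set Cb := G (fun y => ‖y‖ ^ (-b - 2)) e with hCb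
  have htail : ∀ᶠ x in l, ‖G f x * ‖x‖ ^ ((N:ℝ) - 2) - ∫ y, φ x y‖ ≤
      (K * (1/2 : ℝ) ^ (b + 2 - N - η) * Cb) * ‖x‖ ^ (-η) := by
    filter_upwards [hbig] with x hx
    have hx0 : 0 < ‖x‖ := by linarith
    have hxne : x ≠ 0 := norm_pos_iff.mp hx0
    have i1 := (hfa.int hN hxne).mul_const (‖x‖ ^ ((N:ℝ) - 2))
    have i2 : Integrable (φ x) := by
      refine Integrable.indicator ?_ measurableSet_closedBall
      refine i1.congr ?_
      filter_upwards with y; ring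
    unfold G
    rw [← integral_mul_const, ← integral_sub i1 i2]
    have hrhs : (K * (1/2 : ℝ) ^ (b + 2 - N - η) * Cb) * ‖x‖ ^ (-η)
        = ∫ y : Sp N, (K * (‖x‖ / 2) ^ (b + 2 - N - η) * ‖x‖ ^ ((N:ℝ) - 2)) *
          (‖x - y‖ ^ (2 - (N:ℝ)) * ‖y‖ ^ (-b - 2)) := by
      rw [integral_const_mul]
      have : ∫ y : Sp N, ‖x - y‖ ^ (2 - (N:ℝ)) * ‖y‖ ^ (-b - 2) = Cb * ‖x‖ ^ (-b) :=
        G_pow_aux hN he hxne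
      rw [this, show ‖x‖ / 2 = (1/2) * ‖x‖ by ring, mul_rpow (by norm_num) hx0.le]
      have e3 : ‖x‖ ^ (-η) = ‖x‖ ^ (b + 2 - N - η) * ‖x‖ ^ ((N:ℝ) - 2) * ‖x‖ ^ (-b) := by
        rw [← rpow_add hx0, ← rpow_add hx0]; congr 1; ring
      rw [e3]; ring
    rw [hrhs]
    apply norm_integral_le_of_norm_le ((hB.int hN hxne).const_mul _)
    filter_upwards with y
    by_cases hy : y ∈ closedBall (0 : Sp N) (‖x‖ / 2)
    · simp only [hφ]
      rw [indicator_of_mem hy, show ‖x - y‖ ^ (2 - (N:ℝ)) * f y * ‖x‖ ^ ((N:ℝ) - 2)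
        - ‖x - y‖ ^ (2 - (N:ℝ)) * ‖x‖ ^ ((N:ℝ) - 2) * f y = 0 by ring, norm_zero]
      positivity
    · simp only [hφ]
      rw [indicator_of_notMem hy, sub_zero, norm_mul, norm_mul, Real.norm_of_nonneg (by positivity),
        Real.norm_of_nonneg (by positivity : 0 ≤ ‖x‖ ^ ((N:ℝ) - 2)), Real.norm_eq_abs]
      have hy' : ‖x‖ / 2 < ‖y‖ := by simpa using hy
      have hy0 : 0 < ‖y‖ := by linarith
      have h5 : |f y| ≤ K * ((‖x‖ / 2) ^ (b + 2 - N - η) * ‖y‖ ^ (-b - 2)) := by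
        refine (hf y (norm_pos_iff.mp hy0)).trans (mul_le_mul_of_nonneg_left ?_ hK)
        refine (min_le_right _ _).trans ?_
        have : ‖y‖ ^ (-(N:ℝ) - η) = ‖y‖ ^ (b + 2 - N - η) * ‖y‖ ^ (-b - 2) := by
          rw [← rpow_add hy0]; congr 1; ring
        rw [this]
        refine mul_le_mul_of_nonneg_right ?_ (by positivity)
        exact rpow_antitone_exp (by positivity) hy'.le (by linarith)
      have h6 : 0 ≤ ‖x - y‖ ^ (2 - (N:ℝ)) * ‖x‖ ^ ((N:ℝ) - 2) := by positivity
      calc ‖x - y‖ ^ (2 - (N:ℝ)) * |f y| * ‖x‖ ^ ((N:ℝ) - 2)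
          = (‖x - y‖ ^ (2 - (N:ℝ)) * ‖x‖ ^ ((N:ℝ) - 2)) * |f y| := by ring
        _ ≤ _ := mul_le_mul_of_nonneg_left h5 h6
        _ = _ := by ring
  have hz : Tendsto (fun x : Sp N => (K * (1/2 : ℝ) ^ (b + 2 - N - η) * Cb) * ‖x‖ ^ (-η)) l
      (nhds 0) := by
    have := ((tendsto_rpow_neg_atTop hη).comp htl).const_mul (K * (1/2 : ℝ) ^ (b + 2 - N - η) * Cb)
    simpa using this
  have h7 := squeeze_zero_norm' htail hz
  have h8 := h7.add hdom
  simpa using h8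

lemma Gr_asym (hN : 3 ≤ N) (h1 : 0 < b) (h2 : b < (N:ℝ) - 2) (hη : 0 < η) {f : Sp N → ℝ} {K : ℝ}
    (hK : 0 ≤ K)
    (hm : AEStronglyMeasurable f volume) (hf : ∀ y : Sp N, y ≠ 0 → |f y| ≤ K * mf b η y) :
    Tendsto (fun x : Sp N => Gr f x * ‖x‖ ^ ((N:ℝ) - 2)) (Filter.comap (fun x => ‖x‖) Filter.atTop)
      (nhds ((gam N)⁻¹ * ∫ y, f y)) := by
  have := (asym_aux hN h1 h2 hη hK hm hf).const_mul (gam N)⁻¹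
  refine this.congr fun x => ?_
  unfold Gr; ring

lemma Gr_mf_le (hN : 3 ≤ N) (h1 : 0 < b) (h2 : b < (N:ℝ) - 2) {x : Sp N} (hx : x ≠ 0) :
    Gr (mf b η) x ≤ ‖x‖ ^ (-b) / (b * (N - 2 - b)) := by
  rw [← Gr_pow hN h1 h2 hx]
  exact Gr_mono hN (mf_adm h1 h2) (adm_pow h1 h2) (fun y _ => min_le_left _ _) hx

lemma Gr_mf_decay (hN : 3 ≤ N) (h1 : 0 < b) (h2 : b < (N:ℝ) - 2) (hη : 0 < η) :
    ∃ C, 0 < C ∧ ∀ x : Sp N, 1 ≤ ‖x‖ → Gr (mf b η) x ≤ C * ‖x‖ ^ (2 - (N:ℝ)) := by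
  have hA := Gr_asym hN h1 h2 hη (K := 1) (f := mf b η) zero_le_one mf_meas.aestronglyMeasurable
    (fun y _ => by rw [one_mul, abs_of_nonneg (mf_nonneg y)])
  set I := (gam N)⁻¹ * ∫ y : Sp N, mf b η y with hI
  have hI0 : 0 ≤ I := mul_nonneg (inv_nonneg.mpr (gam_pos hN).le) (integral_nonneg mf_nonneg)
  have hev := hA.eventually (gt_mem_nhds (show I < I + 1 by linarith))
  rw [eventually_comap] at hev
  obtain ⟨R, hR⟩ := eventually_atTop.mp hev
  set R' := max R 1 with hR'
  have hR1 : 1 ≤ R' := le_max_right _ _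
  have h3 : 0 < b * ((N:ℝ) - 2 - b) := mul_pos h1 (by linarith)
  refine ⟨I + 1 + R' ^ ((N:ℝ) - 2 - b) / (b * (N - 2 - b)), by positivity, fun x hx => ?_⟩
  have hx0 : 0 < ‖x‖ := by linarith
  have e : ∀ A : ℝ, A * ‖x‖ ^ ((N:ℝ) - 2) * ‖x‖ ^ (2 - (N:ℝ)) = A := by
    intro A; rw [mul_assoc, ← rpow_add hx0]; simp
  rcases le_total R' ‖x‖ with h | h
  · have := hR ‖x‖ (le_trans (le_max_left _ _) h) x rfl
    have h4 : Gr (mf b η) x ≤ (I + 1) * ‖x‖ ^ (2 - (N:ℝ)) := by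
      rw [← e (Gr (mf b η) x)]
      exact mul_le_mul_of_nonneg_right this.le (by positivity)
    refine h4.trans (mul_le_mul_of_nonneg_right ?_ (by positivity))
    have : 0 ≤ R' ^ ((N:ℝ) - 2 - b) / (b * (N - 2 - b)) := by positivity
    linarith
  · refine (Gr_mf_le hN h1 h2 (norm_pos_iff.mp hx0)).trans ?_
    have h4 : ‖x‖ ^ (-b) ≤ R' ^ ((N:ℝ) - 2 - b) * ‖x‖ ^ (2 - (N:ℝ)) := by
      have : ‖x‖ ^ (-b) = ‖x‖ ^ ((N:ℝ) - 2 - b) * ‖x‖ ^ (2 - (N:ℝ)) := by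
        rw [← rpow_add hx0]; congr 1; ring
      rw [this]
      exact mul_le_mul_of_nonneg_right (Real.rpow_le_rpow hx0.le h (by linarith)) (by positivity)
    have h5 : ‖x‖ ^ (-b) / (b * (N - 2 - b)) ≤
        (R' ^ ((N:ℝ) - 2 - b) / (b * (N - 2 - b))) * ‖x‖ ^ (2 - (N:ℝ)) := by
      rw [div_mul_eq_mul_div]; gcongr
    refine h5.trans (mul_le_mul_of_nonneg_right ?_ (by positivity))
    linarith

lemma Gr_lower (hN : 3 ≤ N) {f : Sp N → ℝ} (hf : Adm f) (h : ∀ y : Sp N, y ≠ 0 → 0 < f y) :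
    ∃ c, 0 < c ∧ ∀ x : Sp N, 1 ≤ ‖x‖ → c * ‖x‖ ^ (2 - (N:ℝ)) ≤ Gr f x := by
  have hg := gam_pos hN
  have hN' : (3:ℝ) ≤ N := by exact_mod_cast hN
  have hfi : IntegrableOn f (ball 0 1) :=
    (hf.locallyIntegrable hN).integrableOn_isCompact (isCompact_closedBall 0 1) |>.mono_set
      ball_subset_closedBall
  have hpos : 0 < ∫ y in ball (0 : Sp N) 1, f y := by
    rw [setIntegral_pos_iff_support_of_nonneg_ae _ hfi]
    · have hsub : ball (0 : Sp N) 1 \ {0} ⊆ Function.support f ∩ ball 0 1 := by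
        rintro y ⟨hy1, hy2⟩
        exact ⟨(h y hy2).ne', hy1⟩
      refine lt_of_lt_of_le ?_ (measure_mono hsub)
      have : Nonempty (Fin N) := ⟨⟨0, by omega⟩⟩
      rw [measure_sdiff_null (measure_singleton 0)]
      exact measure_ball_pos _ _ one_pos
    · exact ae_restrict_of_ae (by filter_upwards [ae_ne_zero hN] with y hy using (h y hy).le)
  refine ⟨(gam N)⁻¹ * (2 ^ (2 - (N:ℝ)) * ∫ y in ball (0 : Sp N) 1, f y), by positivity,
    fun x hx => ?_⟩
  have hx0 : 0 < ‖x‖ := by linarith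
  unfold Gr
  rw [mul_assoc]
  refine mul_le_mul_of_nonneg_left ?_ (by positivity)
  have hfint := hf.int hN (norm_pos_iff.mp hx0)
  have h1 : ∫ y in ball (0 : Sp N) 1, ‖x - y‖ ^ (2 - (N:ℝ)) * f y ≤ G f x := by
    apply setIntegral_le_integral hfint
    filter_upwards [ae_ne_zero hN] with y hy
    have := h y hy
    simp only [Pi.zero_apply]; positivity
  refine le_trans ?_ h1
  have h2 : 2 ^ (2 - (N:ℝ)) * (∫ y in ball (0 : Sp N) 1, f y) * ‖x‖ ^ (2 - (N:ℝ))
      = ∫ y in ball (0 : Sp N) 1, (2 * ‖x‖) ^ (2 - (N:ℝ)) * f y := by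
    rw [integral_const_mul, mul_rpow (by norm_num) hx0.le]; ring
  rw [h2]
  apply integral_mono_ae (hfi.const_mul _) hfint.integrableOn
  have hnx : ∀ᵐ y : Sp N, y ≠ x := by
    have : Nonempty (Fin N) := ⟨⟨0, by omega⟩⟩
    exact compl_mem_ae_iff.mpr (measure_singleton x)
  filter_upwards [ae_restrict_mem measurableSet_ball, ae_restrict_of_ae (ae_ne_zero hN),
    ae_restrict_of_ae hnx] with y hy hy0 hyx
  refine mul_le_mul_of_nonneg_right ?_ (h y hy0).le
  have hy1 : ‖y‖ < 1 := by simpa using hy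
  have := norm_sub_le x y
  exact rpow_antitone_exp (norm_pos_iff.mpr (sub_ne_zero.mpr (Ne.symm hyx))) (by linarith)
    (by linarith)

end mfl


structure Par (N : ℕ) (p a c t m : ℝ) : Prop where
  hN : 3 ≤ N
  hp : 1 < p
  ha : 0 < a
  hap : a * p = a + 2
  haN : a < (N:ℝ) - 2
  hm : m = a - ((N:ℝ) - 2) / 2
  hc : 0 < c
  hcp : c ^ (p - 1) = a * ((N:ℝ) - 2 - a)
  ht0 : 0 < t
  htm : t < m
  htq : t ^ 2 - 2 * m * t + 2 * ((N:ℝ) - 2 - a) = 0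

lemma par_exists {N : ℕ} (hN : 3 ≤ N) {p : ℝ} (hp : p ∈ Set.Ioo ((N:ℝ)/((N:ℝ)-2)) (pc N)) :
    Par N p (2/(p-1)) (cp N p) (tauStar N p) (2/(p-1) - ((N:ℝ)-2)/2) := by
  have hN' : (3:ℝ) ≤ N := by exact_mod_cast hN
  obtain ⟨h1, h2⟩ := hp
  have hN2 : (0:ℝ) < (N:ℝ) - 2 := by linarith
  rw [div_lt_iff₀ hN2] at h1
  have hp1 : 1 < p := by nlinarith
  have hp0 : 0 < p - 1 := by linarith
  set s := Real.sqrt ((N:ℝ) - 1) with hs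
  have hs2 : s ^ 2 = (N:ℝ) - 1 := by rw [hs, sq_sqrt]; linarith
  have hs1 : 1 < s := by
    rw [hs]; apply Real.lt_sqrt_of_sq_lt; linarith
  set a := 2/(p-1) with ha
  have ha0 : 0 < a := by positivity
  have hap : a * (p-1) = 2 := by rw [ha]; field_simp
  have haN : a < (N:ℝ) - 2 := by
    by_contra h; push Not at h
    nlinarith
  have hm : s - 1 < a - ((N:ℝ)-2)/2 := by
    unfold pc at h2
    have hd : 0 < (N:ℝ) - 4 + 2 * s := by linarith
    have h3 : p - 1 < 4 / ((N:ℝ) - 4 + 2 * s) := by linarith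
    rw [lt_div_iff₀ hd] at h3
    by_contra h; push Not at h
    nlinarith
  set m := a - ((N:ℝ)-2)/2 with hmd
  have hq : 2 * ((N:ℝ) - 2 - a) < m ^ 2 := by nlinarith
  have hmu : 0 < (N:ℝ) - 2 - a := by linarith
  have hm0 : 0 < m := by linarith
  have hsq := Real.sq_sqrt (show 0 ≤ m^2 - 2 * ((N:ℝ) - 2 - a) by linarith)
  have hsp : 0 < Real.sqrt (m^2 - 2 * ((N:ℝ) - 2 - a)) := Real.sqrt_pos.mpr (by linarith)
  have htd : tauStar N p = m - Real.sqrt (m^2 - 2 * ((N:ℝ) - 2 - a)) := rfl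
  set R := Real.sqrt (m^2 - 2 * ((N:ℝ) - 2 - a)) with hR
  refine ⟨hN, hp1, ha0, by linarith, haN, rfl, ?_, ?_, ?_, ?_, ?_⟩
  · unfold cp; positivity
  · unfold cp
    rw [← ha, ← rpow_mul (by positivity), one_div, inv_mul_cancel₀ hp0.ne', rpow_one]
  · rw [htd]; nlinarith
  · rw [htd]; linarith
  · rw [htd]; nlinarith

namespace Par
variable {N : ℕ} {p a c t m : ℝ}

lemma mu (P : Par N p a c t m) : 0 < (N:ℝ) - 2 - a := by linarith [P.haN]
lemma k0 (P : Par N p a c t m) : 0 < a * ((N:ℝ) - 2 - a) := mul_pos P.ha P.mu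
lemma lb (P : Par N p a c t m) (τ : ℝ) : (a - τ) * ((N:ℝ) - 2 - (a - τ))
    = (a + 2) * ((N:ℝ) - 2 - a) - (τ ^ 2 - 2 * m * τ + 2 * ((N:ℝ) - 2 - a)) := by
  rw [P.hm]; ring
lemma lb_gt (P : Par N p a c t m) {τ : ℝ} (h1 : t < τ) (h2 : τ ≤ m) :
    (a + 2) * ((N:ℝ) - 2 - a) < (a - τ) * ((N:ℝ) - 2 - (a - τ)) := by
  rw [P.lb]
  nlinarith [P.htq, P.htm]
lemma b_pos (P : Par N p a c t m) {τ : ℝ} (h2 : τ ≤ m) : 0 < a - τ := by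
  have := P.hm
  have : (3:ℝ) ≤ N := by exact_mod_cast P.hN
  linarith
lemma b_lt (P : Par N p a c t m) {τ : ℝ} (h2 : 0 ≤ τ) : a - τ < (N:ℝ) - 2 := by
  linarith [P.haN]
lemma kap (P : Par N p a c t m) : 0 < ((N:ℝ) - 2) * p - N := by
  have h := mul_pos (sub_pos.mpr P.hp) P.mu
  nlinarith [P.hap]
lemma apm (P : Par N p a c t m) : a * (p - 1) = 2 := by linarith [P.hap]
lemma p0 (P : Par N p a c t m) : 0 < p := by linarith [P.hp]
lemma cpp (P : Par N p a c t m) : c ^ p = a * ((N:ℝ) - 2 - a) * c := by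
  have : p = (p - 1) + 1 := by ring
  rw [this, rpow_add P.hc, P.hcp, rpow_one]

/-- `S^p` -/
lemma Sp_eq (P : Par N p a c t m) {r : ℝ} (hr : 0 < r) :
    (c * r ^ (-a)) ^ p = a * ((N:ℝ) - 2 - a) * c * r ^ (-a - 2) := by
  rw [mul_rpow P.hc.le (by positivity), P.cpp, ← rpow_mul hr.le]
  congr 2; linarith [P.hap]
lemma Sp1_eq (P : Par N p a c t m) {r : ℝ} (hr : 0 < r) :
    (c * r ^ (-a)) ^ (p - 1) = a * ((N:ℝ) - 2 - a) * r ^ (-2:ℝ) := by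
  rw [mul_rpow P.hc.le (by positivity), P.hcp, ← rpow_mul hr.le]
  congr 2; linarith [P.hap]
end Par

section
variable {N : ℕ} {p a c t m : ℝ}

lemma aesm_of_contAt (hN : 3 ≤ N) {f : Sp N → ℝ} (h : ∀ x : Sp N, x ≠ 0 → ContinuousAt f x) :
    AEStronglyMeasurable f volume := by
  have h1 : ContinuousOn f ({0}ᶜ : Set (Sp N)) := fun x hx => (h x hx).continuousWithinAt
  have h2 := h1.aestronglyMeasurable (μ := volume) (measurableSet_singleton 0).compl
  rwa [Measure.restrict_eq_self_of_ae_mem] at h2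
  exact ae_ne_zero hN

lemma Gr_aesm (hN : 3 ≤ N) {f : Sp N → ℝ} (hf : Adm f) : AEStronglyMeasurable (Gr f) volume :=
  aesm_of_contAt hN fun _ hx => Gr_contAt hN hf hx

lemma aesm_rpow {f : Sp N → ℝ} (hf : AEStronglyMeasurable f volume) (s : ℝ) :
    AEStronglyMeasurable (fun y => f y ^ s) volume :=
  (hf.aemeasurable.pow_const s).aestronglyMeasurable

/-- linear operator on powers -/
lemma Gr_cpow (hN : 3 ≤ N) {b : ℝ} (K : ℝ) (h1 : 0 < b) (h2 : b < (N:ℝ) - 2) {x : Sp N} (hx : x ≠ 0) :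
    Gr (fun y => K * ‖y‖ ^ (-b - 2)) x = K / (b * ((N:ℝ) - 2 - b)) * ‖x‖ ^ (-b) := by
  rw [Gr_const_mul, Gr_pow hN h1 h2 hx]; ring

def SubS (N : ℕ) (a c : ℝ) (u : Sp N → ℝ) : Prop :=
  AEStronglyMeasurable u volume ∧ ∀ y : Sp N, y ≠ 0 → 0 ≤ u y ∧ u y ≤ c * ‖y‖ ^ (-a)

def TT (p : ℝ) (u : Sp N → ℝ) : Sp N → ℝ := Gr (fun y => u y ^ p)

lemma SubS.pow_le (P : Par N p a c t m) {u : Sp N → ℝ} (hu : SubS N a c u) {y : Sp N} (hy : y ≠ 0) :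
    u y ^ p ≤ a * ((N:ℝ) - 2 - a) * c * ‖y‖ ^ (-a - 2) := by
  rw [← P.Sp_eq (norm_pos_iff.mpr hy)]
  exact rpow_le_rpow (hu.2 y hy).1 (hu.2 y hy).2 P.p0.le

lemma adm_Sp (P : Par N p a c t m) (K : ℝ) : Adm (fun y : Sp N => K * ‖y‖ ^ (-a - 2)) :=
  (adm_pow P.ha P.haN).const_mul _

lemma SubS.adm (P : Par N p a c t m) {u : Sp N → ℝ} (hu : SubS N a c u) :
    Adm (fun y => u y ^ p) := by
  refine (adm_Sp P (a * ((N:ℝ) - 2 - a) * c)).of_abs_le (aesm_rpow hu.1 p) fun y hy => ?_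
  rw [abs_of_nonneg (rpow_nonneg (hu.2 y hy).1 _)]
  exact hu.pow_le P hy

lemma Gr_S (P : Par N p a c t m) {x : Sp N} (hx : x ≠ 0) :
    Gr (fun y => a * ((N:ℝ) - 2 - a) * c * ‖y‖ ^ (-a - 2)) x = c * ‖x‖ ^ (-a) := by
  rw [Gr_cpow P.hN _ P.ha P.haN hx]
  have := P.k0
  field_simp [P.mu.ne', P.ha.ne']

lemma SubS.TT (P : Par N p a c t m) {u : Sp N → ℝ} (hu : SubS N a c u) : SubS N a c (TT p u) := by
  refine ⟨Gr_aesm P.hN (hu.adm P), fun y hy => ⟨?_, ?_⟩⟩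
  · exact Gr_nonneg P.hN (fun z hz => rpow_nonneg (hu.2 z hz).1 _) _
  · rw [← Gr_S P hy]
    exact Gr_mono P.hN (hu.adm P) (adm_Sp P _) (fun z hz => hu.pow_le P hz) hy

lemma TT_mono (P : Par N p a c t m) {u v : Sp N → ℝ} (hu : SubS N a c u) (hv : SubS N a c v)
    (h : ∀ y : Sp N, y ≠ 0 → u y ≤ v y) {x : Sp N} (hx : x ≠ 0) : TT p u x ≤ TT p v x :=
  Gr_mono P.hN (hu.adm P) (hv.adm P) (fun y hy => rpow_le_rpow (hu.2 y hy).1 (h y hy) P.p0.le) hx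

def PP (a : ℝ) (u : Sp N → ℝ) : Prop :=
  ∀ l : ℝ, 1 ≤ l → ∀ x : Sp N, x ≠ 0 → l ^ a * u (l • x) ≤ u x

lemma aesm_smul {f : Sp N → ℝ} (hf : AEStronglyMeasurable f volume) {l : ℝ} (hl : 0 < l) :
    AEStronglyMeasurable (fun y => f (l • y)) volume := by
  have hq : Measure.QuasiMeasurePreserving (fun y : Sp N => l • y) volume volume := by
    refine ⟨measurable_const_smul l, ?_⟩
    rw [Measure.map_addHaar_smul _ hl.ne']
    exact Measure.smul_absolutelyContinuous
  exact hf.comp_quasiMeasurePreserving hq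

lemma smul_ne {l : ℝ} (hl : 0 < l) {x : Sp N} (hx : x ≠ 0) : l • x ≠ 0 :=
  smul_ne_zero hl.ne' hx

lemma norm_smul_pos' {l : ℝ} (hl : 0 < l) (x : Sp N) : ‖l • x‖ = l * ‖x‖ := by
  rw [norm_smul, Real.norm_of_nonneg hl.le]

def scl (a l : ℝ) (u : Sp N → ℝ) : Sp N → ℝ := fun x => l ^ a * u (l • x)

lemma SubS.scl {u : Sp N → ℝ} (hu : SubS N a c u) {l : ℝ} (hl : 0 < l) : SubS N a c (scl a l u) := by
  refine ⟨(aesm_smul hu.1 hl).const_mul _, fun y hy => ⟨?_, ?_⟩⟩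
  · exact mul_nonneg (by positivity) (hu.2 _ (smul_ne hl hy)).1
  · have := (hu.2 _ (smul_ne hl hy)).2
    rw [norm_smul_pos' hl, mul_rpow hl.le (norm_nonneg _)] at this
    calc l ^ a * u (l • y) ≤ l ^ a * (c * (l ^ (-a) * ‖y‖ ^ (-a))) := by gcongr
      _ = (l ^ a * l ^ (-a)) * (c * ‖y‖ ^ (-a)) := by ring
      _ = c * ‖y‖ ^ (-a) := by rw [← rpow_add hl]; simp

lemma Gr_scl {f : Sp N → ℝ} {l : ℝ} (hl : 0 < l) (x : Sp N) :
    Gr (scl (a + 2) l f) x = scl a l (Gr f) x := by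
  unfold scl
  rw [Gr_const_mul, Gr_scale hl, ← mul_assoc, ← rpow_add hl]
  congr 2; ring

lemma TT_scl (P : Par N p a c t m) {u : Sp N → ℝ} (hu : SubS N a c u) {l : ℝ} (hl : 0 < l)
    (x : Sp N) : TT p (scl a l u) x = scl a l (TT p u) x := by
  unfold TT
  rw [← Gr_scl hl]
  apply Gr_congr P.hN
  intro y hy
  unfold scl
  rw [mul_rpow (by positivity) (hu.2 _ (smul_ne hl hy)).1, ← rpow_mul hl.le, P.hap]

lemma PP.TT (P : Par N p a c t m) {u : Sp N → ℝ} (hu : SubS N a c u) (h : PP a u) :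
    PP a (TT p u) := by
  intro l hl x hx
  have hl0 : 0 < l := by linarith
  have := TT_mono P (hu.scl hl0) hu (fun y hy => h l hl y hy) hx
  rwa [TT_scl P hu hl0] at this

end

section
variable {N : ℕ} {p a c t m : ℝ}

lemma sc_low {p z : ℝ} (hp : 1 < p) : 1 - p * z ≤ (max (1 - z) 0) ^ p := by
  rcases le_total z 1 with h | h
  · rw [max_eq_left (by linarith)]
    have := one_add_mul_self_le_rpow_one_add (s := -z) (by linarith) hp.le
    rw [← sub_eq_add_neg] at this
    linarith
  · have : 0 ≤ (max (1 - z) 0) ^ p := rpow_nonneg (le_max_right _ _) _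
    nlinarith

lemma sc_up {p z q : ℝ} (hp : 1 < p) (h0 : 0 ≤ z) (h1 : z ≤ 1) (hq : q ≤ 2) (hq1 : 0 < q) :
    (1 - z) ^ p ≤ 1 - p * z + p ^ 2 * z ^ q := by
  have e1 : (1 - z) ^ p * (1 + z) ^ p ≤ 1 := by
    rw [← mul_rpow (by linarith) (by linarith)]
    apply rpow_le_one <;> nlinarith
  have e2 := one_add_mul_self_le_rpow_one_add (s := z) (by linarith) hp.le
  have e3 : 0 ≤ (1 - z) ^ p := rpow_nonneg (by linarith) _
  have e4 : (1 - z) ^ p * (1 + p * z) ≤ 1 := le_trans (by gcongr) e1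
  have hpz : 0 ≤ p * z := by nlinarith
  have e5 : (1 - z) ^ p ≤ 1 - p * z + (p * z) ^ 2 := by
    have : (1 - p * z + (p * z) ^ 2) * (1 + p * z) = 1 + (p * z) ^ 3 := by ring
    have h3 : 0 ≤ (p * z) ^ 3 := by positivity
    by_contra hcon; push Not at hcon
    nlinarith
  have e6 : z ^ 2 ≤ z ^ q := by
    rcases h0.eq_or_lt with h | h
    · rw [← h, zero_rpow hq1.ne']; norm_num
    · have := rpow_le_rpow_of_exponent_ge h h1 hq
      rwa [rpow_two] at this
  nlinarith [mul_le_mul_of_nonneg_left e6 (sq_nonneg p)]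

/-- pointwise upper estimate -/
lemma up_pt (P : Par N p a c t m) {q D r v : ℝ} (hq1 : 1 < q) (hq2 : q ≤ 2) (hr : 0 < r) (hD : 0 ≤ D)
    (hv0 : 0 ≤ v) (hv1 : v ≤ c * r ^ (-a)) (hv2 : v ≤ c * r ^ (-a) - r ^ (-(a - t)) + D * r ^ (-(a - q * t))) :
    v ^ p ≤ a * ((N:ℝ) - 2 - a) * c * r ^ (-a - 2) - p * (a * ((N:ℝ) - 2 - a)) * r ^ (-(a - t) - 2)
      + (p * (a * ((N:ℝ) - 2 - a)) * D + a * ((N:ℝ) - 2 - a) * c * p ^ 2 * c ^ (-q)) * r ^ (-(a - q * t) - 2) := by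
  have hc := P.hc
  have hk := P.k0
  set k := a * ((N:ℝ) - 2 - a) with hkd
  set z := (r ^ t - D * r ^ (q * t)) / c with hz
  have e1 : r ^ (-(a - t)) = r ^ (-a) * r ^ t := by rw [← rpow_add hr]; congr 1; ring
  have e2 : r ^ (-(a - q * t)) = r ^ (-a) * r ^ (q * t) := by rw [← rpow_add hr]; congr 1; ring
  have e3 : r ^ (-(a - t) - 2) = r ^ (-a - 2) * r ^ t := by rw [← rpow_add hr]; congr 1; ring
  have e4 : r ^ (-(a - q * t) - 2) = r ^ (-a - 2) * r ^ (q * t) := by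
    rw [← rpow_add hr]; congr 1; ring
  have hs := P.Sp_eq hr
  rw [← hkd] at hs
  have hs0 : 0 < c * r ^ (-a) := by positivity
  have hv2' : v ≤ c * r ^ (-a) * (1 - z) := by
    rw [e1, e2] at hv2
    have : c * r ^ (-a) * (1 - z) = c * r ^ (-a) - r ^ (-a) * (r ^ t - D * r ^ (q * t)) := by
      rw [hz]; field_simp
    rw [this]; linarith
  have hzp : 0 ≤ r ^ (q * t) * c ^ (-q) := by positivity
  have key : v ^ p ≤ (c * r ^ (-a)) ^ p * (1 - p * z + p ^ 2 * (r ^ (q * t) * c ^ (-q))) := by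
    have hp0 := P.p0
    rcases le_total z 0 with h | h
    · calc v ^ p ≤ (c * r ^ (-a)) ^ p * 1 := by rw [mul_one]; exact rpow_le_rpow hv0 hv1 P.p0.le
        _ ≤ _ := by
          gcongr
          nlinarith [mul_nonneg (sq_nonneg p) hzp]
    · have hz1 : z ≤ 1 := by
        by_contra hcon; push Not at hcon
        nlinarith
      calc v ^ p ≤ (c * r ^ (-a) * (1 - z)) ^ p := rpow_le_rpow hv0 hv2' P.p0.le
        _ = (c * r ^ (-a)) ^ p * (1 - z) ^ p := mul_rpow hs0.le (by linarith)
        _ ≤ _ := by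
          gcongr
          refine (sc_up P.hp h hz1 hq2 (by linarith)).trans ?_
          gcongr
          calc z ^ q ≤ (r ^ t / c) ^ q := by
                apply rpow_le_rpow h _ (by linarith)
                rw [hz]; gcongr
                have : 0 ≤ D * r ^ (q * t) := by positivity
                linarith
            _ = _ := by
                rw [div_rpow (by positivity) hc.le, ← rpow_mul hr.le, rpow_neg hc.le, mul_comm t q]
                rfl
  refine key.trans (le_of_eq ?_)
  rw [hs, e3, e4, hz]
  field_simp
  ring

lemma exists_params (P : Par N p a c t m) : ∃ q : ℝ, 1 < q ∧ q ≤ 2 ∧ t < q * t ∧ q * t ≤ m := by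
  have h := P.ht0
  refine ⟨min 2 (m / t), ?_, min_le_left _ _, ?_, ?_⟩
  · rw [lt_min_iff, lt_div_iff₀ h]; exact ⟨by norm_num, by linarith [P.htm]⟩
  · have : 1 < min 2 (m / t) := by
      rw [lt_min_iff, lt_div_iff₀ h]; exact ⟨by norm_num, by linarith [P.htm]⟩
    nlinarith
  · calc min 2 (m / t) * t ≤ m / t * t := by gcongr; exact min_le_right _ _
      _ = m := by field_simp

structure IsW (N : ℕ) (p a c t : ℝ) (w : Sp N → ℝ) : Prop where
  sub : SubS N a c w
  fix : ∀ x : Sp N, x ≠ 0 → TT p w x = w x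
  pp : PP a w
  pos : ∀ x : Sp N, x ≠ 0 → 0 < w x
  low : ∃ A : ℝ, 0 ≤ A ∧ ∀ x : Sp N, x ≠ 0 → c * ‖x‖ ^ (-a) - A * ‖x‖ ^ (-(a - t)) ≤ w x

def W0 (a c t : ℝ) (y : Sp N) : ℝ := max (c * ‖y‖ ^ (-a) - ‖y‖ ^ (-(a - t))) 0

lemma W0_sub (P : Par N p a c t m) : SubS N a c (W0 a c t : Sp N → ℝ) := by
  refine ⟨?_, fun y hy => ⟨le_max_right _ _, ?_⟩⟩
  · apply Measurable.aestronglyMeasurable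
    exact ((measurable_const.mul (meas_norm_rpow _)).sub (meas_norm_rpow _)).max measurable_const
  · have := P.hc
    apply max_le
    · have : 0 ≤ ‖y‖ ^ (-(a - t)) := by positivity
      linarith
    · positivity

lemma W0_PP (P : Par N p a c t m) : PP a (W0 a c t : Sp N → ℝ) := by
  intro l hl x hx
  have hl0 : 0 < l := by linarith
  have hx0 := norm_pos_iff.mpr hx
  unfold W0
  rw [norm_smul_pos' hl0, mul_rpow hl0.le hx0.le, mul_rpow hl0.le hx0.le,
    mul_max_of_nonneg _ _ (by positivity)]
  apply max_le_max
  · have e : l ^ a * (c * (l ^ (-a) * ‖x‖ ^ (-a)) - l ^ (-(a - t)) * ‖x‖ ^ (-(a - t)))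
      = (l ^ a * l ^ (-a)) * (c * ‖x‖ ^ (-a)) - (l ^ a * l ^ (-(a - t))) * ‖x‖ ^ (-(a - t)) := by ring
    rw [e, ← rpow_add hl0, ← rpow_add hl0]
    have e2 : a + -(a - t) = t := by ring
    rw [e2]
    have h1 : 1 ≤ l ^ t := one_le_rpow hl P.ht0.le
    have h2 : 0 ≤ ‖x‖ ^ (-(a - t)) := by positivity
    simp only [add_neg_cancel, rpow_zero, one_mul]
    nlinarith
  · simp

lemma W0_TT (P : Par N p a c t m) {x : Sp N} (hx : x ≠ 0) : W0 a c t x ≤ TT p (W0 a c t) x := by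
  have hk := P.k0
  have hc := P.hc
  have hsub := W0_sub P
  refine max_le ?_ ((hsub.TT P).2 x hx).1
  have hb0 := P.b_pos P.htm.le
  have hb1 := P.b_lt P.ht0.le
  have hA := (adm_pow (N := N) hb0 hb1).const_mul (p * (a * ((N:ℝ) - 2 - a)))
  have h1 := Gr_sub P.hN (adm_Sp P (a * ((N:ℝ) - 2 - a) * c)) hA hx
  have e2 : p * (a * ((N:ℝ) - 2 - a)) / ((a - t) * ((N:ℝ) - 2 - (a - t))) = 1 := by
    have h := P.lb t
    rw [P.htq, sub_zero] at h
    have e3 : p * (a * ((N:ℝ) - 2 - a)) = (a + 2) * ((N:ℝ) - 2 - a) := by rw [← P.hap]; ring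
    rw [h, e3, div_self]
    exact (mul_pos (by linarith [P.ha]) P.mu).ne'
  rw [Gr_S P hx, Gr_cpow P.hN _ hb0 hb1 hx, e2, one_mul] at h1
  rw [← h1]
  refine Gr_mono P.hN ((adm_Sp P _).sub hA) (hsub.adm P) ?_ hx
  intro y hy
  have hr := norm_pos_iff.mpr hy
  set r := ‖y‖ with hrd
  have e3 : W0 a c t y = c * r ^ (-a) * max (1 - r ^ t / c) 0 := by
    unfold W0
    rw [mul_max_of_nonneg _ _ (by positivity), mul_zero]
    congr 1
    have e1 : r ^ (-(a - t)) = r ^ (-a) * r ^ t := by rw [← rpow_add hr]; congr 1; ring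
    rw [← hrd, e1]; field_simp
  rw [e3, mul_rpow (by positivity) (le_max_right _ _), P.Sp_eq hr]
  have := sc_low (z := r ^ t / c) P.hp
  have e4 : r ^ (-(a - t) - 2) = r ^ (-a - 2) * r ^ t := by rw [← rpow_add hr]; congr 1; ring
  rw [e4]
  calc _ = a * ((N:ℝ) - 2 - a) * c * r ^ (-a - 2) * (1 - p * (r ^ t / c)) := by field_simp
    _ ≤ _ := by gcongr

lemma step1a (P : Par N p a c t m) : ∃ w : Sp N → ℝ, IsW N p a c t w ∧
    ∃ ρ θ : ℝ, 0 < ρ ∧ 0 < θ ∧ θ < 1 ∧ ∀ x : Sp N, ρ ≤ ‖x‖ → w x ≤ θ * (c * ‖x‖ ^ (-a)) := by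
  obtain ⟨q, hq1, hq2, hqt, hqm⟩ := exists_params P
  have hk := P.k0
  have hc := P.hc
  set k := a * ((N:ℝ) - 2 - a) with hkd
  have hpk : p * k = (a + 2) * ((N:ℝ) - 2 - a) := by rw [hkd, ← P.hap]; ring
  have hp0 := P.p0
  have hlq := P.lb_gt hqt hqm
  rw [← hpk] at hlq
  have hbq0 := P.b_pos hqm
  have hbq1 := P.b_lt (by linarith [P.ht0] : 0 ≤ q * t)
  have hb0 := P.b_pos P.htm.le
  have hb1 := P.b_lt P.ht0.le
  set L := (a - q * t) * ((N:ℝ) - 2 - (a - q * t)) with hL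
  have hL0 : 0 < L := by rw [hL]; exact mul_pos hbq0 (by linarith)
  set C := k * c * p ^ 2 * c ^ (-q) with hC
  have hC0 : 0 < C := by positivity
  -- choice of D
  set ρ0 := c ^ (1 / t) with hρ0
  have hρ0p : 0 < ρ0 := by positivity
  set D := max (C / (L - p * k)) (ρ0 ^ (t - q * t)) with hD
  have hD0 : 0 < D := lt_of_lt_of_le (by positivity) (le_max_right _ _)
  have hD1 : p * k * D + C ≤ D * L := by
    have : C / (L - p * k) ≤ D := le_max_left _ _
    rw [div_le_iff₀ (by linarith)] at this
    linarith
  set v : ℕ → Sp N → ℝ := fun n => (TT p)^[n] (W0 a c t) with hv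
  have hvs : ∀ n, v (n+1) = TT p (v n) := fun n => Function.iterate_succ_apply' _ _ _
  have hsub : ∀ n, SubS N a c (v n) := by
    intro n
    induction n with
    | zero => exact W0_sub P
    | succ n ih => rw [hvs]; exact ih.TT P
  have hmon : ∀ n, ∀ x : Sp N, x ≠ 0 → v n x ≤ v (n+1) x := by
    intro n
    induction n with
    | zero => intro x hx; exact W0_TT P hx
    | succ n ih =>
      intro x hx; rw [hvs, hvs (n+1)]; exact TT_mono P (hsub _) (hsub _) ih hx
  have hPP : ∀ n, PP a (v n) := by
    intro n
    induction n with
    | zero => exact W0_PP P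
    | succ n ih => rw [hvs]; exact ih.TT P (hsub n)
  have hup : ∀ n, ∀ x : Sp N, x ≠ 0 →
      v n x ≤ c * ‖x‖ ^ (-a) - ‖x‖ ^ (-(a - t)) + D * ‖x‖ ^ (-(a - q * t)) := by
    intro n
    induction n with
    | zero =>
      intro x hx
      have hr := norm_pos_iff.mpr hx
      change max _ _ ≤ _
      set r := ‖x‖
      apply max_le
      · have : 0 ≤ D * r ^ (-(a - q * t)) := by positivity
        linarith
      · have e1 : r ^ (-(a - t)) = r ^ (-a) * r ^ t := by rw [← rpow_add hr]; congr 1; ring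
        have e2 : r ^ (-(a - q * t)) = r ^ (-a) * r ^ (q * t) := by rw [← rpow_add hr]; congr 1; ring
        rw [e1, e2]
        have : r ^ t ≤ c + D * r ^ (q * t) := by
          rcases le_total r ρ0 with h | h
          · have h1 : r ^ t ≤ c := by
              calc r ^ t ≤ ρ0 ^ t := rpow_le_rpow hr.le h P.ht0.le
                _ = c := by rw [hρ0, ← rpow_mul hc.le, one_div, inv_mul_cancel₀ P.ht0.ne', rpow_one]
            have : 0 ≤ D * r ^ (q * t) := by positivity
            linarith
          · have h1 : ρ0 ^ (t - q * t) ≤ D := le_max_right _ _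
            have h2 := rpow_antitone_exp hρ0p h (by linarith : t - q * t ≤ 0)
            have h3 : r ^ t = r ^ (t - q * t) * r ^ (q * t) := by
              rw [← rpow_add hr]; congr 1; ring
            have : r ^ (t - q * t) * r ^ (q * t) ≤ D * r ^ (q * t) := by
              gcongr; linarith
            rw [h3]; linarith
        have hra : 0 < r ^ (-a) := by positivity
        nlinarith
    | succ n ih =>
      intro x hx
      rw [hvs]
      have hA1 := adm_Sp P (k * c)
      have hA2 := (adm_pow (N := N) hb0 hb1).const_mul (p * k)
      have hA3 := (adm_pow (N := N) hbq0 hbq1).const_mul (p * k * D + C)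
      have h1 := Gr_mono P.hN ((hsub n).adm P) ((hA1.sub hA2).add hA3)
        (fun y hy => up_pt P hq1 hq2 (norm_pos_iff.mpr hy) hD0.le ((hsub n).2 y hy).1
          ((hsub n).2 y hy).2 (ih y hy)) hx
      rw [Gr_add P.hN (hA1.sub hA2) hA3 hx, Gr_sub P.hN hA1 hA2 hx, Gr_S P hx,
        Gr_cpow P.hN _ hb0 hb1 hx, Gr_cpow P.hN _ hbq0 hbq1 hx] at h1
      refine h1.trans ?_
      have e2 : p * k / ((a - t) * ((N:ℝ) - 2 - (a - t))) = 1 := by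
        have h := P.lb t
        rw [P.htq, sub_zero] at h
        rw [h, hpk, div_self]
        exact (mul_pos (by linarith [P.ha]) P.mu).ne'
      rw [e2, one_mul, ← hL]
      gcongr
      rw [div_le_iff₀ hL0]; exact hD1
  have hmono : ∀ x : Sp N, x ≠ 0 → Monotone (fun n => v n x) :=
    fun x hx => monotone_nat_of_le_succ fun n => hmon n x hx
  set w : Sp N → ℝ := fun x => ⨆ n, v n x with hw
  have hlim : ∀ x : Sp N, x ≠ 0 → Tendsto (fun n => v n x) atTop (nhds (w x)) := by
    intro x hx
    apply tendsto_atTop_ciSup (hmono x hx)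
    exact ⟨c * ‖x‖ ^ (-a), by rintro _ ⟨n, rfl⟩; exact ((hsub n).2 x hx).2⟩
  have hwsub : SubS N a c w := by
    refine ⟨?_, fun y hy => ⟨?_, ?_⟩⟩
    · refine aestronglyMeasurable_of_tendsto_ae atTop (fun n => (hsub n).1) ?_
      filter_upwards [ae_ne_zero P.hN] with x hx using hlim x hx
    · exact ge_of_tendsto' (hlim y hy) fun n => ((hsub n).2 y hy).1
    · exact le_of_tendsto' (hlim y hy) fun n => ((hsub n).2 y hy).2
  have hwfix : ∀ x : Sp N, x ≠ 0 → TT p w x = w x := by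
    intro x hx
    have h1 : Tendsto (fun n => TT p (v n) x) atTop (nhds (TT p w x)) := by
      refine Gr_tendsto P.hN (adm_Sp P (k * c)) (Eventually.of_forall fun n => aesm_rpow (hsub n).1 p)
        (Eventually.of_forall fun n y hy => ?_) (fun y hy => ?_) hx
      · rw [abs_of_nonneg (rpow_nonneg ((hsub n).2 y hy).1 _)]
        exact (hsub n).pow_le P hy
      · exact (hlim y hy).rpow_const (Or.inr P.p0.le)
    have h2 := (tendsto_add_atTop_iff_nat 1).mpr (hlim x hx)
    simp only [hvs] at h2
    exact tendsto_nhds_unique h1 h2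
  have hwpp : PP a w := by
    intro l hl x hx
    have hl0 : 0 < l := by linarith
    exact le_of_tendsto_of_tendsto' ((hlim _ (smul_ne hl0 hx)).const_mul _) (hlim x hx)
      fun n => hPP n l hl x hx
  have hwlow : ∀ x : Sp N, x ≠ 0 → W0 a c t x ≤ w x := fun x hx =>
    ge_of_tendsto (hlim x hx) (Eventually.of_forall fun n => hmono x hx (Nat.zero_le n))
  have hwup : ∀ x : Sp N, x ≠ 0 →
      w x ≤ c * ‖x‖ ^ (-a) - ‖x‖ ^ (-(a - t)) + D * ‖x‖ ^ (-(a - q * t)) := fun x hx =>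
    le_of_tendsto' (hlim x hx) fun n => hup n x hx
  refine ⟨w, ⟨hwsub, hwfix, hwpp, ?_, ⟨1, zero_le_one, fun x hx => ?_⟩⟩, ?_⟩
  · intro x hx
    rw [← hwfix x hx]
    refine Gr_pos P.hN (hwsub.adm P) (fun y hy => rpow_nonneg (hwsub.2 y hy).1 _) hρ0p ?_ hx
    intro y hy hyr
    apply rpow_pos_of_pos
    refine lt_of_lt_of_le ?_ (hwlow y hy)
    apply lt_max_of_lt_left
    have hr := norm_pos_iff.mpr hy
    set r := ‖y‖
    have e1 : r ^ (-(a - t)) = r ^ (-a) * r ^ t := by rw [← rpow_add hr]; congr 1; ring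
    have h1 : r ^ t < c := by
      calc r ^ t < ρ0 ^ t := rpow_lt_rpow hr.le hyr P.ht0
        _ = c := by rw [hρ0, ← rpow_mul hc.le, one_div, inv_mul_cancel₀ P.ht0.ne', rpow_one]
    have hra : 0 < r ^ (-a) := by positivity
    rw [e1]; nlinarith
  · rw [one_mul]; exact (le_max_left _ _).trans (hwlow x hx)
  · -- choice of ρ
    set τ := q * t - t with hτ
    have hτ0 : 0 < τ := by linarith
    set ρ := min ((1/(2*D)) ^ (1/τ)) ρ0 with hρ
    have hρp : 0 < ρ := lt_min (by positivity) hρ0p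
    have h1 : D * ρ ^ τ ≤ 1 / 2 := by
      have : ρ ^ τ ≤ 1/(2*D) := by
        calc ρ ^ τ ≤ ((1/(2*D)) ^ (1/τ)) ^ τ := rpow_le_rpow hρp.le (min_le_left _ _) hτ0.le
          _ = _ := by rw [← rpow_mul (by positivity), one_div τ, inv_mul_cancel₀ hτ0.ne', rpow_one]
      calc D * ρ ^ τ ≤ D * (1/(2*D)) := by gcongr
        _ = 1/2 := by field_simp
    have h2 : ρ ^ t ≤ c := by
      calc ρ ^ t ≤ ρ0 ^ t := rpow_le_rpow hρp.le (min_le_right _ _) P.ht0.le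
        _ = c := by rw [hρ0, ← rpow_mul hc.le, one_div, inv_mul_cancel₀ P.ht0.ne', rpow_one]
    have hrt : 0 < ρ ^ t := by positivity
    refine ⟨ρ, 1 - ρ ^ t / (2 * c), hρp, ?_, ?_, ?_⟩
    · have : ρ ^ t / (2 * c) ≤ 1 / 2 := by
        rw [div_le_div_iff₀ (by positivity) (by norm_num)]; linarith
      linarith
    · have : 0 < ρ ^ t / (2 * c) := by positivity
      linarith
    · intro x hxρ
      have hr : 0 < ‖x‖ := lt_of_lt_of_le hρp hxρ
      have hx : x ≠ 0 := norm_pos_iff.mp hr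
      set l := ‖x‖ / ρ with hl
      have hl1 : 1 ≤ l := by rw [hl, le_div_iff₀ hρp]; linarith
      have hl0 : 0 < l := by linarith
      have hx' : l⁻¹ • x ≠ 0 := smul_ne (by positivity) hx
      have hn : ‖l⁻¹ • x‖ = ρ := by
        rw [norm_smul_pos' (by positivity), hl]; field_simp
      have h3 := hwpp l hl1 _ hx'
      rw [smul_inv_smul₀ hl0.ne'] at h3
      have h4 := hwup _ hx'
      rw [hn] at h4
      have e1 : ρ ^ (-(a - t)) = ρ ^ (-a) * ρ ^ t := by rw [← rpow_add hρp]; congr 1; ring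
      have e2 : ρ ^ (-(a - q * t)) = ρ ^ (-a) * (ρ ^ t * ρ ^ τ) := by
        rw [← rpow_add hρp, ← rpow_add hρp]; congr 1; rw [hτ]; ring
      rw [e1, e2] at h4
      have hra : 0 < ρ ^ (-a) := by positivity
      have h5 : l ^ a * w x ≤ ρ ^ (-a) * (c - ρ ^ t / 2) := by
        have : D * (ρ ^ (-a) * (ρ ^ t * ρ ^ τ)) ≤ ρ ^ (-a) * ρ ^ t * (1/2) := by
          calc D * (ρ ^ (-a) * (ρ ^ t * ρ ^ τ)) = ρ ^ (-a) * ρ ^ t * (D * ρ ^ τ) := by ring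
            _ ≤ _ := by gcongr
        linarith
      have hla : 0 < l ^ a := by positivity
      have e5 : ‖x‖ ^ (-a) = (l ^ a)⁻¹ * ρ ^ (-a) := by
        have : ‖x‖ = l * ρ := by rw [hl]; field_simp
        rw [this, mul_rpow hl0.le hρp.le, rpow_neg hl0.le]
      rw [e5]
      have : w x ≤ (l ^ a)⁻¹ * (ρ ^ (-a) * (c - ρ ^ t / 2)) := by
        rw [inv_mul_eq_div, le_div_iff₀ hla]; linarith
      refine this.trans (le_of_eq ?_)
      field_simp

end

section
variable {N : ℕ} {p a c t m : ℝ}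

lemma SubS.pow_split (P : Par N p a c t m) {w : Sp N → ℝ} {θ : ℝ} (hθ : 0 < θ) {y : Sp N} (hy : y ≠ 0)
    (h0 : 0 ≤ w y) (h : w y ≤ θ * (c * ‖y‖ ^ (-a))) :
    w y ^ p ≤ θ ^ (p - 1) * (a * ((N:ℝ) - 2 - a)) * ‖y‖ ^ (-2:ℝ) * w y := by
  have hr := norm_pos_iff.mpr hy
  have hc := P.hc
  have hp := P.hp
  have e : w y ^ p = w y ^ (p - 1) * w y := by
    rw [← rpow_add_one' h0 (by linarith [P.hp])]; congr 1; ring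
  rw [e]
  gcongr
  calc w y ^ (p - 1) ≤ (θ * (c * ‖y‖ ^ (-a))) ^ (p - 1) :=
        rpow_le_rpow h0 h (by linarith)
    _ = _ := by
        rw [mul_rpow hθ.le (by positivity), P.Sp1_eq hr]; ring

lemma decay_aux (P : Par N p a c t m) {w : Sp N → ℝ} (hw : IsW N p a c t w) {R θ b : ℝ} (hR : 0 < R)
    (hθ : 0 < θ) (hθ1 : θ < 1) (h : ∀ x : Sp N, R ≤ ‖x‖ → w x ≤ θ * (c * ‖x‖ ^ (-a)))
    (hb : a < b) (hb2 : b < (N:ℝ) - 2)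
    (hΘ : θ ^ (p - 1) * (a * ((N:ℝ) - 2 - a)) < b * ((N:ℝ) - 2 - b)) :
    ∃ A : ℝ, 0 < A ∧ ∀ x : Sp N, x ≠ 0 → w x ≤ A * ‖x‖ ^ (-b) := by
  have hk := P.k0
  have hc := P.hc
  have hb0 : 0 < b := P.ha.trans hb
  set k := a * ((N:ℝ) - 2 - a) with hkd
  set L := b * ((N:ℝ) - 2 - b) with hL
  have hL0 : 0 < L := mul_pos hb0 (by linarith)
  set κ := θ ^ (p - 1) with hκ
  have hκ0 : 0 < κ := by positivity
  have hκ1 : κ < 1 := rpow_lt_one hθ.le hθ1 (by linarith [P.hp])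
  set A1 := k * c * R ^ (b - a) with hA1
  have hA1p : 0 < A1 := by positivity
  set A := A1 / (L - κ * k) with hA
  have hA0 : 0 < A := div_pos hA1p (by linarith)
  have hAe : A1 + κ * k * A = A * L := by
    have : A * (L - κ * k) = A1 := by rw [hA]; field_simp [(by linarith : L - κ * k ≠ 0)]
    linarith
  have key : ∀ n : ℕ, ∀ x : Sp N, x ≠ 0 → w x ≤ A * ‖x‖ ^ (-b) + κ ^ n * (c * ‖x‖ ^ (-a)) := by
    intro n
    induction n with
    | zero =>
      intro x hx
      have := (hw.sub.2 x hx).2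
      have h2 : 0 ≤ A * ‖x‖ ^ (-b) := by positivity
      simp only [pow_zero, one_mul]; linarith
    | succ n ih =>
      intro x hx
      have hB1 := (adm_pow (N := N) hb0 hb2).const_mul (A1 + κ * k * A)
      have hB2 := adm_Sp P (κ ^ (n+1) * (k * c))
      have h1 := Gr_mono P.hN (hw.sub.adm P) (hB1.add hB2) (fun y hy => ?_) hx
      · rw [Gr_add P.hN hB1 hB2 hx, Gr_cpow P.hN _ hb0 hb2 hx, hAe, ← hL,
          mul_div_cancel_right₀ _ hL0.ne'] at h1
        have e2 : Gr (fun y => κ ^ (n+1) * (k * c) * ‖y‖ ^ (-a - 2)) x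
            = κ ^ (n+1) * (c * ‖x‖ ^ (-a)) := by
          rw [← Gr_S P hx, ← Gr_const_mul]
          apply Gr_congr P.hN
          intro y _; rw [hkd]; ring
        rw [e2] at h1
        rw [← hw.fix x hx]; exact h1
      · have hr := norm_pos_iff.mpr hy
        rcases lt_or_ge ‖y‖ R with hyR | hyR
        · have h3 := hw.sub.pow_le P hy
          have e3 : ‖y‖ ^ (-a - 2) = ‖y‖ ^ (b - a) * ‖y‖ ^ (-b - 2) := by
            rw [← rpow_add hr]; congr 1; ring
          have h4 : w y ^ p ≤ A1 * ‖y‖ ^ (-b - 2) := by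
            refine h3.trans ?_
            rw [e3, hA1]
            have : ‖y‖ ^ (b - a) ≤ R ^ (b - a) := rpow_le_rpow hr.le hyR.le (by linarith)
            calc k * c * (‖y‖ ^ (b - a) * ‖y‖ ^ (-b - 2)) ≤ k * c * (R ^ (b - a) * ‖y‖ ^ (-b - 2)) := by
                  gcongr
              _ = _ := by ring
          refine h4.trans ?_
          have h5 : 0 ≤ κ * k * A * ‖y‖ ^ (-b - 2) := by positivity
          have h6 : 0 ≤ κ ^ (n+1) * (k * c) * ‖y‖ ^ (-a - 2) := by positivity
          linarith
        · have h3 := SubS.pow_split P hθ hy (hw.sub.2 y hy).1 (h y hyR)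
          rw [← hkd, ← hκ] at h3
          refine h3.trans ?_
          have e3 : ‖y‖ ^ (-a - 2) = ‖y‖ ^ (-2:ℝ) * ‖y‖ ^ (-a) := by
            rw [← rpow_add hr]; congr 1; ring
          have e4 : ‖y‖ ^ (-b - 2) = ‖y‖ ^ (-2:ℝ) * ‖y‖ ^ (-b) := by
            rw [← rpow_add hr]; congr 1; ring
          calc κ * k * ‖y‖ ^ (-2:ℝ) * w y
              ≤ κ * k * ‖y‖ ^ (-2:ℝ) * (A * ‖y‖ ^ (-b) + κ ^ n * (c * ‖y‖ ^ (-a))) := by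
                gcongr; exact ih y hy
            _ = κ * k * A * ‖y‖ ^ (-b - 2) + κ ^ (n+1) * (k * c) * ‖y‖ ^ (-a - 2) := by
                rw [e3, e4]; ring
            _ ≤ _ := by
                have : 0 ≤ A1 * ‖y‖ ^ (-b - 2) := by positivity
                linarith
  refine ⟨A, hA0, fun x hx => ?_⟩
  have hl : Tendsto (fun n : ℕ => A * ‖x‖ ^ (-b) + κ ^ n * (c * ‖x‖ ^ (-a))) atTop
      (nhds (A * ‖x‖ ^ (-b) + 0 * (c * ‖x‖ ^ (-a)))) :=
    ((tendsto_pow_atTop_nhds_zero_of_lt_one hκ0.le hκ1).mul_const _).const_add _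
  rw [zero_mul, add_zero] at hl
  exact ge_of_tendsto' hl fun n => key n x hx

lemma small_of_decay (P : Par N p a c t m) {w : Sp N → ℝ} {b A : ℝ} (hb : a < b) (hA : 0 < A)
    (h : ∀ x : Sp N, x ≠ 0 → w x ≤ A * ‖x‖ ^ (-b)) {θ : ℝ} (hθ : 0 < θ) :
    ∃ R, 0 < R ∧ ∀ x : Sp N, R ≤ ‖x‖ → w x ≤ θ * (c * ‖x‖ ^ (-a)) := by
  have hc := P.hc
  have hd : 0 < b - a := by linarith
  refine ⟨(A / (θ * c)) ^ (1 / (b - a)), by positivity, fun x hx => ?_⟩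
  have hr : 0 < ‖x‖ := lt_of_lt_of_le (by positivity) hx
  refine (h x (norm_pos_iff.mp hr)).trans ?_
  have h1 : A / (θ * c) ≤ ‖x‖ ^ (b - a) := by
    calc A / (θ * c) = ((A / (θ * c)) ^ (1 / (b - a))) ^ (b - a) := by
          rw [← rpow_mul (by positivity), one_div, inv_mul_cancel₀ hd.ne', rpow_one]
      _ ≤ _ := rpow_le_rpow (by positivity) hx hd.le
  rw [div_le_iff₀ (by positivity)] at h1
  have e : ‖x‖ ^ (-a) = ‖x‖ ^ (b - a) * ‖x‖ ^ (-b) := by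
    rw [← rpow_add hr]; congr 1; ring
  rw [e]
  calc A * ‖x‖ ^ (-b) ≤ ‖x‖ ^ (b - a) * (θ * c) * ‖x‖ ^ (-b) := by gcongr
    _ = _ := by ring

lemma step1b (P : Par N p a c t m) : ∃ w : Sp N → ℝ, IsW N p a c t w ∧
    ∃ C, 0 < C ∧ ∀ x : Sp N, 1 ≤ ‖x‖ → w x ≤ C * ‖x‖ ^ (2 - (N:ℝ)) := by
  obtain ⟨w, hw, ρ, θ, hρ, hθ, hθ1, h⟩ := step1a P
  have hk := P.k0
  have hp := P.hp
  have haN := P.haN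
  refine ⟨w, hw, ?_⟩
  -- first b
  have hκ1 : θ ^ (p - 1) < 1 := rpow_lt_one hθ.le hθ1 (by linarith [P.hp])
  obtain ⟨b, hb1, hb2, hb3⟩ : ∃ b, a < b ∧ b < (N:ℝ) - 2 ∧
      θ ^ (p - 1) * (a * ((N:ℝ) - 2 - a)) < b * ((N:ℝ) - 2 - b) := by
    have hcont : ContinuousAt (fun b : ℝ => b * ((N:ℝ) - 2 - b)) a := by fun_prop
    have hev : ∀ᶠ b in nhds a, θ ^ (p - 1) * (a * ((N:ℝ) - 2 - a)) < b * ((N:ℝ) - 2 - b) :=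
      hcont.eventually (lt_mem_nhds (by nlinarith))
    have hev2 : ∀ᶠ b in nhds a, b < (N:ℝ) - 2 := gt_mem_nhds haN
    have h3 := (hev.and hev2).filter_mono (nhdsWithin_le_nhds (s := Ioi a))
    obtain ⟨b, ⟨h4, h5⟩, h6⟩ := (h3.and self_mem_nhdsWithin).exists
    exact ⟨b, h6, h5, h4⟩
  obtain ⟨A, hA, hA2⟩ := decay_aux P hw hρ hθ hθ1 h hb1 hb2 hb3
  -- second b
  obtain ⟨b', hb1', hb2'⟩ : ∃ b', max a (N / p) < b' ∧ b' < (N:ℝ) - 2 := by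
    apply exists_between
    rw [max_lt_iff, div_lt_iff₀ P.p0]
    exact ⟨haN, by linarith [P.kap]⟩
  rw [max_lt_iff, div_lt_iff₀ P.p0] at hb1'
  obtain ⟨hba, hbN⟩ := hb1'
  have hb0' : 0 < b' := P.ha.trans hba
  have hL0 : 0 < b' * ((N:ℝ) - 2 - b') := mul_pos hb0' (by linarith)
  obtain ⟨θ', hθ0', hθ1', hθ2'⟩ : ∃ θ', 0 < θ' ∧ θ' < 1 ∧
      θ' ^ (p - 1) * (a * ((N:ℝ) - 2 - a)) < b' * ((N:ℝ) - 2 - b') := by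
    have h1 : Tendsto (fun θ : ℝ => θ ^ (p - 1) * (a * ((N:ℝ) - 2 - a))) (nhds 0)
        (nhds (0 ^ (p-1) * (a * ((N:ℝ) - 2 - a)))) :=
      ((continuousAt_rpow_const 0 (p-1) (Or.inr (by linarith))).mul_const _)
    rw [zero_rpow (by linarith), zero_mul] at h1
    have h2 := (h1.eventually (gt_mem_nhds hL0)).and (gt_mem_nhds (show (0:ℝ) < 1 by norm_num))
    have h3 := h2.filter_mono (nhdsWithin_le_nhds (s := Ioi (0:ℝ)))
    obtain ⟨b, ⟨h4, h5⟩, h6⟩ := (h3.and self_mem_nhdsWithin).exists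
    exact ⟨b, h6, h5, h4⟩
  obtain ⟨R, hR, hR2⟩ := small_of_decay P hb1 hA hA2 hθ0'
  obtain ⟨A', hA', hA2'⟩ := decay_aux P hw hR hθ0' hθ1' hR2 hba hb2' hθ2'
  set η := b' * p - N with hη
  have hη0 : 0 < η := by linarith
  have hc := P.hc
  obtain ⟨C, hC, hC2⟩ := Gr_mf_decay (N := N) P.hN P.ha haN hη0
  set K := max (a * ((N:ℝ) - 2 - a) * c) (A' ^ p) with hK
  have hK0 : 0 < K := lt_max_of_lt_left (by positivity)
  refine ⟨K * C, by positivity, fun x hx => ?_⟩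
  have hx0 : x ≠ 0 := norm_pos_iff.mp (by linarith)
  rw [← hw.fix x hx0]
  have h1 := Gr_mono P.hN (hw.sub.adm P) ((mf_adm (N := N) (η := η) P.ha haN).const_mul K) (fun y hy => ?_) hx0
  · rw [Gr_const_mul] at h1
    refine h1.trans ?_
    rw [mul_assoc]
    exact mul_le_mul_of_nonneg_left (hC2 x hx) hK0.le
  · unfold mf
    rw [mul_min_of_nonneg _ _ hK0.le]
    have hr := norm_pos_iff.mpr hy
    apply le_min
    · refine (hw.sub.pow_le P hy).trans ?_
      gcongr; exact le_max_left _ _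
    · calc w y ^ p ≤ (A' * ‖y‖ ^ (-b')) ^ p := rpow_le_rpow (hw.sub.2 y hy).1 (hA2' y hy) P.p0.le
        _ = A' ^ p * ‖y‖ ^ (-(N:ℝ) - η) := by
          rw [mul_rpow hA'.le (by positivity), ← rpow_mul hr.le]
          congr 2; rw [hη]; ring
        _ ≤ _ := by gcongr; exact le_max_right _ _

lemma IsW.scl (P : Par N p a c t m) {w : Sp N → ℝ} (hw : IsW N p a c t w) {l : ℝ} (hl : 0 < l) :
    IsW N p a c t (scl a l w) := by
  refine ⟨hw.sub.scl hl, fun x hx => ?_, fun l' hl' x hx => ?_, fun x hx => ?_, ?_⟩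
  · rw [TT_scl P hw.sub hl]
    unfold _root_.scl
    rw [hw.fix _ (smul_ne hl hx)]
  · have h1 := hw.pp l' hl' (l • x) (smul_ne hl hx)
    unfold _root_.scl
    rw [smul_comm l l' x]
    have : 0 < l ^ a := by positivity
    nlinarith
  · exact mul_pos (by positivity) (hw.pos _ (smul_ne hl hx))
  · obtain ⟨A, hA, h⟩ := hw.low
    refine ⟨A * l ^ t, by positivity, fun x hx => ?_⟩
    have h1 := h _ (smul_ne hl hx)
    have hx0 := norm_pos_iff.mpr hx
    rw [norm_smul_pos' hl, mul_rpow hl.le hx0.le, mul_rpow hl.le hx0.le] at h1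
    unfold _root_.scl
    calc _ = l ^ a * (c * (l ^ (-a) * ‖x‖ ^ (-a)) - A * (l ^ (-(a - t)) * ‖x‖ ^ (-(a - t)))) := by
          have e1 : l ^ a * l ^ (-a) = 1 := by rw [← rpow_add hl]; simp
          have e2 : l ^ a * l ^ (-(a - t)) = l ^ t := by rw [← rpow_add hl]; congr 1; ring
          linear_combination -(c * ‖x‖ ^ (-a)) * e1 + (A * ‖x‖ ^ (-(a - t))) * e2
      _ ≤ _ := by gcongr

lemma step1 (P : Par N p a c t m) {ε : ℝ} (hε : 0 < ε) : ∃ w : Sp N → ℝ, IsW N p a c t w ∧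
    ∀ x : Sp N, 1 ≤ ‖x‖ → w x ≤ ε * ‖x‖ ^ (2 - (N:ℝ)) := by
  obtain ⟨w, hw, C, hC, h⟩ := step1b P
  have hmu := P.mu
  set l := max 1 ((C / ε) ^ (1 / ((N:ℝ) - 2 - a))) with hl
  have hl1 : 1 ≤ l := le_max_left _ _
  have hl0 : 0 < l := by linarith
  refine ⟨scl a l w, hw.scl P hl0, fun x hx => ?_⟩
  have h1 := h (l • x) (by rw [norm_smul_pos' hl0]; nlinarith)
  rw [norm_smul_pos' hl0, mul_rpow hl0.le (norm_nonneg _)] at h1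
  have h2 : C / ε ≤ l ^ ((N:ℝ) - 2 - a) := by
    calc C / ε = ((C / ε) ^ (1 / ((N:ℝ) - 2 - a))) ^ ((N:ℝ) - 2 - a) := by
          rw [← rpow_mul (by positivity), one_div, inv_mul_cancel₀ hmu.ne', rpow_one]
      _ ≤ _ := rpow_le_rpow (by positivity) (le_max_right _ _) hmu.le
  rw [div_le_iff₀ hε] at h2
  unfold scl
  calc l ^ a * w (l • x) ≤ l ^ a * (C * (l ^ (2 - (N:ℝ)) * ‖x‖ ^ (2 - (N:ℝ)))) := by gcongr
    _ ≤ l ^ a * ((l ^ ((N:ℝ) - 2 - a) * ε) * (l ^ (2 - (N:ℝ)) * ‖x‖ ^ (2 - (N:ℝ)))) := by gcongr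
    _ = (l ^ a * l ^ ((N:ℝ) - 2 - a) * l ^ (2 - (N:ℝ))) * (ε * ‖x‖ ^ (2 - (N:ℝ))) := by ring
    _ = _ := by
      rw [← rpow_add hl0, ← rpow_add hl0]
      have : a + ((N:ℝ) - 2 - a) + (2 - (N:ℝ)) = 0 := by ring
      rw [this, rpow_zero, one_mul]

end

section
variable {N : ℕ} {p a c t m : ℝ}

lemma step2 (P : Par N p a c t m) {τ η β' : ℝ} (hτ : t < τ) (hτm : τ ≤ m) (hβ' : 0 < β') (hη : 0 < η)
    (hηe : η + β' = ((N:ℝ) - 2) * p - N) :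
    ∃ (w : Sp N → ℝ) (θ C' C : ℝ), IsW N p a c t w ∧ 0 < θ ∧ θ < 1 ∧ 0 < C' ∧ 0 < C ∧
      (∀ x : Sp N, 1 ≤ ‖x‖ → w x ≤ C * ‖x‖ ^ (2 - (N:ℝ))) ∧
      (∀ x : Sp N, x ≠ 0 → Gr (mf (a - τ) η) x ≤ C' * w x) ∧
      (∀ x : Sp N, x ≠ 0 → p * w x ^ (p - 1) * Gr (mf (a - τ) η) x ≤ θ * mf (a - τ) η x) ∧
      (∀ x : Sp N, x ≠ 0 → (if ‖x‖ ≤ 1 then ‖x‖ ^ τ else ‖x‖ ^ β') * w x ^ (p - 1) * Gr (mf (a - τ) η) x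
        ≤ C * mf (a - τ) η x) ∧
      (∀ x : Sp N, x ≠ 0 → (if ‖x‖ ≤ 1 then ‖x‖ ^ τ else ‖x‖ ^ β') * w x ^ p ≤ C * mf (a - τ) η x) := by
  have ht0 := P.ht0
  have hc := P.hc
  have hk := P.k0
  have hp := P.hp
  have hp0 := P.p0
  have hb0 := P.b_pos hτm
  have hb1 := P.b_lt (by linarith : 0 ≤ τ)
  have hlb := P.lb_gt hτ hτm
  set b := a - τ with hb
  have hba : b < a := by linarith
  set L := b * ((N:ℝ) - 2 - b) with hL
  have hpk : p * (a * ((N:ℝ) - 2 - a)) = (a + 2) * ((N:ℝ) - 2 - a) := by rw [← P.hap]; ring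
  rw [← hpk] at hlb
  set k := a * ((N:ℝ) - 2 - a) with hkd
  have hL0 : 0 < L := by nlinarith
  set θ := p * k / L with hθ
  have hθ0 : 0 < θ := by positivity
  have hθ1 : θ < 1 := by rw [hθ, div_lt_one hL0]; exact hlb
  obtain ⟨C1, hC1, hψd⟩ := Gr_mf_decay (N := N) P.hN hb0 hb1 hη
  have hψu : ∀ x : Sp N, x ≠ 0 → Gr (mf b η) x ≤ ‖x‖ ^ (-b) / L := fun x hx => Gr_mf_le P.hN hb0 hb1 hx
  have hψ0 : ∀ x : Sp N, 0 ≤ Gr (mf b η) x := fun x => Gr_nonneg P.hN (fun y _ => mf_nonneg y) x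
  set ψ := Gr (mf (N := N) b η) with hψ
  set ε := (θ / (p * C1)) ^ (1 / (p - 1)) with hε
  have hε0 : 0 < ε := by positivity
  have hεp : ε ^ (p - 1) = θ / (p * C1) := by
    rw [hε, ← rpow_mul (by positivity), one_div, inv_mul_cancel₀ (by linarith), rpow_one]
  obtain ⟨w, hw, hwε⟩ := step1 P hε0
  -- constants
  obtain ⟨c2, hc2, hlow⟩ := Gr_lower P.hN (hw.sub.adm P) (fun y hy => rpow_pos_of_pos (hw.pos y hy) p)
  have hlow' : ∀ x : Sp N, 1 ≤ ‖x‖ → c2 * ‖x‖ ^ (2 - (N:ℝ)) ≤ w x := fun x hx => by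
    rw [← hw.fix x (norm_pos_iff.mp (by linarith))]; exact hlow x hx
  -- basic powers
  have w_in : ∀ x : Sp N, x ≠ 0 → w x ^ (p - 1) * ψ x ≤ (k / L) * ‖x‖ ^ (-b - 2) := by
    intro x hx
    have hr := norm_pos_iff.mpr hx
    calc w x ^ (p - 1) * ψ x ≤ (c * ‖x‖ ^ (-a)) ^ (p - 1) * (‖x‖ ^ (-b) / L) := by
          gcongr
          · exact hψ0 x
          · exact (hw.sub.2 x hx).1
          · exact (hw.sub.2 x hx).2
          · exact hψu x hx
      _ = _ := by
          rw [P.Sp1_eq hr, ← hkd]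
          have : ‖x‖ ^ (-b - 2) = ‖x‖ ^ (-2:ℝ) * ‖x‖ ^ (-b) := by
            rw [← rpow_add hr]; congr 1; ring
          rw [this]; ring
  have w_out : ∀ x : Sp N, 1 ≤ ‖x‖ → w x ^ (p - 1) * ψ x ≤ (θ / p) * ‖x‖ ^ (-((N:ℝ) - 2) * p) := by
    intro x hx1
    have hr : 0 < ‖x‖ := by linarith
    have hx := norm_pos_iff.mp hr
    calc w x ^ (p - 1) * ψ x ≤ (ε * ‖x‖ ^ (2 - (N:ℝ))) ^ (p - 1) * (C1 * ‖x‖ ^ (2 - (N:ℝ))) := by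
          gcongr
          · exact hψ0 x
          · exact (hw.sub.2 x hx).1
          · exact hwε x hx1
          · exact hψd x hx1
      _ = _ := by
          rw [mul_rpow hε0.le (by positivity), hεp, ← rpow_mul hr.le]
          have : ‖x‖ ^ (-((N:ℝ) - 2) * p) = ‖x‖ ^ ((2 - (N:ℝ)) * (p - 1)) * ‖x‖ ^ (2 - (N:ℝ)) := by
            rw [← rpow_add hr]; congr 1; ring
          rw [this]; field_simp
  have out_e : ∀ x : Sp N, 1 ≤ ‖x‖ → ‖x‖ ^ β' * ‖x‖ ^ (-((N:ℝ) - 2) * p) = ‖x‖ ^ (-(N:ℝ) - η) := by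
    intro x hx1
    rw [← rpow_add (by linarith)]; congr 1; linarith
  obtain ⟨C', hC', hψw⟩ : ∃ C', 0 < C' ∧ ∀ x : Sp N, x ≠ 0 → ψ x ≤ C' * w x := by
    refine ⟨max (C1 / c2) (1 / (L * c2)), lt_max_of_lt_left (by positivity), fun x hx => ?_⟩
    have hr := norm_pos_iff.mpr hx
    rcases le_total 1 ‖x‖ with h1 | h1
    · calc ψ x ≤ C1 * ‖x‖ ^ (2 - (N:ℝ)) := hψd x h1
        _ = C1 / c2 * (c2 * ‖x‖ ^ (2 - (N:ℝ))) := by field_simp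
        _ ≤ max (C1 / c2) (1 / (L * c2)) * w x := by
          gcongr
          · exact le_max_left _ _
          · exact hlow' x h1
    · set l := ‖x‖⁻¹ with hl
      have hl1 : 1 ≤ l := (one_le_inv₀ hr).mpr h1
      have hl0 : 0 < l := by linarith
      have hn : ‖l • x‖ = 1 := by rw [norm_smul_pos' hl0, hl]; field_simp
      have h2 := hw.pp l hl1 x hx
      have h3 := hlow' (l • x) hn.ge
      rw [hn, one_rpow, mul_one] at h3
      have h4 : ‖x‖ ^ (-a) * c2 ≤ w x := by
        have : l ^ a = ‖x‖ ^ (-a) := by rw [hl, inv_rpow hr.le, rpow_neg hr.le]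
        rw [← this]
        exact le_trans (by gcongr) h2
      calc ψ x ≤ ‖x‖ ^ (-b) / L := hψu x hx
        _ ≤ ‖x‖ ^ (-a) / L := by
          gcongr ?_ / L
          exact rpow_le_rpow_of_exponent_ge hr h1 (by linarith)
        _ = 1 / (L * c2) * (‖x‖ ^ (-a) * c2) := by field_simp
        _ ≤ _ := by
          gcongr
          exact le_max_right _ _
  set C := max (max ε (k / L)) (max (max (θ / p) (k * c)) (ε ^ p)) with hC
  have hCε : ε ≤ C := (le_max_left _ _).trans (le_max_left _ _)
  have hCk : k / L ≤ C := (le_max_right _ _).trans (le_max_left _ _)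
  have hCθ : θ / p ≤ C := (le_max_left _ _).trans ((le_max_left _ _).trans (le_max_right _ _))
  have hCc : k * c ≤ C := (le_max_right _ _).trans ((le_max_left _ _).trans (le_max_right _ _))
  have hCp : ε ^ p ≤ C := (le_max_right _ _).trans (le_max_right _ _)
  have hC0 : 0 < C := hε0.trans_le hCε
  refine ⟨w, θ, C', C, hw, hθ0, hθ1, hC', hC0, ?_, hψw, ?_, ?_, ?_⟩
  · intro x hx
    exact (hwε x hx).trans (by gcongr)
  · intro x hx
    rcases le_total ‖x‖ 1 with h1 | h1
    · rw [mf_in hb1 hη hx h1]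
      calc p * w x ^ (p - 1) * ψ x = p * (w x ^ (p - 1) * ψ x) := by ring
        _ ≤ p * ((k / L) * ‖x‖ ^ (-b - 2)) := mul_le_mul_of_nonneg_left (w_in x hx) hp0.le
        _ = _ := by rw [hθ]; ring
    · rw [mf_out hb1 hη h1]
      calc p * w x ^ (p - 1) * ψ x = p * (w x ^ (p - 1) * ψ x) := by ring
        _ ≤ p * ((θ / p) * ‖x‖ ^ (-((N:ℝ) - 2) * p)) := mul_le_mul_of_nonneg_left (w_out x h1) hp0.le
        _ = θ * ‖x‖ ^ (-((N:ℝ) - 2) * p) := by field_simp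
        _ ≤ _ := by
          gcongr ?_ * ?_
          exact rpow_le_rpow_of_exponent_le h1 (by linarith)
  · intro x hx
    have hr := norm_pos_iff.mpr hx
    split_ifs with h1
    · rw [mf_in hb1 hη hx h1]
      have h2 : ‖x‖ ^ τ ≤ 1 := rpow_le_one hr.le h1 (by linarith)
      have h3 := w_in x hx
      have h4 : 0 ≤ w x ^ (p - 1) * ψ x := mul_nonneg (rpow_nonneg (hw.sub.2 x hx).1 _) (hψ0 x)
      calc ‖x‖ ^ τ * w x ^ (p - 1) * ψ x = ‖x‖ ^ τ * (w x ^ (p - 1) * ψ x) := by ring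
        _ ≤ 1 * (w x ^ (p - 1) * ψ x) := by gcongr
        _ ≤ (k / L) * ‖x‖ ^ (-b - 2) := by rw [one_mul]; exact h3
        _ ≤ _ := by gcongr
    · push Not at h1
      rw [mf_out hb1 hη h1.le, ← out_e x h1.le]
      calc ‖x‖ ^ β' * w x ^ (p - 1) * ψ x = ‖x‖ ^ β' * (w x ^ (p - 1) * ψ x) := by ring
        _ ≤ ‖x‖ ^ β' * ((θ / p) * ‖x‖ ^ (-((N:ℝ) - 2) * p)) := mul_le_mul_of_nonneg_left (w_out x h1.le) (by positivity)
        _ = (θ / p) * (‖x‖ ^ β' * ‖x‖ ^ (-((N:ℝ) - 2) * p)) := by ring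
        _ ≤ _ := by gcongr
  · intro x hx
    have hr := norm_pos_iff.mpr hx
    split_ifs with h1
    · rw [mf_in hb1 hη hx h1]
      calc ‖x‖ ^ τ * w x ^ p ≤ ‖x‖ ^ τ * (k * c * ‖x‖ ^ (-a - 2)) := by
            gcongr; exact hw.sub.pow_le P hx
        _ = k * c * ‖x‖ ^ (-b - 2) := by
            have : ‖x‖ ^ (-b - 2) = ‖x‖ ^ τ * ‖x‖ ^ (-a - 2) := by
              rw [← rpow_add hr]; congr 1; rw [hb]; ring
            rw [this]; ring
        _ ≤ _ := by gcongr
    · push Not at h1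
      rw [mf_out hb1 hη h1.le, ← out_e x h1.le]
      calc ‖x‖ ^ β' * w x ^ p ≤ ‖x‖ ^ β' * (ε * ‖x‖ ^ (2 - (N:ℝ))) ^ p := by
            gcongr
            · exact (hw.sub.2 x hx).1
            · exact hwε x h1.le
        _ = ε ^ p * (‖x‖ ^ β' * ‖x‖ ^ (-((N:ℝ) - 2) * p)) := by
            rw [mul_rpow hε0.le (by positivity), ← rpow_mul hr.le]
            have : (2 - (N:ℝ)) * p = -((N:ℝ) - 2) * p := by ring
            rw [this]; ring
        _ ≤ _ := by gcongr

lemma V_est {V : Sp N → ℝ} {c₀ τ₀ cinf β : ℝ} (hV : V0cond N V c₀ τ₀ cinf β) {τ β' : ℝ} (hτ : 0 < τ)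
    (hττ : τ ≤ τ₀) (hβ' : 0 < β') (hβ : β ≤ β') : ∃ C δ : ℝ, 0 < C ∧ 0 < δ ∧ ∀ l : ℝ, 1 ≤ l → ∀ x : Sp N,
      x ≠ 0 → |V x - 1| ≤ C * l ^ (-δ) * (if ‖l • x‖ ≤ 1 then ‖l • x‖ ^ τ else ‖l • x‖ ^ β') := by
  obtain ⟨_, hc0, hτ0, h1, hci, h2⟩ := hV
  set δ := min τ β' with hδ
  have hδ0 : 0 < δ := lt_min hτ hβ'
  set C := c₀ + (1 + cinf * 2 ^ β') with hC
  have hC0 : 0 < C := by positivity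
  refine ⟨C, δ, hC0, hδ0, fun l hl x hx => ?_⟩
  have hl0 : 0 < l := by linarith
  have hr := norm_pos_iff.mpr hx
  have hC1 : c₀ ≤ C := by rw [hC]; have : 0 < 1 + cinf * 2 ^ β' := by positivity
                          linarith
  have hC2 : 1 + cinf * 2 ^ β' ≤ C := by linarith
  rw [norm_smul_pos' hl0]
  rcases le_total ‖x‖ 1 with hx1 | hx1
  · have h3 := h1 x hx hx1
    split_ifs with h4
    · refine h3.trans ?_
      calc c₀ * ‖x‖ ^ τ₀ ≤ c₀ * ‖x‖ ^ τ := by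
            gcongr c₀ * ?_
            exact rpow_le_rpow_of_exponent_ge hr hx1 hττ
        _ = c₀ * l ^ (-τ) * (l * ‖x‖) ^ τ := by
            rw [mul_rpow hl0.le hr.le]
            have : l ^ (-τ) * l ^ τ = 1 := by rw [← rpow_add hl0]; simp
            linear_combination -(c₀ * ‖x‖ ^ τ) * this
        _ ≤ C * l ^ (-δ) * (l * ‖x‖) ^ τ := by
            gcongr
            exact min_le_left _ _
    · push Not at h4
      refine h3.trans ?_
      calc c₀ * ‖x‖ ^ τ₀ ≤ c₀ * ‖x‖ ^ δ := by
            gcongr c₀ * ?_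
            exact rpow_le_rpow_of_exponent_ge hr hx1 ((min_le_left _ _).trans hττ)
        _ = c₀ * l ^ (-δ) * (l * ‖x‖) ^ δ := by
            rw [mul_rpow hl0.le hr.le]
            have : l ^ (-δ) * l ^ δ = 1 := by rw [← rpow_add hl0]; simp
            linear_combination -(c₀ * ‖x‖ ^ δ) * this
        _ ≤ C * l ^ (-δ) * (l * ‖x‖) ^ β' := by
            gcongr
            · exact h4.le
            · exact min_le_right _ _
  · have hlx : 1 ≤ l * ‖x‖ := by nlinarith
    have e : (if l * ‖x‖ ≤ 1 then (l * ‖x‖) ^ τ else (l * ‖x‖) ^ β') = (l * ‖x‖) ^ β' := by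
      split_ifs with h
      · have : l * ‖x‖ = 1 := le_antisymm h hlx
        rw [this, one_rpow, one_rpow]
      · rfl
    rw [e]
    obtain ⟨h3, h4⟩ := h2 x hx
    have h5 : |V x - 1| ≤ 1 + V x := by rw [abs_le]; constructor <;> linarith
    have h6 : (1 + ‖x‖) ^ β ≤ 2 ^ β' * ‖x‖ ^ β' := by
      calc (1 + ‖x‖) ^ β ≤ (1 + ‖x‖) ^ β' := rpow_le_rpow_of_exponent_le (by linarith) hβ
        _ ≤ (2 * ‖x‖) ^ β' := by
          apply rpow_le_rpow (by positivity) (by linarith) hβ'.le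
        _ = _ := mul_rpow (by norm_num) hr.le
    have h7 : 1 ≤ ‖x‖ ^ β' := one_le_rpow hx1 hβ'.le
    calc |V x - 1| ≤ 1 + V x := h5
      _ ≤ ‖x‖ ^ β' + cinf * (2 ^ β' * ‖x‖ ^ β') := by
        have : cinf * (1 + ‖x‖) ^ β ≤ cinf * (2 ^ β' * ‖x‖ ^ β') := by gcongr
        linarith
      _ = (1 + cinf * 2 ^ β') * l ^ (-β') * (l * ‖x‖) ^ β' := by
        rw [mul_rpow hl0.le hr.le]
        have : l ^ (-β') * l ^ β' = 1 := by rw [← rpow_add hl0]; simp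
        linear_combination -((1 + cinf * 2 ^ β') * ‖x‖ ^ β') * this
      _ ≤ _ := by
        gcongr
        exact min_le_right _ _
end

section
variable {N : ℕ} {p a c t m : ℝ}

structure Setup (N : ℕ) (p a c t m : ℝ) (V w : Sp N → ℝ) (τ η l0 θ r C' C K : ℝ) : Prop where
  P : Par N p a c t m
  hw : IsW N p a c t w
  hτ0 : 0 < τ
  hτm : τ ≤ m
  hη : 0 < η
  hl0 : 1 ≤ l0
  hθ0 : 0 < θ
  hθ1 : θ < 1
  hr : 0 < r
  hC' : 0 < C'
  hC : 0 < C
  hrC : r * C' ≤ 1 / 2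
  hK0 : 0 ≤ K
  ψw : ∀ x : Sp N, x ≠ 0 → Gr (mf (a - τ) η) x ≤ C' * w x
  dec : ∀ x : Sp N, 1 ≤ ‖x‖ → w x ≤ C * ‖x‖ ^ (2 - (N:ℝ))
  hK : ∀ l, l0 ≤ l → ∀ x : Sp N, x ≠ 0 → V x * (p * ((1 + r * C') * scl a l w x) ^ (p - 1)) *
    scl a l (Gr (mf (a - τ) η)) x ≤ θ * scl (a + 2) l (mf (a - τ) η) x
  hE : ∀ l, l0 ≤ l → ∀ x : Sp N, x ≠ 0 → |V x - 1| * scl a l w x ^ p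
    ≤ (1 - θ) * r * scl (a + 2) l (mf (a - τ) η) x
  dom : ∀ x : Sp N, x ≠ 0 → V x * (2 * scl a l0 w x) ^ p ≤ K * mf a η x
  hV0 : ∀ x : Sp N, x ≠ 0 → 0 ≤ V x
  hVm : AEStronglyMeasurable V volume

lemma V_cont {V : Sp N → ℝ} (hV : LocHolderOn V {0}ᶜ) {x : Sp N} (hx : x ≠ 0) :
    ContinuousAt V x := by
  obtain ⟨C, α, r, hr, hα, _, h⟩ := hV x hx
  have h1 : ContinuousOn V (ball x r ∩ {0}ᶜ) := h.continuousOn hα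
  apply h1.continuousAt
  exact inter_mem (ball_mem_nhds x hr) (isOpen_compl_singleton.mem_nhds hx)

set_option maxHeartbeats 1000000 in
lemma setup_exists (P : Par N p a c t m) {V : Sp N → ℝ} {c₀ τ₀ cinf β : ℝ}
    (hV : V0cond N V c₀ τ₀ cinf β) (hτ₀ : t < τ₀) (hβ : β < ((N:ℝ) - 2) * p - N) :
    ∃ (w : Sp N → ℝ) (τ η l0 θ r C' C K : ℝ), Setup N p a c t m V w τ η l0 θ r C' C K := by
  have ht0 := P.ht0
  have hc := P.hc
  have hk := P.k0
  have hp := P.hp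
  have hp0 := P.p0
  obtain ⟨β', hβ1, hβ2⟩ : ∃ β', max β 0 < β' ∧ β' < ((N:ℝ) - 2) * p - N :=
    exists_between (max_lt hβ P.kap)
  rw [max_lt_iff] at hβ1
  obtain ⟨hββ, hβ0⟩ := hβ1
  set η := ((N:ℝ) - 2) * p - N - β' with hηd
  have hη : 0 < η := by linarith
  set τ := min τ₀ m with hτd
  have htτ : t < τ := lt_min hτ₀ P.htm
  have hτm : τ ≤ m := min_le_right _ _
  have hτ0 : 0 < τ := by linarith
  have hb0 := P.b_pos hτm
  have hb1 := P.b_lt hτ0.le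
  obtain ⟨w, θ, C', C, hw, hθ0, hθ1, hC', hC, hdec, hψw, hK, hhK, hhE⟩ :=
    step2 P htτ hτm hβ0 hη (by rw [hηd]; ring)
  obtain ⟨C2, δ, hC2, hδ, hVe⟩ := V_est hV hτ0 (min_le_left _ _) hβ0 hββ.le
  have hVn : ∀ x : Sp N, x ≠ 0 → 0 ≤ V x := fun x hx => (hV.2.2.2.2.2 x hx).1
  have hVm : AEStronglyMeasurable V volume := aesm_of_contAt P.hN fun x hx => V_cont hV.1 hx
  have hψ0 : ∀ x : Sp N, 0 ≤ Gr (mf (a - τ) η) x := fun x => Gr_nonneg P.hN (fun y _ => mf_nonneg y) x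
  set ψ := Gr (mf (N := N) (a - τ) η) with hψ
  set θ' := (1 + θ) / 2 with hθ'
  have hθ'1 : θ' < 1 := by linarith
  have hθθ' : θ < θ' := by linarith
  -- choose r
  obtain ⟨r, hr, hrC, hrθ⟩ : ∃ r, 0 < r ∧ r * C' ≤ 1 / 2 ∧ (1 + r * C') ^ (p - 1) * θ < θ' := by
    have h1 : Tendsto (fun r : ℝ => (1 + r * C') ^ (p - 1) * θ) (nhds 0)
        (nhds ((1 + 0 * C') ^ (p - 1) * θ)) := by
      refine (ContinuousAt.rpow_const (by fun_prop) (Or.inr (by linarith))).mul_const _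
    rw [zero_mul, add_zero, one_rpow, one_mul] at h1
    have h2 := h1.eventually (gt_mem_nhds hθθ')
    have h3 : ∀ᶠ r in nhds (0:ℝ), r < 1 / (2 * C') := gt_mem_nhds (by positivity)
    have h4 := (h2.and h3).filter_mono (nhdsWithin_le_nhds (s := Ioi (0:ℝ)))
    obtain ⟨r, ⟨h5, h6⟩, h7⟩ := (h4.and self_mem_nhdsWithin).exists
    refine ⟨r, h7, ?_, h5⟩
    rw [lt_div_iff₀ (by positivity)] at h6
    linarith
  set q := (1 + r * C') ^ (p - 1) with hq
  have hq0 : 0 < q := by positivity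
  -- choose l0
  obtain ⟨l0, hl0, hl0'⟩ : ∃ l0 : ℝ, 1 ≤ l0 ∧ ∀ l, l0 ≤ l →
      q * (θ + p * C2 * C * l ^ (-δ)) ≤ θ' ∧ C2 * C * l ^ (-δ) ≤ (1 - θ') * r := by
    have hz := tendsto_rpow_neg_atTop hδ
    have h1 : Tendsto (fun l : ℝ => q * (θ + p * C2 * C * l ^ (-δ))) atTop (nhds (q * (θ + p * C2 * C * 0))) :=
      ((hz.const_mul _).const_add _).const_mul _
    have h2 : Tendsto (fun l : ℝ => C2 * C * l ^ (-δ)) atTop (nhds (C2 * C * 0)) := hz.const_mul _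
    rw [mul_zero, add_zero] at h1
    rw [mul_zero] at h2
    have h3 := (h1.eventually (ge_mem_nhds hrθ)).and
      (h2.eventually (ge_mem_nhds (mul_pos (by linarith : 0 < 1 - θ') hr)))
    obtain ⟨l1, hl1⟩ := eventually_atTop.mp h3
    exact ⟨max 1 l1, le_max_left _ _, fun l hl => hl1 l ((le_max_right _ _).trans hl)⟩
  -- scaled inequalities
  have hpow : ∀ l, 0 < l → ∀ x : Sp N, x ≠ 0 → scl a l w x ^ (p - 1) * scl a l ψ x
      = l ^ (a + 2) * (w (l • x) ^ (p - 1) * ψ (l • x)) := by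
    intro l hl x hx
    unfold scl
    rw [mul_rpow (by positivity) (hw.pos _ (smul_ne hl hx)).le, ← rpow_mul hl.le, P.apm, rpow_add hl]
    ring
  have hpow2 : ∀ l, 0 < l → ∀ x : Sp N, x ≠ 0 → scl a l w x ^ p = l ^ (a + 2) * w (l • x) ^ p := by
    intro l hl x hx
    unfold scl
    rw [mul_rpow (by positivity) (hw.pos _ (smul_ne hl hx)).le, ← rpow_mul hl.le, P.hap]
  have hEE : ∀ l, l0 ≤ l → ∀ x : Sp N, x ≠ 0 → |V x - 1| * scl a l w x ^ p
      ≤ (1 - θ') * r * scl (a + 2) l (mf (a - τ) η) x := by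
    intro l hl x hx
    have hl1 : 1 ≤ l := hl0.trans hl
    have hlp : 0 < l := by linarith
    have h3 := hVe l hl1 x hx
    have h4 := hhE (l • x) (smul_ne hlp hx)
    have hwp : 0 ≤ w (l • x) ^ p := rpow_nonneg (hw.pos _ (smul_ne hlp hx)).le _
    rw [hpow2 l hlp x hx]
    set h := (if ‖l • x‖ ≤ 1 then ‖l • x‖ ^ τ else ‖l • x‖ ^ β') with hh
    calc |V x - 1| * (l ^ (a + 2) * w (l • x) ^ p)
        ≤ (C2 * l ^ (-δ) * h) * (l ^ (a + 2) * w (l • x) ^ p) := by gcongr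
      _ = C2 * l ^ (-δ) * l ^ (a + 2) * (h * w (l • x) ^ p) := by ring
      _ ≤ C2 * l ^ (-δ) * l ^ (a + 2) * (C * mf (a - τ) η (l • x)) := by gcongr
      _ = (C2 * C * l ^ (-δ)) * (l ^ (a + 2) * mf (a - τ) η (l • x)) := by ring
      _ ≤ ((1 - θ') * r) * (l ^ (a + 2) * mf (a - τ) η (l • x)) := by
        have := mf_nonneg (b := a - τ) (η := η) (l • x)
        exact mul_le_mul_of_nonneg_right (hl0' l hl).2 (by positivity)
  have hl0p : 0 < l0 := by linarith
  set K := 2 ^ p * ((1 - θ') * r * l0 ^ (a + 2) + l0 ^ (a + 2) * (C ^ p + a * ((N:ℝ) - 2 - a) * c)) with hKd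
  have hth : 0 < 1 - θ' := by linarith
  have hK0 : 0 ≤ K := by positivity
  refine ⟨w, τ, η, l0, θ', r, C', C, K, P, hw, hτ0, hτm, hη, hl0, by linarith, hθ'1, hr, hC', hC, hrC,
    hK0, hψw, hdec, ?_, hEE, ?_, hVn, hVm⟩
  · intro l hl x hx
    have hl1 : 1 ≤ l := hl0.trans hl
    have hlp : 0 < l := by linarith
    have h3 := hVe l hl1 x hx
    have h4 := hhK (l • x) (smul_ne hlp hx)
    have h5 := hK (l • x) (smul_ne hlp hx)
    have hVx : V x ≤ 1 + |V x - 1| := by linarith [le_abs_self (V x - 1)]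
    have hws : 0 ≤ scl a l w x := mul_nonneg (by positivity) (hw.pos _ (smul_ne hlp hx)).le
    have hwn : 0 ≤ w (l • x) ^ (p - 1) * ψ (l • x) :=
      mul_nonneg (rpow_nonneg (hw.pos _ (smul_ne hlp hx)).le _) (hψ0 _)
    rw [mul_rpow (by positivity) hws, ← hq]
    set h := (if ‖l • x‖ ≤ 1 then ‖l • x‖ ^ τ else ‖l • x‖ ^ β') with hh
    have hm0 := mf_nonneg (b := a - τ) (η := η) (l • x)
    calc V x * (p * (q * scl a l w x ^ (p - 1))) * scl a l ψ x
        = V x * p * q * (scl a l w x ^ (p - 1) * scl a l ψ x) := by ring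
      _ = V x * (p * q * l ^ (a + 2) * (w (l • x) ^ (p - 1) * ψ (l • x))) := by
        rw [hpow l hlp x hx]; ring
      _ ≤ (1 + C2 * l ^ (-δ) * h) * (p * q * l ^ (a + 2) * (w (l • x) ^ (p - 1) * ψ (l • x))) := by
        apply mul_le_mul_of_nonneg_right (by linarith)
        exact mul_nonneg (by positivity) hwn
      _ = q * l ^ (a + 2) * (p * w (l • x) ^ (p - 1) * ψ (l • x)
          + p * C2 * l ^ (-δ) * (h * w (l • x) ^ (p - 1) * ψ (l • x))) := by ring
      _ ≤ q * l ^ (a + 2) * (θ * mf (a - τ) η (l • x)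
          + p * C2 * l ^ (-δ) * (C * mf (a - τ) η (l • x))) := by
        refine mul_le_mul_of_nonneg_left (add_le_add h5 ?_) (by positivity)
        exact mul_le_mul_of_nonneg_left h4 (by positivity)
      _ = q * (θ + p * C2 * C * l ^ (-δ)) * (l ^ (a + 2) * mf (a - τ) η (l • x)) := by ring
      _ ≤ θ' * (l ^ (a + 2) * mf (a - τ) η (l • x)) := by
        gcongr
        exact (hl0' l hl).1
  · intro x hx
    have hxp := norm_pos_iff.mpr hx
    have h1 := hEE l0 le_rfl x hx
    have hVx : V x ≤ 1 + |V x - 1| := by linarith [le_abs_self (V x - 1)]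
    have hws : 0 ≤ scl a l0 w x := mul_nonneg (by positivity) (hw.pos _ (smul_ne hl0p hx)).le
    have hm1 := mf_nonneg (b := a) (η := η) x
    have hL1 : 1 ≤ l0 ^ (a + 2) := one_le_rpow hl0 (by linarith [P.ha])
    -- (1-θ') r ≤ 1 is not available; absorb
    have hm2 : mf (a - τ) η (l0 • x) ≤ mf a η x := by
      rcases le_total ‖x‖ 1 with h | h
      · rw [mf_in P.haN hη hx h]
        calc mf (a - τ) η (l0 • x) ≤ ‖l0 • x‖ ^ (-(a - τ) - 2) := min_le_left _ _
          _ ≤ ‖x‖ ^ (-(a - τ) - 2) := by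
            apply rpow_antitone_exp hxp _ (by linarith)
            rw [norm_smul_pos' hl0p]; nlinarith
          _ ≤ _ := rpow_le_rpow_of_exponent_ge hxp h (by linarith)
      · rw [mf_out P.haN hη h]
        calc mf (a - τ) η (l0 • x) ≤ ‖l0 • x‖ ^ (-(N:ℝ) - η) := min_le_right _ _
          _ ≤ _ := by
            apply rpow_antitone_exp hxp _
            · have : (0:ℝ) ≤ N := by positivity
              linarith
            · rw [norm_smul_pos' hl0p]; nlinarith
    have hwm : scl a l0 w x ^ p ≤ l0 ^ (a + 2) * (C ^ p + a * ((N:ℝ) - 2 - a) * c) * mf a η x := by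
      rcases le_total ‖x‖ 1 with h | h
      · rw [mf_in P.haN hη hx h]
        refine ((hw.scl P hl0p).sub.pow_le P hx).trans ?_
        gcongr ?_ * ?_
        have h5 : 0 ≤ C ^ p := by positivity
        have h6 : 0 < a * ((N:ℝ) - 2 - a) * c := by positivity
        calc a * ((N:ℝ) - 2 - a) * c ≤ C ^ p + a * ((N:ℝ) - 2 - a) * c := by linarith
          _ ≤ _ := le_mul_of_one_le_left (by positivity) hL1
      · rw [mf_out P.haN hη h]
        have h6 : 1 ≤ ‖l0 • x‖ := by rw [norm_smul_pos' hl0p]; nlinarith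
        have h7 : w (l0 • x) ≤ C * ‖x‖ ^ (2 - (N:ℝ)) := by
          refine (hdec _ h6).trans ?_
          gcongr C * ?_
          apply rpow_antitone_exp hxp
          · rw [norm_smul_pos' hl0p]; nlinarith
          · have : (3:ℝ) ≤ N := by exact_mod_cast P.hN
            linarith
        rw [hpow2 l0 hl0p x hx]
        have h8 : w (l0 • x) ^ p ≤ C ^ p * ‖x‖ ^ (-(N:ℝ) - η) := by
          calc w (l0 • x) ^ p ≤ (C * ‖x‖ ^ (2 - (N:ℝ))) ^ p :=
                rpow_le_rpow (hw.pos _ (smul_ne hl0p hx)).le h7 hp0.le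
            _ = C ^ p * ‖x‖ ^ ((2 - (N:ℝ)) * p) := by
                rw [mul_rpow hC.le (by positivity), ← rpow_mul hxp.le]
            _ ≤ _ := by
                gcongr C ^ p * ?_
                apply rpow_le_rpow_of_exponent_le h
                rw [hηd]; linarith
        have h9 : 0 < a * ((N:ℝ) - 2 - a) * c := by positivity
        calc l0 ^ (a + 2) * w (l0 • x) ^ p ≤ l0 ^ (a + 2) * (C ^ p * ‖x‖ ^ (-(N:ℝ) - η)) := by gcongr
          _ ≤ l0 ^ (a + 2) * ((C ^ p + a * ((N:ℝ) - 2 - a) * c) * ‖x‖ ^ (-(N:ℝ) - η)) := by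
            gcongr; linarith
          _ = _ := by ring
    have hwp : 0 ≤ scl a l0 w x ^ p := rpow_nonneg hws _
    have h1' : |V x - 1| * scl a l0 w x ^ p ≤ (1 - θ') * r * l0 ^ (a + 2) * mf a η x := by
      refine h1.trans ?_
      unfold scl
      rw [mul_assoc ((1 - θ') * r)]
      gcongr
    rw [mul_rpow (by norm_num) hws]
    calc V x * (2 ^ p * scl a l0 w x ^ p) = 2 ^ p * (V x * scl a l0 w x ^ p) := by ring
      _ ≤ 2 ^ p * ((1 + |V x - 1|) * scl a l0 w x ^ p) := by gcongr
      _ = 2 ^ p * (|V x - 1| * scl a l0 w x ^ p + scl a l0 w x ^ p) := by ring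
      _ ≤ 2 ^ p * ((1 - θ') * r * l0 ^ (a + 2) * mf a η x
          + l0 ^ (a + 2) * (C ^ p + a * ((N:ℝ) - 2 - a) * c) * mf a η x) := by gcongr
      _ = K * mf a η x := by rw [hKd]; ring
end

section
variable {N : ℕ} {p a c t m : ℝ}

lemma rpow_sub_le_aux {p x y M : ℝ} (hp : 1 < p) (hy : 0 ≤ y) (hyx : y ≤ x) (hx : x ≤ M) :
    x ^ p - y ^ p ≤ p * M ^ (p - 1) * (x - y) := by
  rcases (hy.trans hyx).eq_or_lt with h | h
  · have : y = 0 := le_antisymm (by linarith) hy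
    rw [← h, this]; simp
  · have h1 := sc_low (p := p) (z := 1 - y / x) hp
    rw [sub_sub_cancel, max_eq_left (by positivity), div_rpow hy h.le] at h1
    have hxp : 0 < x ^ p := by positivity
    have e : x ^ p = x ^ (p - 1) * x := by rw [← rpow_add_one h.ne']; congr 1; ring
    have h2 : x ^ p - p * x ^ (p - 1) * (x - y) ≤ y ^ p := by
      rw [le_div_iff₀ hxp] at h1
      calc _ = (1 - p * (1 - y / x)) * x ^ p := by rw [e]; field_simp
        _ ≤ _ := h1
    have h3 : x ^ (p - 1) ≤ M ^ (p - 1) := rpow_le_rpow h.le hx (by linarith)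
    have h4 : p * x ^ (p - 1) * (x - y) ≤ p * M ^ (p - 1) * (x - y) := by
      apply mul_le_mul_of_nonneg_right _ (by linarith)
      gcongr
    linarith

lemma abs_rpow_sub_le {p x y M : ℝ} (hp : 1 < p) (hx0 : 0 ≤ x) (hy0 : 0 ≤ y) (hx : x ≤ M) (hy : y ≤ M) :
    |x ^ p - y ^ p| ≤ p * M ^ (p - 1) * |x - y| := by
  rcases le_total y x with h | h
  · have := rpow_le_rpow hy0 h (by linarith : 0 ≤ p)
    rw [abs_of_nonneg (by linarith), abs_of_nonneg (by linarith)]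
    exact rpow_sub_le_aux hp hy0 h hx
  · have := rpow_le_rpow hx0 h (by linarith : 0 ≤ p)
    rw [abs_of_nonpos (by linarith), abs_of_nonpos (by linarith)]
    have := rpow_sub_le_aux hp hx0 h hy
    linarith

def TV (p : ℝ) (V u : Sp N → ℝ) : Sp N → ℝ := Gr (fun y => V y * u y ^ p)

lemma Gr_abs_le (hN : 3 ≤ N) {f g : Sp N → ℝ} (hf : Adm f) (hg : Adm g)
    (h : ∀ y : Sp N, y ≠ 0 → |f y| ≤ g y) {x : Sp N} (hx : x ≠ 0) : |Gr f x| ≤ Gr g x := by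
  rw [abs_le]
  constructor
  · have h1 := Gr_mono hN (hg.const_mul (-1)) hf (fun y hy => by
      have := (abs_le.mp (h y hy)).1; linarith) hx
    rw [Gr_const_mul] at h1; linarith
  · exact Gr_mono hN hf hg (fun y hy => (abs_le.mp (h y hy)).2) hx

namespace Setup
variable {V w : Sp N → ℝ} {τ η l0 θ r C' C K : ℝ}

lemma b0 (S : Setup N p a c t m V w τ η l0 θ r C' C K) : 0 < a - τ := S.P.b_pos S.hτm
lemma b1 (S : Setup N p a c t m V w τ η l0 θ r C' C K) : a - τ < (N:ℝ) - 2 := S.P.b_lt S.hτ0.le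
lemma lpos (S : Setup N p a c t m V w τ η l0 θ r C' C K) {l : ℝ} (hl : l0 ≤ l) : 0 < l := by
  linarith [S.hl0]
lemma wl (S : Setup N p a c t m V w τ η l0 θ r C' C K) {l : ℝ} (hl : l0 ≤ l) :
    IsW N p a c t (scl a l w) := S.hw.scl S.P (S.lpos hl)
lemma ψ0 (S : Setup N p a c t m V w τ η l0 θ r C' C K) {l : ℝ} (hl : l0 ≤ l) (x : Sp N) :
    0 ≤ scl a l (Gr (mf (a - τ) η)) x := by
  have := S.lpos hl
  exact mul_nonneg (by positivity) (Gr_nonneg S.P.hN (fun y _ => mf_nonneg y) _)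
lemma ψle (S : Setup N p a c t m V w τ η l0 θ r C' C K) {l : ℝ} (hl : l0 ≤ l) {x : Sp N} (hx : x ≠ 0) :
    scl a l (Gr (mf (a - τ) η)) x ≤ C' * scl a l w x := by
  have hl := S.lpos hl
  have := S.ψw (l • x) (smul_ne hl hx)
  unfold scl
  calc _ ≤ l ^ a * (C' * w (l • x)) := by gcongr
    _ = _ := by ring
lemma wanti (S : Setup N p a c t m V w τ η l0 θ r C' C K) {l l' : ℝ} (hl : l0 ≤ l) (hll : l ≤ l')
    {x : Sp N} (hx : x ≠ 0) : scl a l' w x ≤ scl a l w x := by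
  have hl := S.lpos hl
  have h1 := S.hw.pp (l' / l) ((one_le_div hl).mpr hll) (l • x) (smul_ne hl hx)
  rw [smul_smul, div_mul_cancel₀ _ hl.ne'] at h1
  unfold scl
  have e : l' ^ a = l ^ a * (l' / l) ^ a := by
    rw [← mul_rpow hl.le (div_nonneg (by linarith) hl.le)]; congr 1; field_simp
  rw [e, mul_assoc]
  gcongr

/-- membership in the contraction ball -/
def InX (_S : Setup N p a c t m V w τ η l0 θ r C' C K) (l : ℝ) (u : Sp N → ℝ) : Prop :=
  AEStronglyMeasurable u volume ∧ ∀ x : Sp N, x ≠ 0 →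
    |u x - scl a l w x| ≤ r * scl a l (Gr (mf (a - τ) η)) x

variable (S : Setup N p a c t m V w τ η l0 θ r C' C K)

lemma InX.bd {l : ℝ} (hl : l0 ≤ l) {u : Sp N → ℝ} (hu : S.InX l u) {x : Sp N} (hx : x ≠ 0) :
    scl a l w x / 2 ≤ u x ∧ u x ≤ (1 + r * C') * scl a l w x ∧ u x ≤ 2 * scl a l w x
      ∧ u x ≤ 2 * scl a l0 w x ∧ 0 < u x := by
  have h1 := abs_le.mp (hu.2 x hx)
  have h2 : r * scl a l (Gr (mf (a - τ) η)) x ≤ r * C' * scl a l w x := by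
    have := mul_le_mul_of_nonneg_left (S.ψle hl hx) S.hr.le
    linarith
  have h3 := (S.wl hl).pos x hx
  have h4 := S.hrC
  have h5 : r * C' * scl a l w x ≤ 1 / 2 * scl a l w x := by gcongr
  have h6 := S.wanti le_rfl hl hx
  refine ⟨by linarith, by linarith, by linarith, by linarith, by linarith⟩

lemma domle (S : Setup N p a c t m V w τ η l0 θ r C' C K) {u : Sp N → ℝ} {y : Sp N} (hy : y ≠ 0) (h0 : 0 ≤ u y) (h : u y ≤ 2 * scl a l0 w y) :
    |V y * u y ^ p| ≤ K * mf a η y := by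
  have hV := S.hV0 y hy
  rw [abs_of_nonneg (mul_nonneg hV (rpow_nonneg h0 _))]
  refine le_trans ?_ (S.dom y hy)
  have := rpow_le_rpow h0 h S.P.p0.le
  gcongr

lemma dadm (S : Setup N p a c t m V w τ η l0 θ r C' C K) : Adm (fun y : Sp N => K * mf a η y) := (mf_adm S.P.ha S.P.haN).const_mul K

lemma aesmV (S : Setup N p a c t m V w τ η l0 θ r C' C K) {u : Sp N → ℝ} (hu : AEStronglyMeasurable u volume) :
    AEStronglyMeasurable (fun y => V y * u y ^ p) volume := S.hVm.mul (aesm_rpow hu p)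

lemma InX.adm {l : ℝ} (hl : l0 ≤ l) {u : Sp N → ℝ} (hu : S.InX l u) : Adm (fun y => V y * u y ^ p) :=
  S.dadm.of_abs_le (S.aesmV hu.1) fun y hy => by
    obtain ⟨_, _, _, h4, h5⟩ := InX.bd S hl hu hy
    exact S.domle hy h5.le h4

lemma w_InX {l : ℝ} (hl : l0 ≤ l) : S.InX l (scl a l w) := by
  refine ⟨(S.wl hl).sub.1, fun x _ => ?_⟩
  rw [sub_self, abs_zero]
  exact mul_nonneg S.hr.le (S.ψ0 hl x)

lemma madm (S : Setup N p a c t m V w τ η l0 θ r C' C K) {l : ℝ} (hl : l0 ≤ l) : Adm (scl (a + 2) l (mf (N := N) (a - τ) η)) := by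
  have hl' := S.lpos hl
  refine (adm_pow (N := N) S.b0 S.b1).of_le (K := l ^ (a + 2) * l ^ (-(a - τ) - 2)) ?_ fun y hy => ?_
  · exact (aesm_smul mf_meas.aestronglyMeasurable hl').const_mul _
  · unfold scl
    have h0 := mf_nonneg (b := a - τ) (η := η) (l • y)
    rw [abs_of_nonneg (by positivity), abs_of_nonneg (by positivity), mul_assoc,
      ← mul_rpow hl'.le (norm_nonneg _), ← norm_smul_pos' hl']
    gcongr
    exact min_le_left _ _

lemma contr {l : ℝ} (hl : l0 ≤ l) {u v : Sp N → ℝ} (hu : S.InX l u) (hv : S.InX l v) {e : ℝ}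
    (h : ∀ x : Sp N, x ≠ 0 → |u x - v x| ≤ e * scl a l (Gr (mf (a - τ) η)) x) (he : 0 ≤ e)
    {x : Sp N} (hx : x ≠ 0) :
    |TV p V u x - TV p V v x| ≤ e * θ * scl a l (Gr (mf (a - τ) η)) x := by
  have hA := InX.adm S hl hu
  have hB := InX.adm S hl hv
  unfold TV
  rw [← Gr_sub S.P.hN hA hB hx, ← Gr_scl (S.lpos hl), ← Gr_const_mul]
  refine Gr_abs_le S.P.hN (hA.sub hB) ((S.madm hl).const_mul _) (fun y hy => ?_) hx
  obtain ⟨_, h2, _, _, h5⟩ := InX.bd S hl hu hy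
  obtain ⟨_, h2', _, _, h5'⟩ := InX.bd S hl hv hy
  rw [← mul_sub, abs_mul, abs_of_nonneg (S.hV0 y hy)]
  have h6 := abs_rpow_sub_le S.P.hp h5.le h5'.le h2 h2'
  have hM : 0 ≤ p * ((1 + r * C') * scl a l w y) ^ (p - 1) :=
    mul_nonneg S.P.p0.le (rpow_nonneg (h5.le.trans h2) _)
  have hV := S.hV0 y hy
  calc V y * |u y ^ p - v y ^ p| ≤ V y * (p * ((1 + r * C') * scl a l w y) ^ (p - 1) *
        (e * scl a l (Gr (mf (a - τ) η)) y)) := by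
        gcongr
        refine h6.trans ?_
        gcongr
        exact h y hy
    _ = e * (V y * (p * ((1 + r * C') * scl a l w y) ^ (p - 1)) * scl a l (Gr (mf (a - τ) η)) y) := by ring
    _ ≤ e * (θ * scl (a + 2) l (mf (a - τ) η) y) := by
        exact mul_le_mul_of_nonneg_left (S.hK l hl y hy) he
    _ = _ := by ring

lemma first (S : Setup N p a c t m V w τ η l0 θ r C' C K) {l : ℝ} (hl : l0 ≤ l) {x : Sp N} (hx : x ≠ 0) :
    |TV p V (scl a l w) x - scl a l w x| ≤ (1 - θ) * r * scl a l (Gr (mf (a - τ) η)) x := by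
  have hA := InX.adm S hl (S.w_InX hl)
  have hB := (S.wl hl).sub.adm S.P
  have h1 : scl a l w x = Gr (fun y => scl a l w y ^ p) x := ((S.wl hl).fix x hx).symm
  rw [h1]
  unfold TV
  rw [← Gr_sub S.P.hN hA hB hx, ← Gr_scl (S.lpos hl), ← Gr_const_mul]
  refine Gr_abs_le S.P.hN (hA.sub hB) ((S.madm hl).const_mul _) (fun y hy => ?_) hx
  refine le_trans (le_of_eq ?_) (S.hE l hl y hy)
  have hw := rpow_nonneg ((S.wl hl).pos y hy).le p
  rw [← abs_of_nonneg hw, ← abs_mul, abs_of_nonneg hw]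
  congr 1; ring

lemma TV_InX {l : ℝ} (hl : l0 ≤ l) {u : Sp N → ℝ} (hu : S.InX l u) : S.InX l (TV p V u) := by
  refine ⟨Gr_aesm S.P.hN (InX.adm S hl hu), fun x hx => ?_⟩
  have h1 := S.contr hl hu (S.w_InX hl) hu.2 S.hr.le hx
  have h2 := S.first hl hx
  calc |TV p V u x - scl a l w x|
      ≤ |TV p V u x - TV p V (scl a l w) x| + |TV p V (scl a l w) x - scl a l w x| := abs_sub_le _ _ _
    _ ≤ _ := by linarith

def vv (_S : Setup N p a c t m V w τ η l0 θ r C' C K) (n : ℕ) (l : ℝ) : Sp N → ℝ :=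
  (TV p V)^[n] (scl a l w)

lemma vv_zero (l : ℝ) : S.vv 0 l = scl a l w := rfl
lemma vv_succ (n : ℕ) (l : ℝ) : S.vv (n+1) l = TV p V (S.vv n l) := Function.iterate_succ_apply' _ _ _

lemma vv_InX {l : ℝ} (hl : l0 ≤ l) (n : ℕ) : S.InX l (S.vv n l) := by
  induction n with
  | zero => exact S.w_InX hl
  | succ n ih => rw [vv_succ]; exact S.TV_InX hl ih

lemma vv_diff {l : ℝ} (hl : l0 ≤ l) (n : ℕ) : ∀ {x : Sp N}, x ≠ 0 →
    |S.vv (n+1) l x - S.vv n l x| ≤ (1 - θ) * r * θ ^ n * scl a l (Gr (mf (a - τ) η)) x := by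
  have h1 : 0 < 1 - θ := by linarith [S.hθ1]
  have h2 := S.hr
  have h3 := S.hθ0
  induction n with
  | zero => intro x hx; rw [vv_succ, vv_zero, pow_zero, mul_one]; exact S.first hl hx
  | succ n ih =>
    intro x hx
    have := S.contr hl (S.vv_InX hl (n+1)) (S.vv_InX hl n) (fun y hy => ih hy) (by positivity) hx
    rw [vv_succ S (n+1), vv_succ S n] at *
    refine this.trans (le_of_eq (by ring))

def uu (S : Setup N p a c t m V w τ η l0 θ r C' C K) (l : ℝ) (x : Sp N) : ℝ :=
  limUnder atTop (fun n => S.vv n l x)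

lemma uu_tendsto {l : ℝ} (hl : l0 ≤ l) {x : Sp N} (hx : x ≠ 0) :
    Tendsto (fun n => S.vv n l x) atTop (nhds (S.uu l x)) := by
  have hc : CauchySeq (fun n => S.vv n l x) := by
    refine cauchySeq_of_le_geometric θ ((1 - θ) * r * scl a l (Gr (mf (a - τ) η)) x) S.hθ1 fun n => ?_
    rw [dist_comm, Real.dist_eq]
    refine (S.vv_diff hl n hx).trans (le_of_eq (by ring))
  exact hc.tendsto_limUnder

lemma uu_err {l : ℝ} (hl : l0 ≤ l) (n : ℕ) {x : Sp N} (hx : x ≠ 0) :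
    |S.vv n l x - S.uu l x| ≤ r * θ ^ n * scl a l (Gr (mf (a - τ) η)) x := by
  have h1 : 0 < 1 - θ := by linarith [S.hθ1]
  have := dist_le_of_le_geometric_of_tendsto θ ((1 - θ) * r * scl a l (Gr (mf (a - τ) η)) x) S.hθ1
    (f := fun n => S.vv n l x) (fun n => by
      rw [dist_comm, Real.dist_eq]
      exact (S.vv_diff hl n hx).trans (le_of_eq (by ring))) (S.uu_tendsto hl hx) n
  rw [Real.dist_eq] at this
  refine this.trans (le_of_eq ?_)
  field_simp

lemma uu_InX {l : ℝ} (hl : l0 ≤ l) : S.InX l (S.uu l) := by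
  refine ⟨?_, fun x hx => ?_⟩
  · refine aestronglyMeasurable_of_tendsto_ae atTop (fun n => (S.vv_InX hl n).1) ?_
    filter_upwards [ae_ne_zero S.P.hN] with x hx using S.uu_tendsto hl hx
  · have := S.uu_err hl 0 hx
    rw [abs_sub_comm, pow_zero, mul_one] at this
    exact this

lemma uu_fix {l : ℝ} (hl : l0 ≤ l) {x : Sp N} (hx : x ≠ 0) : TV p V (S.uu l) x = S.uu l x := by
  have h1 : Tendsto (fun n => TV p V (S.vv n l) x) atTop (nhds (TV p V (S.uu l) x)) := by
    refine Gr_tendsto S.P.hN S.dadm (Eventually.of_forall fun n => S.aesmV (S.vv_InX hl n).1)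
      (Eventually.of_forall fun n y hy => ?_) (fun y hy => ?_) hx
    · obtain ⟨_, _, _, h4, h5⟩ := InX.bd S hl (S.vv_InX hl n) hy
      exact S.domle hy h5.le h4
    · exact ((S.uu_tendsto hl hy).rpow_const (Or.inr S.P.p0.le)).const_mul _
  have h2 := (tendsto_add_atTop_iff_nat 1).mpr (S.uu_tendsto hl hx)
  simp only [vv_succ] at h2
  exact tendsto_nhds_unique h1 h2

lemma vv_anti {l l' : ℝ} (hl : l0 ≤ l) (hll : l ≤ l') (n : ℕ) : ∀ {x : Sp N}, x ≠ 0 →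
    S.vv n l' x ≤ S.vv n l x := by
  have hl' := hl.trans hll
  induction n with
  | zero => intro x hx; exact S.wanti hl hll hx
  | succ n ih =>
    intro x hx
    rw [vv_succ, vv_succ]
    refine Gr_mono S.P.hN (InX.adm S hl' (S.vv_InX hl' n)) (InX.adm S hl (S.vv_InX hl n)) (fun y hy => ?_) hx
    have h5 := (InX.bd S hl' (S.vv_InX hl' n) hy).2.2.2.2
    have := S.hV0 y hy
    have := rpow_le_rpow h5.le (ih hy) S.P.p0.le
    gcongr

lemma uu_anti {l l' : ℝ} (hl : l0 ≤ l) (hll : l ≤ l') {x : Sp N} (hx : x ≠ 0) : S.uu l' x ≤ S.uu l x :=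
  le_of_tendsto_of_tendsto' (S.uu_tendsto (hl.trans hll) hx) (S.uu_tendsto hl hx)
    fun n => S.vv_anti hl hll n hx

lemma w_cont (S : Setup N p a c t m V w τ η l0 θ r C' C K) {x : Sp N} (hx : x ≠ 0) : ContinuousAt w x := by
  have h1 := Gr_contAt S.P.hN (S.hw.sub.adm S.P) hx
  refine h1.congr ?_
  filter_upwards [isOpen_compl_singleton.mem_nhds hx] with y hy using S.hw.fix y hy

lemma vv_cont (n : ℕ) : ∀ {x : Sp N}, x ≠ 0 → ContinuousOn (fun l => S.vv n l x) (Ici l0) := by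
  induction n with
  | zero =>
    intro x hx l hl
    have hl' := S.lpos hl
    apply ContinuousAt.continuousWithinAt
    change ContinuousAt (fun l => l ^ a * w (l • x)) l
    refine (continuousAt_rpow_const l a (Or.inl hl'.ne')).mul ?_
    have h1 : ContinuousAt (fun l : ℝ => l • x) l := by fun_prop
    exact ContinuousAt.comp (f := fun l : ℝ => l • x) (S.w_cont (smul_ne hl' hx)) h1
  | succ n ih =>
    intro x hx l hl
    simp only [vv_succ]
    refine Gr_tendsto S.P.hN S.dadm ?_ ?_ (fun y hy => ?_) hx
    · filter_upwards [self_mem_nhdsWithin] with l' hl'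
      exact S.aesmV (S.vv_InX hl' n).1
    · filter_upwards [self_mem_nhdsWithin] with l' hl' y hy
      obtain ⟨_, _, _, h4, h5⟩ := InX.bd S hl' (S.vv_InX hl' n) hy
      exact S.domle hy h5.le h4
    · have h1 : Tendsto (fun l' => S.vv n l' y) (nhdsWithin l (Ici l0)) (nhds (S.vv n l y)) := ih hy l hl
      exact (h1.rpow_const (Or.inr S.P.p0.le)).const_mul _

lemma uu_cont {x : Sp N} (hx : x ≠ 0) : ContinuousOn (fun l => S.uu l x) (Ici l0) := by
  have hu : TendstoUniformlyOn (fun n l => S.vv n l x) (fun l => S.uu l x) atTop (Ici l0) := by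
    rw [Metric.tendstoUniformlyOn_iff]
    intro ε hε
    have h1 : Tendsto (fun n : ℕ => r * θ ^ n * (C' * scl a l0 w x)) atTop
        (nhds (r * 0 * (C' * scl a l0 w x))) :=
      ((tendsto_pow_atTop_nhds_zero_of_lt_one S.hθ0.le S.hθ1).const_mul _).mul_const _
    rw [mul_zero, zero_mul] at h1
    filter_upwards [h1.eventually (gt_mem_nhds hε)] with n hn l hl
    rw [dist_comm, Real.dist_eq]
    refine lt_of_le_of_lt ((S.uu_err hl n hx).trans ?_) hn
    have hr := S.hr
    have hθ := S.hθ0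
    have hC' := S.hC'
    gcongr
    refine (S.ψle hl hx).trans ?_
    have := S.wanti le_rfl hl hx
    gcongr
  exact hu.continuousOn (Eventually.of_forall fun n => S.vv_cont n hx).frequently

end Setup
end

section
variable {N : ℕ} {p a c t m : ℝ}
namespace Setup
variable {V w : Sp N → ℝ} {τ η l0 θ r C' C K : ℝ}

def nu (S : Setup N p a c t m V w τ η l0 θ r C' C K) (l : ℝ) : ℝ :=
  (gam N)⁻¹ * ∫ y, V y * S.uu l y ^ p

variable (S : Setup N p a c t m V w τ η l0 θ r C' C K)

lemma uu_pos {l : ℝ} (hl : l0 ≤ l) {y : Sp N} (hy : y ≠ 0) : 0 < S.uu l y :=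
  (InX.bd S hl (S.uu_InX hl) hy).2.2.2.2

lemma uu_dom {l : ℝ} (hl : l0 ≤ l) {y : Sp N} (hy : y ≠ 0) : |V y * S.uu l y ^ p| ≤ K * mf a η y := by
  obtain ⟨_, _, _, h4, h5⟩ := InX.bd S hl (S.uu_InX hl) hy
  exact S.domle hy h5.le h4

lemma uu_m {l : ℝ} (hl : l0 ≤ l) : AEStronglyMeasurable (fun y => V y * S.uu l y ^ p) volume :=
  S.aesmV (S.uu_InX hl).1

lemma d_int (S : Setup N p a c t m V w τ η l0 θ r C' C K) : Integrable (fun y : Sp N => K * mf a η y) :=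
  (mf_int S.P.hN S.P.haN S.hη).const_mul K

lemma uu_int {l : ℝ} (hl : l0 ≤ l) : Integrable (fun y => V y * S.uu l y ^ p) := by
  refine S.d_int.mono' (S.uu_m hl) ?_
  filter_upwards [ae_ne_zero S.P.hN] with y hy using S.uu_dom hl hy

lemma gi (S : Setup N p a c t m V w τ η l0 θ r C' C K) : 0 < (gam N)⁻¹ := inv_pos.mpr (gam_pos S.P.hN)

lemma uu_asym {l : ℝ} (hl : l0 ≤ l) : Tendsto (fun x : Sp N => S.uu l x * ‖x‖ ^ ((N:ℝ) - 2))
    (Filter.comap (fun x => ‖x‖) Filter.atTop) (nhds (S.nu l)) := by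
  have h := Gr_asym S.P.hN S.P.ha S.P.haN S.hη S.hK0 (S.uu_m hl) (fun y hy => S.uu_dom hl hy)
  refine h.congr' ?_
  have h1 : ∀ᶠ x : Sp N in Filter.comap (fun x => ‖x‖) Filter.atTop, (1:ℝ) ≤ ‖x‖ :=
    tendsto_comap.eventually (eventually_ge_atTop 1)
  filter_upwards [h1] with x hx
  have hx0 : x ≠ 0 := norm_pos_iff.mp (by linarith)
  rw [← S.uu_fix hl hx0]; rfl

lemma nu_cont : ContinuousOn S.nu (Ici l0) := by
  intro l hl
  refine Tendsto.const_mul _ ?_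
  refine tendsto_integral_filter_of_dominated_convergence (fun y : Sp N => K * mf a η y) ?_ ?_ S.d_int ?_
  · filter_upwards [self_mem_nhdsWithin] with l' hl' using S.uu_m hl'
  · filter_upwards [self_mem_nhdsWithin] with l' hl'
    filter_upwards [ae_ne_zero S.P.hN] with y hy using S.uu_dom hl' hy
  · filter_upwards [ae_ne_zero S.P.hN] with y hy
    have h1 : Tendsto (fun l' => S.uu l' y) (nhdsWithin l (Ici l0)) (nhds (S.uu l y)) := S.uu_cont hy l hl
    exact (h1.rpow_const (Or.inr S.P.p0.le)).const_mul _

lemma f_anti {l l' : ℝ} (hl : l0 ≤ l) (hll : l ≤ l') {y : Sp N} (hy : y ≠ 0) :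
    V y * S.uu l' y ^ p ≤ V y * S.uu l y ^ p := by
  have h5 := S.uu_pos (hl.trans hll) hy
  have := S.hV0 y hy
  have := rpow_le_rpow h5.le (S.uu_anti hl hll hy) S.P.p0.le
  gcongr

lemma nu_anti {l l' : ℝ} (hl : l0 ≤ l) (hll : l ≤ l') : S.nu l' ≤ S.nu l := by
  have hg := S.gi
  unfold nu
  refine mul_le_mul_of_nonneg_left ?_ hg.le
  refine integral_mono_ae (S.uu_int (hl.trans hll)) (S.uu_int hl) ?_
  filter_upwards [ae_ne_zero S.P.hN] with y hy using S.f_anti hl hll hy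

lemma nu_pos {l : ℝ} (hl : l0 ≤ l) : 0 < S.nu l := by
  have h0 : 0 ≤ᵐ[volume] fun y => V y * S.uu l y ^ p := by
    filter_upwards [ae_ne_zero S.P.hN] with y hy
    exact mul_nonneg (S.hV0 y hy) (rpow_nonneg (S.uu_pos hl hy).le _)
  refine mul_pos S.gi (lt_of_le_of_ne (integral_nonneg_of_ae h0) fun h => ?_)
  have h1 := (integral_eq_zero_iff_of_nonneg_ae h0 (S.uu_int hl)).mp h.symm
  obtain ⟨e, he⟩ := exists_unit S.P.hN
  have he0 : e ≠ 0 := norm_pos_iff.mp (by rw [he]; exact one_pos)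
  have h2 := S.uu_pos hl he0
  rw [← S.uu_fix hl he0] at h2
  have h3 : TV p V (S.uu l) e = 0 := by
    unfold TV Gr G
    rw [integral_eq_zero_of_ae, mul_zero]
    filter_upwards [h1] with y hy
    rw [hy]; simp
  linarith

lemma uu_same {l l' : ℝ} (hl : l0 ≤ l) (hll : l ≤ l') (h : S.nu l = S.nu l') {x : Sp N} (hx : x ≠ 0) :
    S.uu l x = S.uu l' x := by
  have hl' := hl.trans hll
  have h1 : ∫ y, V y * S.uu l y ^ p = ∫ y, V y * S.uu l' y ^ p := mul_left_cancel₀ S.gi.ne' h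
  have h2 : (fun y => V y * S.uu l' y ^ p) =ᵐ[volume] fun y => V y * S.uu l y ^ p := by
    refine (integral_eq_iff_of_ae_le (S.uu_int hl') (S.uu_int hl) ?_).mp h1.symm
    filter_upwards [ae_ne_zero S.P.hN] with y hy using S.f_anti hl hll hy
  rw [← S.uu_fix hl hx, ← S.uu_fix hl' hx]
  unfold TV Gr G
  congr 1
  refine integral_congr_ae ?_
  filter_upwards [h2] with y hy
  rw [hy]

lemma uu_same' {l l' : ℝ} (hl : l0 ≤ l) (hl' : l0 ≤ l') (h : S.nu l = S.nu l') {x : Sp N} (hx : x ≠ 0) :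
    S.uu l x = S.uu l' x := by
  rcases le_total l l' with h1 | h1
  · exact S.uu_same hl h1 h hx
  · exact (S.uu_same hl' h1 h.symm hx).symm

lemma uu_decay {l : ℝ} (hl : l0 ≤ l) {x : Sp N} (h : 1 ≤ l * ‖x‖) :
    S.uu l x ≤ 2 * C * ‖x‖ ^ (2 - (N:ℝ)) * l ^ (a + 2 - (N:ℝ)) := by
  have hlp := S.lpos hl
  have hx : x ≠ 0 := by
    rintro rfl; rw [norm_zero, mul_zero] at h; linarith
  have h1 := (InX.bd S hl (S.uu_InX hl) hx).2.2.1
  have h2 := S.dec (l • x) (by rw [norm_smul_pos' hlp]; exact h)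
  rw [norm_smul_pos' hlp, mul_rpow hlp.le (norm_nonneg _)] at h2
  have e : l ^ (a + 2 - (N:ℝ)) = l ^ a * l ^ (2 - (N:ℝ)) := by
    rw [← rpow_add hlp]; congr 1; ring
  have h3 : scl a l w x ≤ l ^ a * (C * (l ^ (2 - (N:ℝ)) * ‖x‖ ^ (2 - (N:ℝ)))) := by
    unfold scl
    exact mul_le_mul_of_nonneg_left h2 (by positivity)
  rw [e]
  refine h1.trans ((mul_le_mul_of_nonneg_left h3 zero_le_two).trans (le_of_eq (by ring)))

lemma dec_lim (S : Setup N p a c t m V w τ η l0 θ r C' C K) (B : ℝ) :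
    Tendsto (fun l : ℝ => B * l ^ (a + 2 - (N:ℝ))) atTop (nhds 0) := by
  have h := tendsto_rpow_neg_atTop (y := (N:ℝ) - 2 - a) (by linarith [S.P.haN])
  have h2 := h.const_mul B
  rw [mul_zero] at h2
  refine h2.congr fun l => ?_
  congr 2; ring

lemma uu_zero {x : Sp N} (hx : x ≠ 0) : Tendsto (fun l => S.uu l x) atTop (nhds 0) := by
  have hxp : 0 < ‖x‖ := norm_pos_iff.mpr hx
  refine squeeze_zero' ?_ ?_ (S.dec_lim (2 * C * ‖x‖ ^ (2 - (N:ℝ))))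
  · filter_upwards [eventually_ge_atTop l0] with l hl using (S.uu_pos hl hx).le
  · filter_upwards [eventually_ge_atTop l0, eventually_ge_atTop (1 / ‖x‖)] with l hl h
    exact S.uu_decay hl ((div_le_iff₀ hxp).mp h)

lemma nu_zero : Tendsto S.nu atTop (nhds 0) := by
  have h : Tendsto S.nu atTop (nhds ((gam N)⁻¹ * ∫ _y : Sp N, (0:ℝ))) := by
    refine Tendsto.const_mul _ ?_
    refine tendsto_integral_filter_of_dominated_convergence (fun y : Sp N => K * mf a η y) ?_ ?_ S.d_int ?_
    · filter_upwards [eventually_ge_atTop l0] with l' hl' using S.uu_m hl'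
    · filter_upwards [eventually_ge_atTop l0] with l' hl'
      filter_upwards [ae_ne_zero S.P.hN] with y hy using S.uu_dom hl' hy
    · filter_upwards [ae_ne_zero S.P.hN] with y hy
      have := ((S.uu_zero hy).rpow_const (p := p) (Or.inr S.P.p0.le)).const_mul (V y)
      rwa [zero_rpow S.P.p0.ne', mul_zero] at this
  simpa using h

lemma ex_small {ε : ℝ} (hε : 0 < ε) : ∃ L, l0 ≤ L ∧ S.nu L < ε := by
  obtain ⟨L, h1, h2⟩ := ((S.nu_zero.eventually (gt_mem_nhds hε)).and (eventually_ge_atTop l0)).exists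
  exact ⟨L, h2, h1⟩

lemma ivt {L : ℝ} (hL : l0 ≤ L) {ν : ℝ} (h : ν ∈ Icc (S.nu L) (S.nu l0)) : ∃ l ∈ Icc l0 L, S.nu l = ν :=
  intermediate_value_Icc' hL (S.nu_cont.mono Icc_subset_Ici_self) h

lemma ex_lam {ν : ℝ} (h : ν ∈ Ioc 0 (S.nu l0)) : ∃ l, l0 ≤ l ∧ S.nu l = ν := by
  obtain ⟨L, h1, h2⟩ := S.ex_small h.1
  obtain ⟨l, hl, h3⟩ := S.ivt h1 ⟨h2.le, h.2⟩
  exact ⟨l, hl.1, h3⟩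

lemma uu_sing {l : ℝ} (hl : l0 ≤ l) : Tendsto (fun x : Sp N => S.uu l x * ‖x‖ ^ a)
    (nhdsWithin 0 {0}ᶜ) (nhds c) := by
  have hlp := S.lpos hl
  obtain ⟨A, hA, hlow⟩ := (S.wl hl).low
  set B := r * (l ^ a * (l ^ (-(a - τ)) / ((a - τ) * (N - 2 - (a - τ))))) with hB
  have hn : Tendsto (fun x : Sp N => ‖x‖) (nhdsWithin 0 {0}ᶜ) (nhds 0) := by
    have : Tendsto (fun x : Sp N => ‖x‖) (nhds 0) (nhds ‖(0 : Sp N)‖) := continuous_norm.tendsto 0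
    rw [norm_zero] at this
    exact this.mono_left nhdsWithin_le_nhds
  have hlim : Tendsto (fun x : Sp N => A * ‖x‖ ^ t + B * ‖x‖ ^ τ) (nhdsWithin 0 {0}ᶜ) (nhds 0) := by
    have h1 := (hn.rpow_const (p := t) (Or.inr S.P.ht0.le)).const_mul A
    have h2 := (hn.rpow_const (p := τ) (Or.inr S.hτ0.le)).const_mul B
    have h3 := h1.add h2
    rwa [zero_rpow S.P.ht0.ne', zero_rpow S.hτ0.ne', mul_zero, mul_zero, add_zero] at h3
  rw [tendsto_iff_norm_sub_tendsto_zero]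
  refine squeeze_zero' (Eventually.of_forall fun _ => norm_nonneg _) ?_ hlim
  filter_upwards [self_mem_nhdsWithin] with x hx
  have hx : x ≠ 0 := hx
  have hxp : 0 < ‖x‖ := norm_pos_iff.mpr hx
  have e1 := abs_le.mp ((S.uu_InX hl).2 x hx)
  have e2 := hlow x hx
  have e3 := ((S.wl hl).sub.2 x hx).2
  have e4 : r * scl a l (Gr (mf (a - τ) η)) x ≤ B * ‖x‖ ^ (-(a - τ)) := by
    have h := Gr_mf_le (η := η) S.P.hN S.b0 S.b1 (smul_ne hlp hx)
    rw [norm_smul_pos' hlp, mul_rpow hlp.le hxp.le] at h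
    unfold scl
    have hr := S.hr
    have h' := mul_le_mul_of_nonneg_left (mul_le_mul_of_nonneg_left h (rpow_nonneg hlp.le a)) hr.le
    refine h'.trans (le_of_eq ?_)
    rw [hB]; ring
  have f1 : ‖x‖ ^ (-a) * ‖x‖ ^ a = 1 := by rw [← rpow_add hxp]; simp
  have f2 : ‖x‖ ^ (-(a - t)) * ‖x‖ ^ a = ‖x‖ ^ t := by rw [← rpow_add hxp]; congr 1; ring
  have f3 : ‖x‖ ^ (-(a - τ)) * ‖x‖ ^ a = ‖x‖ ^ τ := by rw [← rpow_add hxp]; congr 1; ring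
  have hxa : 0 ≤ ‖x‖ ^ a := by positivity
  have hAt : 0 ≤ A * ‖x‖ ^ t := by positivity
  have g1 := mul_le_mul_of_nonneg_right
    (show S.uu l x ≤ c * ‖x‖ ^ (-a) + B * ‖x‖ ^ (-(a - τ)) by linarith) hxa
  have g2 := mul_le_mul_of_nonneg_right
    (show c * ‖x‖ ^ (-a) - A * ‖x‖ ^ (-(a - t)) - B * ‖x‖ ^ (-(a - τ)) ≤ S.uu l x by linarith) hxa
  rw [add_mul, mul_assoc, f1, mul_assoc, f3] at g1
  rw [sub_mul, sub_mul, mul_assoc, f1, mul_assoc, f2, mul_assoc, f3] at g2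
  rw [Real.norm_eq_abs, abs_le]
  constructor <;> linarith

lemma uu_reg (hV : LocHolderOn V {0}ᶜ) {l : ℝ} (hl : l0 ≤ l) {x₀ : Sp N} (hx₀ : x₀ ≠ 0) :
    ContDiffAt ℝ 2 (S.uu l) x₀ ∧ - lap (S.uu l) x₀ = V x₀ * S.uu l x₀ ^ p := by
  have hf := InX.adm S hl (S.uu_InX hl)
  have hp := S.P.hp
  have hp0 := S.P.p0
  have hev : Gr (fun y => V y * S.uu l y ^ p) =ᶠ[nhds x₀] S.uu l := by
    filter_upwards [isOpen_compl_singleton.mem_nhds hx₀] with y hy using S.uu_fix hl hy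
  have key : ∃ ρ H α : ℝ, 0 < ρ ∧ 0 ≤ H ∧ 0 < α ∧ ∀ x ∈ ball x₀ ρ, ∀ y ∈ ball x₀ ρ,
      |V y * S.uu l y ^ p - V x * S.uu l x ^ p| ≤ H * ‖x - y‖ ^ α := by
    obtain ⟨ρ₁, hρ₁, L, hL, hlip⟩ := Gr_lip S.P.hN hf hx₀
    obtain ⟨D, α, ρ₂, hρ₂, hα, hα1, hol⟩ := hV x₀ hx₀
    have hxp : 0 < ‖x₀‖ := norm_pos_iff.mpr hx₀
    set ρ := min (min ρ₁ ρ₂) (min ‖x₀‖ (1/2)) with hρ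
    have hρ0 : 0 < ρ := by positivity
    have r1 : ρ ≤ ρ₁ := (min_le_left _ _).trans (min_le_left _ _)
    have r2 : ρ ≤ ρ₂ := (min_le_left _ _).trans (min_le_right _ _)
    have r3 : ρ ≤ ‖x₀‖ := (min_le_right _ _).trans (min_le_left _ _)
    have r4 : ρ ≤ 1/2 := (min_le_right _ _).trans (min_le_right _ _)
    have hne : ∀ x ∈ ball x₀ ρ, x ≠ 0 := by
      rintro x hx rfl
      rw [mem_ball, dist_eq_norm, zero_sub, norm_neg] at hx
      linarith
    have hα' : (0:ℝ) < α := by exact_mod_cast hα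
    have hα1' : (α:ℝ) ≤ 1 := by exact_mod_cast hα1
    have hVd : ∀ x ∈ ball x₀ ρ, ∀ y ∈ ball x₀ ρ, |V y - V x| ≤ D * ‖x - y‖ ^ (α:ℝ) := by
      intro x hx y hy
      have := hol.dist_le ⟨ball_subset_ball r2 hy, hne y hy⟩ ⟨ball_subset_ball r2 hx, hne x hx⟩
      rwa [Real.dist_eq, dist_comm, dist_eq_norm] at this
    have hud : ∀ x ∈ ball x₀ ρ, ∀ y ∈ ball x₀ ρ, |S.uu l y - S.uu l x| ≤ L * ‖x - y‖ := by
      intro x hx y hy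
      have := hlip y (ball_subset_ball r1 hy) x (ball_subset_ball r1 hx)
      rw [norm_sub_rev]
      have e1 := S.uu_fix hl (hne x hx)
      have e2 := S.uu_fix hl (hne y hy)
      unfold TV at e1 e2
      rwa [e1, e2] at this
    have hn1 : ∀ x ∈ ball x₀ ρ, ∀ y ∈ ball x₀ ρ, ‖x - y‖ ≤ 1 := by
      intro x hx y hy
      rw [mem_ball] at hx hy
      have := dist_triangle_right x y x₀
      rw [← dist_eq_norm]; linarith
    have hc0 : x₀ ∈ ball x₀ ρ := mem_ball_self hρ0
    set M := S.uu l x₀ + L with hM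
    have hu0 := S.uu_pos hl hx₀
    have hM0 : 0 < M := by linarith
    have huM : ∀ x ∈ ball x₀ ρ, S.uu l x ≤ M := by
      intro x hx
      have h1 := (abs_le.mp (hud x₀ hc0 x hx)).2
      have h2 := mul_le_mul_of_nonneg_left (hn1 x₀ hc0 x hx) hL
      linarith
    set Q := V x₀ + D with hQ
    have hD : (0:ℝ) ≤ D := D.2
    have hV0 := S.hV0 x₀ hx₀
    have hVQ : ∀ x ∈ ball x₀ ρ, V x ≤ Q := by
      intro x hx
      have h1 := (abs_le.mp (hVd x₀ hc0 x hx)).2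
      have h3 := rpow_le_one (norm_nonneg _) (hn1 x₀ hc0 x hx) hα'.le
      have h2 := mul_le_mul_of_nonneg_left h3 hD
      linarith
    have hQ0 : 0 ≤ Q := by linarith
    refine ⟨ρ, D * M ^ p + Q * (p * M ^ (p - 1) * L), α, hρ0, by positivity, hα', fun x hx y hy => ?_⟩
    have ux := S.uu_pos hl (hne x hx)
    have uy := S.uu_pos hl (hne y hy)
    have h1 := abs_rpow_sub_le hp uy.le ux.le (huM y hy) (huM x hx)
    have h2 : ‖x - y‖ ≤ ‖x - y‖ ^ (α:ℝ) := by
      rcases (norm_nonneg (x - y)).eq_or_lt with h | h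
      · rw [← h]; positivity
      · calc ‖x - y‖ = ‖x - y‖ ^ (1:ℝ) := (rpow_one _).symm
          _ ≤ _ := rpow_le_rpow_of_exponent_ge h (hn1 x hx y hy) hα1'
    have h3 : |S.uu l y ^ p - S.uu l x ^ p| ≤ p * M ^ (p - 1) * (L * ‖x - y‖ ^ (α:ℝ)) := by
      refine h1.trans ?_
      have := (hud x hx y hy).trans (mul_le_mul_of_nonneg_left h2 hL)
      gcongr
    have h4 : S.uu l y ^ p ≤ M ^ p := rpow_le_rpow uy.le (huM y hy) hp0.le
    have h5 : 0 ≤ S.uu l y ^ p := rpow_nonneg uy.le _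
    have h6 := S.hV0 x (hne x hx)
    calc |V y * S.uu l y ^ p - V x * S.uu l x ^ p|
        = |(V y - V x) * S.uu l y ^ p + V x * (S.uu l y ^ p - S.uu l x ^ p)| := by congr 1; ring
      _ ≤ |V y - V x| * S.uu l y ^ p + V x * |S.uu l y ^ p - S.uu l x ^ p| := by
          refine (abs_add_le _ _).trans (le_of_eq ?_)
          rw [abs_mul, abs_mul, abs_of_nonneg h5, abs_of_nonneg h6]
      _ ≤ (D * ‖x - y‖ ^ (α:ℝ)) * M ^ p + Q * (p * M ^ (p - 1) * (L * ‖x - y‖ ^ (α:ℝ))) := by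
          refine add_le_add ?_ ?_
          · exact mul_le_mul (hVd x hx y hy) h4 h5 (by positivity)
          · exact mul_le_mul (hVQ x hx) h3 (abs_nonneg _) hQ0
      _ = _ := by ring
  obtain ⟨ρ, H, α, hρ, hH, hα, hol⟩ := key
  obtain ⟨h1, h2⟩ := Gr_R2 S.P.hN hf hx₀ hρ hH hα hol
  refine ⟨h1.congr_of_eventuallyEq hev.symm, ?_⟩
  rw [lap_congr hev.symm, h2]

lemma uu_fast (hV : LocHolderOn V {0}ᶜ) {l : ℝ} (hl : l0 ≤ l) : FastDecaySol N p V (S.uu l) (S.nu l) :=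
  ⟨fun _ hx => (S.uu_reg hV hl hx).1.contDiffWithinAt, fun _ hx => S.uu_pos hl hx,
    fun _ hx => (S.uu_reg hV hl hx).2, S.uu_asym hl⟩

end Setup

lemma final {V w : Sp N → ℝ} {τ η l0 θ r C' C K : ℝ} (S : Setup N p a c t m V w τ η l0 θ r C' C K)
    (hV : LocHolderOn V {0}ᶜ) (ha : a = 2 / (p - 1)) (hc : c = cp N p) :
    ∃ ν₀ : ℝ, 0 < ν₀ ∧ ∃ u : ℝ → EuclideanSpace ℝ (Fin N) → ℝ,
      (∀ ν ∈ Set.Ioc (0:ℝ) ν₀, FastDecaySol N p V (u ν) ν ∧ SingAtOrigin N p (u ν)) ∧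
      (∀ ν ν' : ℝ, 0 < ν → ν ≤ ν' → ν' ≤ ν₀ →
        ∀ x : EuclideanSpace ℝ (Fin N), x ≠ 0 → u ν x ≤ u ν' x) ∧
      (∀ x : EuclideanSpace ℝ (Fin N), x ≠ 0 →
        ContinuousOn (fun ν => u ν x) (Set.Ioc (0:ℝ) ν₀)) ∧
      (∀ K : Set (EuclideanSpace ℝ (Fin N)), IsCompact K → K ⊆ {0}ᶜ →
        ∀ ε : ℝ, 0 < ε → ∃ δ : ℝ, 0 < δ ∧
          ∀ ν ∈ Set.Ioc (0:ℝ) ν₀, ν < δ → ∀ x ∈ K, u ν x < ε) := by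
  have hex : ∀ ν : ℝ, ∃ l, ν ∈ Ioc 0 (S.nu l0) → l0 ≤ l ∧ S.nu l = ν := by
    intro ν
    by_cases h : ν ∈ Ioc 0 (S.nu l0)
    · obtain ⟨l, hl⟩ := S.ex_lam h
      exact ⟨l, fun _ => hl⟩
    · exact ⟨0, fun h' => absurd h' h⟩
  choose lam hlam using hex
  refine ⟨S.nu l0, S.nu_pos le_rfl, fun ν => S.uu (lam ν), ?_, ?_, ?_, ?_⟩
  · intro ν hν
    obtain ⟨h1, h2⟩ := hlam ν hν
    refine ⟨?_, ?_⟩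
    · have := S.uu_fast hV h1
      rwa [h2] at this
    · have := S.uu_sing h1
      unfold SingAtOrigin
      rw [← ha, ← hc]
      exact this
  · intro ν ν' h0 hle h1 x hx
    obtain ⟨a1, a2⟩ := hlam ν ⟨h0, hle.trans h1⟩
    obtain ⟨b1, b2⟩ := hlam ν' ⟨h0.trans_le hle, h1⟩
    rcases le_total (lam ν') (lam ν) with h | h
    · exact S.uu_anti b1 h hx
    · have := S.nu_anti a1 h
      exact (S.uu_same' a1 b1 (by linarith) hx).le
  · intro x hx
    have hcl : ∀ L, l0 ≤ L → ContinuousOn (fun ν => S.uu (lam ν) x) (Icc (S.nu L) (S.nu l0)) := by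
      intro L hL
      rw [continuousOn_iff_isClosed]
      intro T hT
      have hcont : ContinuousOn (fun l => S.uu l x) (Icc l0 L) := (S.uu_cont hx).mono Icc_subset_Ici_self
      have hcomp : IsCompact (Icc l0 L ∩ (fun l => S.uu l x) ⁻¹' T) :=
        (isCompact_Icc.of_isClosed_subset (hcont.preimage_isClosed_of_isClosed isClosed_Icc hT)
          inter_subset_left)
      refine ⟨S.nu '' (Icc l0 L ∩ (fun l => S.uu l x) ⁻¹' T), ?_, ?_⟩
      · exact (hcomp.image_of_continuousOn (S.nu_cont.mono
          (inter_subset_left.trans Icc_subset_Ici_self))).isClosed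
      · ext ν
        constructor
        · rintro ⟨h1, h2⟩
          obtain ⟨a1, a2⟩ := hlam ν ⟨(S.nu_pos hL).trans_le h2.1, h2.2⟩
          obtain ⟨l, b1, b2⟩ := S.ivt hL h2
          refine ⟨⟨l, ⟨b1, ?_⟩, b2⟩, h2⟩
          change S.uu l x ∈ T
          rw [S.uu_same' b1.1 a1 (b2.trans a2.symm) hx]
          exact h1
        · rintro ⟨⟨l, ⟨b1, b3⟩, b2⟩, h2⟩
          obtain ⟨a1, a2⟩ := hlam ν ⟨(S.nu_pos hL).trans_le h2.1, h2.2⟩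
          refine ⟨?_, h2⟩
          change S.uu (lam ν) x ∈ T
          rw [← S.uu_same' b1.1 a1 (b2.trans a2.symm) hx]
          exact b3
    intro ν hν
    obtain ⟨L, h1, h2⟩ := S.ex_small hν.1
    have := hcl L h1 ν ⟨h2.le, hν.2⟩
    refine this.mono_of_mem_nhdsWithin ?_
    filter_upwards [self_mem_nhdsWithin, mem_nhdsWithin_of_mem_nhds (lt_mem_nhds h2)] with ν' h3 h4
    exact ⟨le_of_lt h4, h3.2⟩
  · intro Q hQ hQ0 ε hε
    rcases Q.eq_empty_or_nonempty with rfl | hne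
    · exact ⟨1, one_pos, fun _ _ _ x hx => absurd hx (notMem_empty x)⟩
    obtain ⟨x₁, hx₁, hmin⟩ := hQ.exists_isMinOn hne continuous_norm.continuousOn
    have hd : 0 < ‖x₁‖ := norm_pos_iff.mpr (hQ0 hx₁)
    have hlim := S.dec_lim (2 * C * ‖x₁‖ ^ (2 - (N:ℝ)))
    obtain ⟨L, ⟨h1, h2⟩, h3⟩ := (((hlim.eventually (gt_mem_nhds hε)).and
      (eventually_ge_atTop l0)).and (eventually_ge_atTop (1 / ‖x₁‖))).exists
    refine ⟨S.nu L, S.nu_pos h2, fun ν hν hlt x hx => ?_⟩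
    obtain ⟨a1, a2⟩ := hlam ν hν
    have hL : L ≤ lam ν := by
      by_contra hcon
      have := S.nu_anti a1 (not_le.mp hcon).le
      linarith
    have hxx : ‖x₁‖ ≤ ‖x‖ := hmin hx
    have hLp := S.lpos h2
    have h5 : 1 ≤ L * ‖x‖ := ((div_le_iff₀ hd).mp h3).trans (by gcongr)
    refine lt_of_le_of_lt ((S.uu_anti h2 hL (hQ0 hx)).trans ((S.uu_decay h2 h5).trans ?_)) h1
    have hN3 : (3:ℝ) ≤ N := by exact_mod_cast S.P.hN
    have := rpow_antitone_exp hd hxx (by linarith : 2 - (N:ℝ) ≤ 0)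
    have hC := S.hC
    gcongr
end

/-- Theorem 1.1, existence of a family of fast decaying solutions. -/
theorem statement_0 (N : ℕ) (hN : 3 ≤ N) (p : ℝ)
    (hp : p ∈ Set.Ioo ((N:ℝ) / ((N:ℝ) - 2)) (pc N))
    (V : EuclideanSpace ℝ (Fin N) → ℝ) (c₀ τ₀ cinf β : ℝ)
    (hV : V0cond N V c₀ τ₀ cinf β)
    (hτ : tauStar N p < τ₀) (hβ : β < ((N:ℝ) - 2) * p - N) :
    ∃ ν₀ : ℝ, 0 < ν₀ ∧ ∃ u : ℝ → EuclideanSpace ℝ (Fin N) → ℝ,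
      (∀ ν ∈ Set.Ioc (0:ℝ) ν₀, FastDecaySol N p V (u ν) ν ∧ SingAtOrigin N p (u ν)) ∧
      (∀ ν ν' : ℝ, 0 < ν → ν ≤ ν' → ν' ≤ ν₀ →
        ∀ x : EuclideanSpace ℝ (Fin N), x ≠ 0 → u ν x ≤ u ν' x) ∧
      (∀ x : EuclideanSpace ℝ (Fin N), x ≠ 0 →
        ContinuousOn (fun ν => u ν x) (Set.Ioc (0:ℝ) ν₀)) ∧
      (∀ K : Set (EuclideanSpace ℝ (Fin N)), IsCompact K → K ⊆ {0}ᶜ →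
        ∀ ε : ℝ, 0 < ε → ∃ δ : ℝ, 0 < δ ∧
          ∀ ν ∈ Set.Ioc (0:ℝ) ν₀, ν < δ → ∀ x ∈ K, u ν x < ε) := by
  obtain ⟨w, τ, η, l0, θ, r, C', C, K, S⟩ := setup_exists (par_exists hN hp) hV hτ hβ
  exact final S hV.1 rfl rfl
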